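/- Let m ∈ ℕ, a ∈ ℝ, 0 ≤ ℓ < d, and let either 1 < p < ∞ and m > d/p, or p = 1 and m ≥ d. Then for every natural number n > 1 and every u ∈ 𝒦^m_{a,p}(ℝ^d,ℝ^ℓ_*) one has u^n ∈ 𝒦^m_{na − d(n−1)/p, p}(ℝ^d,ℝ^ℓ_*), together with the estimate ‖u^n | 𝒦^m_{na − d(n−1)/p, p}(ℝ^d,ℝ^ℓ_*)‖ ≤ c^{n−1} ‖u | 𝒦^m_{a,p}(ℝ^d,ℝ^ℓ_*)‖^n, where c is a constant independent of u and n (the constant of the bilinear product estimate for these parameters). -/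

import Mathlib

open MeasureTheory Metric Set Filter
open scoped Topology ENNReal NNReal

noncomputable section

/-- `d`-dimensional Euclidean space. -/
abbrev Ed (d : ℕ) : Type := EuclideanSpace ℝ (Fin d)

/-- The finite set of all multi-indices `α : Fin d → ℕ` with `|α| = ∑ i, α i ≤ m`. -/
def multiIdx (d m : ℕ) : Finset (Fin d → ℕ) :=
  (Fintype.piFinset fun _ : Fin d => Finset.range (m + 1)).filter fun α => ∑ i, α i ≤ m

/-- First-order partial derivative in the `i`-th coordinate direction. -/
def pderivI (d : ℕ) (i : Fin d) (f : Ed d → ℝ) : Ed d → ℝ :=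
  fun x => fderiv ℝ f x (EuclideanSpace.single i 1)

/-- Iterated partial derivative `∂^α`. -/
def pderivA (d : ℕ) (α : Fin d → ℕ) (f : Ed d → ℝ) : Ed d → ℝ :=
  ((List.finRange d).foldr (fun i g => (pderivI d i)^[α i] ∘ g) id) f

/-- Smooth compactly supported test functions with support inside `Ω`. -/
def IsTestFun (d : ℕ) (Ω : Set (Ed d)) (φ : Ed d → ℝ) : Prop :=
  ContDiff ℝ (⊤ : ℕ∞) φ ∧ HasCompactSupport φ ∧ tsupport φ ⊆ Ω

/-- `v` is the `α`-th weak (distributional) derivative of `u` on `Ω`. -/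
def HasWeakDerivOn (d : ℕ) (Ω : Set (Ed d)) (α : Fin d → ℕ) (u v : Ed d → ℝ) : Prop :=
  LocallyIntegrableOn u Ω volume ∧ LocallyIntegrableOn v Ω volume ∧
    ∀ φ : Ed d → ℝ, IsTestFun d Ω φ →
      ∫ x in Ω, u x * pderivA d α φ x = (-1 : ℝ) ^ (∑ i, α i) * ∫ x in Ω, v x * φ x

/-- `D` is a family of weak derivatives of `u` on `Ω` for all multi-indices of order `≤ m`. -/
def IsWeakDerivFamily (d : ℕ) (Ω : Set (Ed d)) (m : ℕ) (u : Ed d → ℝ)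
    (D : (Fin d → ℕ) → Ed d → ℝ) : Prop :=
  ∀ α ∈ multiIdx d m, HasWeakDerivOn d Ω α u (D α)

/-- `x ↦ (ρ(x)^(|α|-a) |v(x)|)^p`, the integrand in the Kondratiev norm. -/
def kIntegrand (d : ℕ) (ρ : Ed d → ℝ) (a p : ℝ) (α : Fin d → ℕ) (v : Ed d → ℝ) : Ed d → ℝ :=
  fun x => (ρ x ^ (((∑ i, α i : ℕ) : ℝ) - a) * |v x|) ^ p

/-- The Kondratiev norm computed from a family `D` of weak derivatives. -/
def KnormP (d : ℕ) (Ω : Set (Ed d)) (ρ : Ed d → ℝ) (m : ℕ) (a p : ℝ)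
    (D : (Fin d → ℕ) → Ed d → ℝ) : ℝ :=
  (∑ α ∈ multiIdx d m, ∫ x in Ω, kIntegrand d ρ a p α (D α) x) ^ (1 / p)

/-- `D` witnesses membership of `u` in the Kondratiev space `𝒦^m_{a,p}(Ω, M)`
    (with weight function `ρ`). -/
def KMemData (d : ℕ) (Ω : Set (Ed d)) (ρ : Ed d → ℝ) (m : ℕ) (a p : ℝ)
    (u : Ed d → ℝ) (D : (Fin d → ℕ) → Ed d → ℝ) : Prop :=
  IsWeakDerivFamily d Ω m u D ∧
    ∀ α ∈ multiIdx d m, IntegrableOn (kIntegrand d ρ a p α (D α)) Ω volume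

/-- Membership in the Kondratiev space `𝒦^m_{a,p}(Ω, M)` with weight `ρ`, `p < ∞`. -/
def MemK (d : ℕ) (Ω : Set (Ed d)) (ρ : Ed d → ℝ) (m : ℕ) (a p : ℝ) (u : Ed d → ℝ) : Prop :=
  ∃ D, KMemData d Ω ρ m a p u D

open Classical in
/-- The Kondratiev norm of `u` (computed from a choice of weak derivative family;
    it is a.e. independent of this choice). -/
def Knorm (d : ℕ) (Ω : Set (Ed d)) (ρ : Ed d → ℝ) (m : ℕ) (a p : ℝ) (u : Ed d → ℝ) : ℝ :=
  if h : MemK d Ω ρ m a p u then KnormP d Ω ρ m a p h.choose else 0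

/-- `x ↦ ρ(x)^(|α|-a) v(x)`, the function whose `L_∞` norm enters the norm for `p = ∞`. -/
def kIntegrandInf (d : ℕ) (ρ : Ed d → ℝ) (a : ℝ) (α : Fin d → ℕ) (v : Ed d → ℝ) : Ed d → ℝ :=
  fun x => ρ x ^ (((∑ i, α i : ℕ) : ℝ) - a) * v x

/-- `D` witnesses membership of `u` in `𝒦^m_{a,∞}(Ω, M)`. -/
def KMemDataInf (d : ℕ) (Ω : Set (Ed d)) (ρ : Ed d → ℝ) (m : ℕ) (a : ℝ)
    (u : Ed d → ℝ) (D : (Fin d → ℕ) → Ed d → ℝ) : Prop :=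
  IsWeakDerivFamily d Ω m u D ∧
    ∀ α ∈ multiIdx d m,
      eLpNorm (kIntegrandInf d ρ a α (D α)) ⊤ (volume.restrict Ω) < ⊤

/-- Membership in `𝒦^m_{a,∞}(Ω, M)`. -/
def MemKInf (d : ℕ) (Ω : Set (Ed d)) (ρ : Ed d → ℝ) (m : ℕ) (a : ℝ) (u : Ed d → ℝ) : Prop :=
  ∃ D, KMemDataInf d Ω ρ m a u D

/-- The `𝒦^m_{a,∞}` norm computed from a family `D` of weak derivatives. -/
def KnormInfP (d : ℕ) (Ω : Set (Ed d)) (ρ : Ed d → ℝ) (m : ℕ) (a : ℝ)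
    (D : (Fin d → ℕ) → Ed d → ℝ) : ℝ :=
  ∑ α ∈ multiIdx d m, (eLpNorm (kIntegrandInf d ρ a α (D α)) ⊤ (volume.restrict Ω)).toReal

open Classical in
/-- The `𝒦^m_{a,∞}(Ω, M)` norm of `u`. -/
def KnormInf (d : ℕ) (Ω : Set (Ed d)) (ρ : Ed d → ℝ) (m : ℕ) (a : ℝ) (u : Ed d → ℝ) : ℝ :=
  if h : MemKInf d Ω ρ m a u then KnormInfP d Ω ρ m a h.choose else 0

/-- The subspace `ℝ^ℓ_* = {x : x₁ = ⋯ = x_{d-ℓ} = 0}` of `ℝ^d`. -/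
def RStar (d ℓ : ℕ) : Set (Ed d) := {x | ∀ i : Fin d, (i : ℕ) < d - ℓ → x i = 0}

/-- The weight `ρ(x) = min(1, |x'|)` for the model case `(ℝ^d, ℝ^ℓ_*)`. -/
def rhoModel (d ℓ : ℕ) (x : Ed d) : ℝ :=
  min 1 (Real.sqrt (∑ i ∈ Finset.univ.filter (fun i : Fin d => (i : ℕ) < d - ℓ), (x i) ^ 2))

/-- The model domain `ℝ^d ∖ ℝ^ℓ_*`. -/
def ModelDomain (d ℓ : ℕ) : Set (Ed d) := (RStar d ℓ)ᶜ

/-- Membership in the model Kondratiev space `𝒦^m_{a,p}(ℝ^d, ℝ^ℓ_*)`, `p < ∞`. -/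
def MemKM (d ℓ m : ℕ) (a p : ℝ) (u : Ed d → ℝ) : Prop :=
  MemK d (ModelDomain d ℓ) (rhoModel d ℓ) m a p u

/-- The norm of the model Kondratiev space `𝒦^m_{a,p}(ℝ^d, ℝ^ℓ_*)`, `p < ∞`. -/
def KnormM (d ℓ m : ℕ) (a p : ℝ) (u : Ed d → ℝ) : ℝ :=
  Knorm d (ModelDomain d ℓ) (rhoModel d ℓ) m a p u

/-- Membership in the model Kondratiev space `𝒦^m_{a,∞}(ℝ^d, ℝ^ℓ_*)`. -/
def MemKMInf (d ℓ m : ℕ) (a : ℝ) (u : Ed d → ℝ) : Prop :=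
  MemKInf d (ModelDomain d ℓ) (rhoModel d ℓ) m a u

/-- The norm of the model Kondratiev space `𝒦^m_{a,∞}(ℝ^d, ℝ^ℓ_*)`. -/
def KnormMInf (d ℓ m : ℕ) (a : ℝ) (u : Ed d → ℝ) : ℝ :=
  KnormInf d (ModelDomain d ℓ) (rhoModel d ℓ) m a u

open scoped ContDiff

/-- Iterated partial derivative along a list of directions. -/
def pderivL (d : ℕ) (L : List (Fin d)) (f : Ed d → ℝ) : Ed d → ℝ := L.foldr (pderivI d) f

/-- The list of directions attached to a multi-index. -/
def idxList (d : ℕ) (α : Fin d → ℕ) : List (Fin d) :=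
  (List.finRange d).flatMap fun i => List.replicate (α i) i

theorem pderivA_eq (d : ℕ) (α : Fin d → ℕ) (f : Ed d → ℝ) :
    pderivA d α f = pderivL d (idxList d α) f := by
  unfold pderivA pderivL idxList
  generalize List.finRange d = L
  induction L with
  | nil => simp
  | cons i L ih =>
    simp only [List.foldr_cons, List.flatMap_cons, List.foldr_append, Function.comp]
    rw [ih]
    generalize (List.foldr (pderivI d) f (List.flatMap (fun i => List.replicate (α i) i) L)) = g
    induction α i with
    | zero => simp
    | succ n ihn => rw [Function.iterate_succ_apply', ihn, List.replicate_succ, List.foldr_cons]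

theorem idxList_length (d : ℕ) (α : Fin d → ℕ) : (idxList d α).length = ∑ i, α i := by
  unfold idxList
  rw [List.length_flatMap]
  simp only [List.length_replicate]
  rw [← List.ofFn_eq_map, List.sum_ofFn]

theorem idxList_count (d : ℕ) (α : Fin d → ℕ) (j : Fin d) : (idxList d α).count j = α j := by
  unfold idxList
  rw [List.count_flatMap]
  have : (List.count j ∘ fun i => List.replicate (α i) i) = fun i => if i = j then α i else 0 := by
    funext i
    simp [List.count_replicate]
  rw [this, ← List.ofFn_eq_map, List.sum_ofFn]
  simp

theorem pderivI_contDiff {d : ℕ} (i : Fin d) {f : Ed d → ℝ} (hf : ContDiff ℝ ∞ f) :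
    ContDiff ℝ ∞ (pderivI d i f) := by
  unfold pderivI
  exact (hf.fderiv_right (m := ∞) (by simp)).clm_apply contDiff_const

theorem pderivL_contDiff {d : ℕ} (L : List (Fin d)) {f : Ed d → ℝ} (hf : ContDiff ℝ ∞ f) :
    ContDiff ℝ ∞ (pderivL d L f) := by
  induction L with
  | nil => exact hf
  | cons i L ih => exact pderivI_contDiff i ih

theorem pderivA_contDiff {d : ℕ} (α : Fin d → ℕ) {f : Ed d → ℝ} (hf : ContDiff ℝ ∞ f) :
    ContDiff ℝ ∞ (pderivA d α f) := by
  rw [pderivA_eq]; exact pderivL_contDiff _ hf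

theorem pderivL_eq_iter {d : ℕ} (L : List (Fin d)) {f : Ed d → ℝ} (hf : ContDiff ℝ ∞ f) (x : Ed d) :
    pderivL d L f x = iteratedFDeriv ℝ L.length f x
      (fun k => EuclideanSpace.single (L.get k) (1 : ℝ)) := by
  induction L generalizing x with
  | nil => simp [pderivL]
  | cons i L ih =>
    have h1 : pderivL d (i :: L) f = pderivI d i (pderivL d L f) := rfl
    have h2 : pderivL d L f = fun x => iteratedFDeriv ℝ L.length f x
      (fun k => EuclideanSpace.single (L.get k) (1 : ℝ)) := funext ih
    rw [h1, h2]
    unfold pderivI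
    have h3 : DifferentiableAt ℝ (iteratedFDeriv ℝ L.length f) x :=
      (hf.differentiable_iteratedFDeriv (m := L.length) (by exact_mod_cast ENat.natCast_lt_top _)) x
    rw [fderiv_continuousMultilinear_apply_const_apply h3]
    exact (iteratedFDeriv_succ_apply_left (𝕜 := ℝ) (f := f) (x := x) (n := L.length)
      (fun k => EuclideanSpace.single ((i :: L).get k) (1 : ℝ))).symm

theorem abs_pderivA_le {d : ℕ} (α : Fin d → ℕ) {f : Ed d → ℝ} (hf : ContDiff ℝ ∞ f) (x : Ed d) :
    ‖pderivA d α f x‖ₑ ≤ ‖iteratedFDeriv ℝ (∑ i, α i) f x‖ₑ := by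
  rw [pderivA_eq, pderivL_eq_iter _ hf, ← idxList_length]
  rw [enorm_le_iff_norm_le]
  refine (ContinuousMultilinearMap.le_opNorm _ _).trans ?_
  simp

theorem pderivI_comm {d : ℕ} (i j : Fin d) {f : Ed d → ℝ} (hf : ContDiff ℝ ∞ f) :
    pderivI d i (pderivI d j f) = pderivI d j (pderivI d i f) := by
  funext x
  have := pderivL_eq_iter [i, j] hf x
  have h' := pderivL_eq_iter [j, i] hf x
  have hs : IsSymmSndFDerivAt ℝ f x := (hf.contDiffAt (x := x)).isSymmSndFDerivAt
    (by simp only [minSmoothness_of_isRCLikeNormedField]; exact WithTop.coe_le_coe.2 (le_top : (2 : ℕ∞) ≤ ⊤))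
  have hd : DifferentiableAt ℝ (fderiv ℝ f) x :=
    ((hf.fderiv_right (m := ∞) (by simp)).differentiable (by simp)) x
  unfold pderivI
  rw [fderiv_clm_apply hd (by fun_prop), fderiv_clm_apply hd (by fun_prop)]
  simp
  exact hs _ _

theorem pderivL_perm {d : ℕ} {L L' : List (Fin d)} (h : L.Perm L') {f : Ed d → ℝ}
    (hf : ContDiff ℝ ∞ f) : pderivL d L f = pderivL d L' f := by
  induction h with
  | nil => rfl
  | cons i _ ih => exact congrArg (pderivI d i) ih
  | swap i j L => exact pderivI_comm _ _ (pderivL_contDiff L hf)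
  | trans _ _ ih1 ih2 => exact ih1.trans ih2

theorem mem_multiIdx {d m : ℕ} {α : Fin d → ℕ} : α ∈ multiIdx d m ↔ ∑ i, α i ≤ m := by
  unfold multiIdx
  simp only [Finset.mem_filter, Fintype.mem_piFinset, Finset.mem_range, and_iff_right_iff_imp]
  intro h i
  have := Finset.single_le_sum (f := α) (fun i _ => Nat.zero_le _) (Finset.mem_univ i)
  omega

theorem iter_le_sum {d m k : ℕ} (hk : k ≤ m) {f : Ed d → ℝ} (hf : ContDiff ℝ ∞ f) (x : Ed d) :
    ‖iteratedFDeriv ℝ k f x‖ₑ ≤ (d ^ k : ℕ) *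
      ∑ α ∈ (multiIdx d m).filter (fun α => ∑ i, α i = k), ‖pderivA d α f x‖ₑ := by
  have key : ∀ I : Fin k → Fin d, ‖iteratedFDeriv ℝ k f x (fun j => EuclideanSpace.single (I j) (1 : ℝ))‖
      ≤ ∑ α ∈ (multiIdx d m).filter (fun α => ∑ i, α i = k), ‖pderivA d α f x‖ := by
    intro I
    set L := List.ofFn I
    set α : Fin d → ℕ := fun j => L.count j
    have hL : L.length = k := by simp [L]
    have h1 : iteratedFDeriv ℝ k f x (fun j => EuclideanSpace.single (I j) (1 : ℝ)) = pderivA d α f x := by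
      rw [pderivA_eq]
      have hp : (idxList d α).Perm L := by
        rw [List.perm_iff_count]
        intro j
        rw [idxList_count]
      rw [pderivL_perm hp hf, pderivL_eq_iter L hf]
      have gen : ∀ (n : ℕ) (hn : n = k), iteratedFDeriv ℝ k f x (fun j => EuclideanSpace.single (I j) (1 : ℝ))
         = iteratedFDeriv ℝ n f x (fun j => EuclideanSpace.single (I (Fin.cast hn j)) (1 : ℝ)) := by
        rintro n rfl; rfl
      rw [gen _ hL]
      congr 1
      funext j
      simp [L]
      rfl
    have h2 : ∑ i, α i = k := by
      rw [← hL, ← idxList_length]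
      apply List.Perm.length_eq
      rw [List.perm_iff_count]
      intro j
      rw [idxList_count]
    rw [h1]
    apply Finset.single_le_sum (f := fun α => ‖pderivA d α f x‖) (fun _ _ => norm_nonneg _)
    rw [Finset.mem_filter, mem_multiIdx]
    exact ⟨by omega, h2⟩
  have : ‖iteratedFDeriv ℝ k f x‖ ≤ (d ^ k : ℕ) *
      ∑ α ∈ (multiIdx d m).filter (fun α => ∑ i, α i = k), ‖pderivA d α f x‖ := by
    refine ContinuousMultilinearMap.opNorm_le_bound (by positivity) (fun v => ?_)
    have hv : ∀ j, v j = ∑ i, v j i • EuclideanSpace.single i (1 : ℝ) := by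
      intro j
      ext l
      simp [Finset.sum_apply, Pi.single_apply]
    have : iteratedFDeriv ℝ k f x v = ∑ I : Fin k → Fin d, (∏ j, v j (I j)) *
        iteratedFDeriv ℝ k f x (fun j => EuclideanSpace.single (I j) (1 : ℝ)) := by
      conv_lhs => rw [show v = fun j => ∑ i, v j i • EuclideanSpace.single i (1 : ℝ) from funext hv]
      rw [ContinuousMultilinearMap.map_sum]
      simp_rw [ContinuousMultilinearMap.map_smul_univ, smul_eq_mul]
    rw [this]
    refine (norm_sum_le _ _).trans ?_
    set S := ∑ α ∈ (multiIdx d m).filter (fun α => ∑ i, α i = k), ‖pderivA d α f x‖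
    have hb : ∀ I : Fin k → Fin d, ‖(∏ j, v j (I j)) *
        iteratedFDeriv ℝ k f x (fun j => EuclideanSpace.single (I j) (1 : ℝ))‖ ≤ (∏ j, ‖v j‖) * S := by
      intro I
      rw [norm_mul, norm_prod]
      gcongr with j
      · exact PiLp.norm_apply_le _ _
      · exact key I
    refine (Finset.sum_le_sum (fun I _ => hb I)).trans ?_
    simp
    apply le_of_eq; ring
  rw [← ofReal_norm]
  refine (ENNReal.ofReal_le_ofReal this).trans ?_
  rw [ENNReal.ofReal_mul (by positivity), ENNReal.ofReal_natCast, ENNReal.ofReal_sum_of_nonneg (fun _ _ => norm_nonneg _)]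
  simp only [ofReal_norm]
  rfl

theorem pderivI_tsupport {d : ℕ} (i : Fin d) (f : Ed d → ℝ) :
    tsupport (pderivI d i f) ⊆ tsupport f := by
  unfold pderivI
  exact (tsupport_fderiv_apply_subset ℝ _)

theorem pderivL_tsupport {d : ℕ} (L : List (Fin d)) (f : Ed d → ℝ) :
    tsupport (pderivL d L f) ⊆ tsupport f := by
  induction L with
  | nil => exact subset_rfl
  | cons i L ih => exact (pderivI_tsupport i _).trans ih

theorem pderivL_hcs {d : ℕ} (L : List (Fin d)) {f : Ed d → ℝ} (hf : HasCompactSupport f) :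
    HasCompactSupport (pderivL d L f) :=
  hf.of_isClosed_subset (isClosed_tsupport _) (pderivL_tsupport L f)

theorem pderivL_sub {d : ℕ} (L : List (Fin d)) {f g : Ed d → ℝ} (hf : ContDiff ℝ ∞ f)
    (hg : ContDiff ℝ ∞ g) : pderivL d L (f - g) = pderivL d L f - pderivL d L g := by
  induction L with
  | nil => rfl
  | cons i L ih =>
    change pderivI d i (pderivL d L (f - g)) = _
    rw [ih]
    funext x
    change fderiv ℝ _ x _ = _
    rw [fderiv_sub ((pderivL_contDiff L hf).differentiable (by simp) x)
      ((pderivL_contDiff L hg).differentiable (by simp) x)]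
    rfl

theorem pderivL_sum {d : ℕ} {ι : Type*} (s : Finset ι) (L : List (Fin d)) {f : ι → Ed d → ℝ}
    (hf : ∀ j ∈ s, ContDiff ℝ ∞ (f j)) :
    pderivL d L (fun x => ∑ j ∈ s, f j x) = fun x => ∑ j ∈ s, pderivL d L (f j) x := by
  induction L with
  | nil => rfl
  | cons i L ih =>
    change pderivI d i (pderivL d L _) = _
    rw [ih]
    funext x
    change fderiv ℝ _ x _ = _
    rw [fderiv_fun_sum (fun j hj => (pderivL_contDiff L (hf j hj)).differentiable (by simp) x)]
    simp
    rfl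

theorem integrable_smooth_mul {d : ℕ} {h φ : Ed d → ℝ} (hh : Continuous h)
    (hφ : Continuous φ) (hc : HasCompactSupport φ) : Integrable (fun x => h x * φ x) :=
  (hh.mul hφ).integrable_of_hasCompactSupport (hc.mul_left)

theorem ibp_list {d : ℕ} (L : List (Fin d)) {h φ : Ed d → ℝ} (hh : ContDiff ℝ ∞ h)
    (hφ : ContDiff ℝ ∞ φ) (hc : HasCompactSupport φ) :
    ∫ x, h x * pderivL d L φ x = (-1 : ℝ) ^ L.length * ∫ x, pderivL d L.reverse h x * φ x := by
  induction L generalizing h with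
  | nil => simp [pderivL]
  | cons i L ih =>
    have hLφ := pderivL_contDiff L hφ
    have hLc := pderivL_hcs L hc
    have h1 : ∫ x, h x * pderivL d (i :: L) φ x = - ∫ x, pderivI d i h x * pderivL d L φ x := by
      change ∫ x, h x * fderiv ℝ (pderivL d L φ) x (EuclideanSpace.single i 1) =
        - ∫ x, fderiv ℝ h x (EuclideanSpace.single i 1) * pderivL d L φ x
      apply integral_mul_fderiv_eq_neg_fderiv_mul_of_integrable
      · exact integrable_smooth_mul (pderivI_contDiff i hh).continuous hLφ.continuous hLc
      · exact integrable_smooth_mul hh.continuous (pderivI_contDiff i hLφ).continuous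
          (pderivL_hcs [i] hLc)
      · exact integrable_smooth_mul hh.continuous hLφ.continuous hLc
      · exact fun x _ => hh.differentiable (by simp) x
      · exact fun x _ => hLφ.differentiable (by simp) x
    rw [h1, ih (pderivI_contDiff i hh)]
    have : pderivL d (i :: L).reverse h = pderivL d L.reverse (pderivI d i h) := by
      simp [pderivL]
    rw [this, List.length_cons, pow_succ]
    ring

theorem ibp {d : ℕ} (α : Fin d → ℕ) {h φ : Ed d → ℝ} (hh : ContDiff ℝ ∞ h)
    (hφ : ContDiff ℝ ∞ φ) (hc : HasCompactSupport φ) :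
    ∫ x, h x * pderivA d α φ x = (-1 : ℝ) ^ (∑ i, α i) * ∫ x, pderivA d α h x * φ x := by
  rw [pderivA_eq, pderivA_eq, ibp_list _ hh hφ hc, idxList_length,
    pderivL_perm (List.reverse_perm _) hh]

theorem pderivL_reflect {d : ℕ} (L : List (Fin d)) {φ : Ed d → ℝ} (hφ : ContDiff ℝ ∞ φ) (x : Ed d) :
    pderivL d L (fun y => φ (x - y)) = fun y => (-1 : ℝ) ^ L.length * pderivL d L φ (x - y) := by
  induction L with
  | nil => simp [pderivL]
  | cons i L ih =>
    change pderivI d i (pderivL d L _) = _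
    rw [ih]
    funext y
    have hd : DifferentiableAt ℝ (pderivL d L φ) (x - y) :=
      (pderivL_contDiff L hφ).differentiable (by simp) _
    have h1 : HasFDerivAt (fun y => (-1 : ℝ) ^ L.length * pderivL d L φ (x - y))
        ((-1 : ℝ) ^ L.length • (fderiv ℝ (pderivL d L φ) (x - y)).comp (-ContinuousLinearMap.id ℝ (Ed d))) y := by
      apply HasFDerivAt.const_mul
      apply HasFDerivAt.comp
      · exact hd.hasFDerivAt
      · simpa using (hasFDerivAt_id y).const_sub x
    unfold pderivI
    rw [h1.fderiv]
    change _ = _ * fderiv ℝ (pderivL d L φ) (x - y) _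
    simp [pow_succ]

/-- Mollification. -/
def moll (d : ℕ) (φ U : Ed d → ℝ) : Ed d → ℝ := fun x => ∫ t, U t * φ (x - t)

theorem moll_eq (d : ℕ) (φ U : Ed d → ℝ) :
    moll d φ U = convolution U φ (ContinuousLinearMap.mul ℝ ℝ) volume := rfl

theorem moll_contDiff {d : ℕ} {φ U : Ed d → ℝ} (hU : LocallyIntegrable U) (hφ : ContDiff ℝ ∞ φ)
    (hc : HasCompactSupport φ) : ContDiff ℝ ∞ (moll d φ U) := by
  rw [moll_eq]
  exact hc.contDiff_convolution_right _ hU hφ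

theorem pderivL_moll {d : ℕ} (L : List (Fin d)) {φ U : Ed d → ℝ} (hU : LocallyIntegrable U)
    (hφ : ContDiff ℝ ∞ φ) (hc : HasCompactSupport φ) :
    pderivL d L (moll d φ U) = moll d (pderivL d L φ) U := by
  induction L with
  | nil => rfl
  | cons i L ih =>
    change pderivI d i (pderivL d L _) = _
    rw [ih]
    funext x
    have hg := pderivL_contDiff L hφ
    have hgc := pderivL_hcs L hc
    have := hgc.hasFDerivAt_convolution_right (ContinuousLinearMap.mul ℝ ℝ) hU (hg.of_le (by simp)) x
    unfold pderivI
    rw [moll_eq, this.fderiv]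
    rw [convolution_precompR_apply _ hU (hgc.fderiv ℝ) (hg.continuous_fderiv (by simp))]
    rfl

/-- Derivatives of a mollification of a weakly differentiable function. -/
theorem pderivA_moll_weak {d : ℕ} {Ω K : Set (Ed d)} (hΩ : MeasurableSet Ω) (hK : MeasurableSet K)
    (hKΩ : K ⊆ Ω) {α : Fin d → ℕ} {u v : Ed d → ℝ}
    (hw : HasWeakDerivOn d Ω α u v) (hU : LocallyIntegrable (K.indicator u)) {φ : Ed d → ℝ}
    (hφ : ContDiff ℝ ∞ φ) (hc : HasCompactSupport φ) (x : Ed d)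
    (hx : ∀ y, x - y ∈ tsupport φ → y ∈ K) :
    pderivA d α (moll d φ (K.indicator u)) x = moll d φ (K.indicator v) x := by
  have ht : tsupport (fun y => φ (x - y)) ⊆ {y | x - y ∈ tsupport φ} := by
    apply closure_minimal
    · intro y hy
      exact subset_tsupport _ hy
    · exact (isClosed_tsupport φ).preimage (by fun_prop)
  have htest : IsTestFun d Ω (fun y => φ (x - y)) := by
    refine ⟨hφ.comp (by fun_prop), ?_, ?_⟩
    · exact hc.comp_homeomorph (Homeomorph.subLeft x)
    · exact fun y hy => hKΩ (hx y (ht hy))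
  have key := hw.2.2 _ htest
  have e1 : ∀ (w ψ : Ed d → ℝ), (∀ y, ψ (x - y) ≠ 0 → y ∈ K) → 
      ∫ y, K.indicator w y * ψ (x - y) = ∫ y in Ω, w y * ψ (x - y) := by
    intro w ψ h
    rw [← integral_indicator hΩ]
    congr 1
    funext y
    by_cases hy : y ∈ K
    · simp [hy, hKΩ hy]
    · have : ψ (x - y) = 0 := by by_contra h'; exact hy (h y h')
      simp [hy, this, indicator]
  rw [pderivA_eq, pderivL_moll _ hU hφ hc]
  unfold moll
  rw [e1 u, e1 v]
  · rw [pderivA_eq, pderivL_reflect _ hφ, idxList_length] at key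
    have h2 : ((-1 : ℝ) ^ (∑ i, α i)) ≠ 0 := by positivity
    apply mul_left_cancel₀ h2
    rw [← key, ← integral_const_mul]
    congr 1
    funext y
    ring
  · intro y hy
    exact hx y (subset_tsupport _ hy)
  · intro y hy
    exact hx y (pderivL_tsupport _ _ (subset_tsupport _ hy))

theorem jensen_w {X : Type*} [MeasurableSpace X] {μ : Measure X} {p : ℝ} (hp : 1 ≤ p)
    {a w : X → ℝ≥0∞} (ha : AEMeasurable a μ) (hw : AEMeasurable w μ) :
    (∫⁻ x, a x * w x ∂μ) ^ p ≤ (∫⁻ x, w x ∂μ) ^ (p - 1) * ∫⁻ x, a x ^ p * w x ∂μ := by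
  rcases hp.eq_or_lt with rfl | hp1
  · simp
  have hpq : p.HolderConjugate (p / (p - 1)) := Real.HolderConjugate.conjExponent hp1
  have hp0 : 0 < p := by linarith
  have h := ENNReal.lintegral_mul_le_Lp_mul_Lq μ hpq (f := fun x => a x * w x ^ (1 / p))
    (g := fun x => w x ^ ((p - 1) / p)) (ha.mul (hw.pow_const _)) (hw.pow_const _)
  have e1 : ∀ x, ((fun x => a x * w x ^ (1 / p)) * fun x => w x ^ ((p - 1) / p)) x = a x * w x := by
    intro x
    simp only [Pi.mul_apply]
    rw [mul_assoc, ← ENNReal.rpow_add_of_nonneg _ _ (by positivity) (div_nonneg (by linarith) hp0.le)]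
    rw [show 1 / p + (p - 1) / p = 1 by field_simp; ring]
    simp
  simp_rw [e1] at h
  have e2 : ∀ x, (a x * w x ^ (1 / p)) ^ p = a x ^ p * w x := by
    intro x
    rw [ENNReal.mul_rpow_of_nonneg _ _ hp0.le, ← ENNReal.rpow_mul]
    simp [hp0.ne']
  have e3 : ∀ x, (w x ^ ((p - 1) / p)) ^ (p / (p - 1)) = w x := by
    intro x
    rw [← ENNReal.rpow_mul]
    have : p - 1 ≠ 0 := by linarith
    rw [show (p - 1) / p * (p / (p - 1)) = 1 by field_simp]
    simp
  simp_rw [e2, e3] at h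
  have h' := ENNReal.rpow_le_rpow h hp0.le
  rw [ENNReal.mul_rpow_of_nonneg _ _ hp0.le, ← ENNReal.rpow_mul, ← ENNReal.rpow_mul] at h'
  rw [show 1 / (p / (p - 1)) * p = p - 1 by
    have : p - 1 ≠ 0 := by linarith
    field_simp, show 1 / p * p = 1 by field_simp, ENNReal.rpow_one, mul_comm] at h'
  exact h'

theorem eLpNorm_rpow {X : Type*} [MeasurableSpace X] {μ : Measure X} {p : ℝ} (hp : 1 ≤ p)
    {F : Type*} [NormedAddCommGroup F] (h : X → F) :
    eLpNorm h (ENNReal.ofReal p) μ ^ p = ∫⁻ x, ‖h x‖ₑ ^ p ∂μ := by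
  have hp0 : 0 < p := by linarith
  rw [eLpNorm_eq_lintegral_rpow_enorm_toReal (by simpa using hp0) (by simp)]
  rw [ENNReal.toReal_ofReal hp0.le, ← ENNReal.rpow_mul]
  simp [hp0.ne']

theorem eLpNorm_eq_l {X : Type*} [MeasurableSpace X] {μ : Measure X} {p : ℝ} (hp : 1 ≤ p)
    {F : Type*} [NormedAddCommGroup F] (h : X → F) :
    eLpNorm h (ENNReal.ofReal p) μ = (∫⁻ x, ‖h x‖ₑ ^ p ∂μ) ^ (1 / p) := by
  rw [← eLpNorm_rpow hp, ← ENNReal.rpow_mul]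
  have hp0 : 0 < p := by linarith
  simp [hp0.ne']

theorem one_le_ofReal {p : ℝ} (hp : 1 ≤ p) : 1 ≤ ENNReal.ofReal p := by
  rw [← ENNReal.ofReal_one]; exact ENNReal.ofReal_le_ofReal hp

/-- The mollifying kernel. -/
def mk (d : ℕ) (k : ℕ) : ContDiffBump (0 : Ed d) :=
  ⟨1 / (2 * ((k : ℝ) + 1)), 1 / ((k : ℝ) + 1), by positivity, by
    apply one_div_lt_one_div_of_lt <;> nlinarith [Nat.cast_nonneg (α := ℝ) k]⟩

def mker (d k : ℕ) : Ed d → ℝ := (mk d k).normed volume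

theorem mker_contDiff (d k : ℕ) : ContDiff ℝ ∞ (mker d k) := (mk d k).contDiff_normed
theorem mker_hcs (d k : ℕ) : HasCompactSupport (mker d k) := (mk d k).hasCompactSupport_normed
theorem mker_nonneg (d k : ℕ) (x : Ed d) : 0 ≤ mker d k x := (mk d k).nonneg_normed x
theorem mker_tsupport (d k : ℕ) : tsupport (mker d k) = closedBall 0 (1 / ((k : ℝ) + 1)) :=
  (mk d k).tsupport_normed_eq
theorem mker_support (d k : ℕ) : Function.support (mker d k) = ball 0 (1 / ((k : ℝ) + 1)) :=
  (mk d k).support_normed_eq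
theorem mker_lint (d k : ℕ) : ∫⁻ x, ENNReal.ofReal (mker d k x) = 1 := by
  rw [← ofReal_integral_eq_lintegral_ofReal]
  · unfold mker; rw [(mk d k).integral_normed]; simp
  · exact (mker_contDiff d k).continuous.integrable_of_hasCompactSupport (mker_hcs d k)
  · exact ae_of_all _ (mker_nonneg d k)

theorem moll_bound {d : ℕ} {p : ℝ} (hp : 1 ≤ p) {h : Ed d → ℝ} (hm : AEStronglyMeasurable h volume) (k : ℕ) :
    eLpNorm (moll d (mker d k) h) (ENNReal.ofReal p) volume ≤ eLpNorm h (ENNReal.ofReal p) volume := by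
  rw [eLpNorm_eq_l hp, eLpNorm_eq_l hp]
  apply ENNReal.rpow_le_rpow _ (by positivity)
  have hφc : Continuous (mker d k) := (mker_contDiff d k).continuous
  have h1 : ∀ x, ‖moll d (mker d k) h x‖ₑ ^ p ≤ ∫⁻ t, ‖h t‖ₑ ^ p * ENNReal.ofReal (mker d k (x - t)) := by
    intro x
    have : ‖moll d (mker d k) h x‖ₑ ≤ ∫⁻ t, ‖h t‖ₑ * ENNReal.ofReal (mker d k (x - t)) := by
      unfold moll
      refine (enorm_integral_le_lintegral_enorm _).trans (le_of_eq ?_)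
      congr 1; funext t
      rw [enorm_mul, Real.enorm_of_nonneg (mker_nonneg d k _)]
    refine (ENNReal.rpow_le_rpow this (by linarith)).trans ?_
    refine (jensen_w hp hm.enorm (by fun_prop)).trans ?_
    rw [lintegral_sub_left_eq_self (fun t => ENNReal.ofReal (mker d k t)) x, mker_lint]
    simp
  refine (lintegral_mono h1).trans ?_
  rw [lintegral_lintegral_swap]
  · apply lintegral_mono_ae
    refine ae_of_all _ fun t => ?_
    rw [lintegral_const_mul' _ _ ?_, lintegral_sub_right_eq_self (fun x => ENNReal.ofReal (mker d k x)) t, mker_lint, mul_one]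
    exact ENNReal.rpow_ne_top_of_nonneg (by linarith) enorm_ne_top
  · apply AEMeasurable.mul
    · exact (hm.enorm.pow_const p).comp_snd
    · exact (ENNReal.continuous_ofReal.comp (hφc.comp (continuous_fst.sub continuous_snd))).aemeasurable

theorem moll_eq' (d : ℕ) (φ U : Ed d → ℝ) :
    moll d φ U = convolution φ U (ContinuousLinearMap.lsmul ℝ ℝ) volume := by
  rw [← convolution_flip]
  funext x
  unfold moll convolution
  congr 1; funext t
  simp [mul_comm]

theorem moll_sub {d : ℕ} {φ g h : Ed d → ℝ} (hφ : Continuous φ) (hc : HasCompactSupport φ)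
    (hg : LocallyIntegrable g) (hh : LocallyIntegrable h) :
    moll d φ (g - h) = moll d φ g - moll d φ h := by
  funext x
  unfold moll
  simp only [Pi.sub_apply, sub_mul]
  rw [integral_sub]
  · exact (hc.convolutionExists_right (ContinuousLinearMap.mul ℝ ℝ) hg hφ x)
  · exact (hc.convolutionExists_right (ContinuousLinearMap.mul ℝ ℝ) hh hφ x)

theorem moll_tendsto_cont {d : ℕ} {p : ℝ} (hp : 1 ≤ p) {g : Ed d → ℝ} (hg : Continuous g)
    (hc : HasCompactSupport g) :
    Tendsto (fun k => eLpNorm (moll d (mker d k) g - g) (ENNReal.ofReal p) volume) atTop (𝓝 0) := by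
  have huc := hc.uniformContinuous_of_continuous hg
  rw [Metric.uniformContinuous_iff] at huc
  set S := cthickening 1 (tsupport g)
  have hSc : IsCompact S := hc.isCompact.cthickening
  set V := volume S
  have hV : V ≠ ⊤ := hSc.measure_lt_top.ne
  rw [ENNReal.tendsto_atTop_zero]
  intro ε hε
  have hbd : ∀ η : ℝ, 0 < η → ∃ N : ℕ, ∀ k ≥ N, eLpNorm (moll d (mker d k) g - g) (ENNReal.ofReal p) volume
      ≤ V ^ (1 / p) * ENNReal.ofReal η := by
    intro η hη
    obtain ⟨δ, hδ, hδ'⟩ := huc η hη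
    obtain ⟨N, hN⟩ := exists_nat_one_div_lt hδ
    refine ⟨N, fun k hk => ?_⟩
    have hkδ : 1 / ((k : ℝ) + 1) ≤ δ := by
      refine le_trans ?_ hN.le
      apply one_div_le_one_div_of_le (by positivity)
      have : (N : ℝ) ≤ k := by exact_mod_cast hk
      linarith
    have h1 : ∀ x, ‖(moll d (mker d k) g - g) x‖ ≤ η := by
      intro x
      rw [Pi.sub_apply, ← dist_eq_norm, moll_eq']
      apply (mk d k).dist_normed_convolution_le hg.aestronglyMeasurable
      intro y hy
      apply (hδ' _).le
      rw [mem_ball] at hy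
      exact lt_of_lt_of_le hy hkδ
    have h2 : ∀ x, x ∉ S → (moll d (mker d k) g - g) x = 0 := by
      intro x hx
      have hx' : ∀ t, t ∈ tsupport g → 1 < dist x t := by
        intro t ht
        by_contra hcon
        exact hx (mem_cthickening_of_dist_le x t 1 _ ht (not_lt.1 hcon))
      have hgx : g x = 0 := by
        by_contra hcon
        have := hx' x (subset_tsupport _ hcon)
        simp at this
        linarith
      have : moll d (mker d k) g x = 0 := by
        unfold moll
        rw [integral_eq_zero_of_ae]
        refine ae_of_all _ fun t => ?_
        by_cases ht : t ∈ tsupport g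
        · have : mker d k (x - t) = 0 := by
            rw [← Function.notMem_support, mker_support]
            simp only [mem_ball, dist_zero_right, not_lt]
            have := hx' t ht
            rw [dist_eq_norm] at this
            refine le_trans ?_ this.le
            rw [div_le_one (by positivity)]; linarith [Nat.cast_nonneg (α := ℝ) k]
          simp [this]
        · simp [image_eq_zero_of_notMem_tsupport ht]
      simp [this, hgx]
    have h3 : moll d (mker d k) g - g = S.indicator (moll d (mker d k) g - g) := by
      funext x
      by_cases hx : x ∈ S
      · simp [hx]
      · rw [h2 x hx]; simp [hx]
    rw [h3, eLpNorm_indicator_eq_eLpNorm_restrict hSc.measurableSet]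
    refine (eLpNorm_le_of_ae_bound (ae_of_all _ h1)).trans ?_
    rw [Measure.restrict_apply_univ, ENNReal.toReal_ofReal (by linarith), one_div]
  by_cases hV0 : V ^ (1 / p) = 0
  · obtain ⟨N, hN⟩ := hbd 1 one_pos
    refine ⟨N, fun k hk => (hN k hk).trans ?_⟩
    rw [hV0]; simp
  · have hVp : V ^ (1 / p) ≠ ⊤ := ENNReal.rpow_ne_top_of_nonneg (by positivity) hV
    have : ∃ η : ℝ, 0 < η ∧ V ^ (1 / p) * ENNReal.ofReal η ≤ ε := by
      by_cases hε' : ε = ⊤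
      · exact ⟨1, one_pos, by rw [hε']; exact le_top⟩
      have hq : ε / V ^ (1 / p) ≠ ⊤ := (ENNReal.div_lt_top hε' hV0).ne
      refine ⟨(ε / V ^ (1 / p)).toReal, ENNReal.toReal_pos (ENNReal.div_pos hε.ne' hVp).ne' hq, ?_⟩
      rw [ENNReal.ofReal_toReal hq]
      exact ENNReal.mul_div_le
    obtain ⟨η, hη, hle⟩ := this
    obtain ⟨N, hN⟩ := hbd η hη
    exact ⟨N, fun k hk => (hN k hk).trans hle⟩

theorem moll_tendsto {d : ℕ} {p : ℝ} (hp : 1 ≤ p) {h : Ed d → ℝ} (hh : MemLp h (ENNReal.ofReal p) volume) :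
    Tendsto (fun k => eLpNorm (moll d (mker d k) h - h) (ENNReal.ofReal p) volume) atTop (𝓝 0) := by
  have h1p := one_le_ofReal hp
  rw [ENNReal.tendsto_atTop_zero]
  intro ε hε
  have hε3 : ε / 3 ≠ 0 := by simpa using hε.ne'
  obtain ⟨g, hgc, hgs, hgcont, hgm⟩ := hh.exists_hasCompactSupport_eLpNorm_sub_le (by simp) hε3
  have := moll_tendsto_cont hp hgcont hgc
  rw [ENNReal.tendsto_atTop_zero] at this
  obtain ⟨N, hN⟩ := this (ε / 3) (pos_iff_ne_zero.2 hε3)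
  refine ⟨N, fun k hk => ?_⟩
  have hhl : LocallyIntegrable h := hh.locallyIntegrable h1p
  have hgl : LocallyIntegrable g := hgm.locallyIntegrable h1p
  have hφ := (mker_contDiff d k).continuous
  have mc : ∀ {w : Ed d → ℝ}, LocallyIntegrable w → AEStronglyMeasurable (moll d (mker d k) w) volume := fun hw =>
    (moll_contDiff hw (mker_contDiff d k) (mker_hcs d k)).continuous.aestronglyMeasurable
  have e : moll d (mker d k) h - h = moll d (mker d k) (h - g) + ((moll d (mker d k) g - g) + (g - h)) := by
    rw [moll_sub hφ (mker_hcs d k) hhl hgl]; abel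
  rw [e]
  refine (eLpNorm_add_le (mc (hhl.sub hgl)) (((mc hgl).sub hgm.1).add (hgm.1.sub hh.1)) h1p).trans ?_
  refine (add_le_add (moll_bound hp (hh.1.sub hgm.1) k) (eLpNorm_add_le ((mc hgl).sub hgm.1) (hgm.1.sub hh.1) h1p)).trans ?_
  rw [eLpNorm_sub_comm g h]
  refine (add_le_add hgs (add_le_add (hN k hk) hgs)).trans (le_of_eq ?_)
  rw [← add_assoc, ENNReal.add_thirds]

/-- pointwise size of the `k`-th derivative -/
def DN {d : ℕ} (f : Ed d → ℝ) (k : ℕ) (x : Ed d) : ℝ≥0∞ := ‖iteratedFDeriv ℝ k f x‖ₑ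

theorem DN_cont {d : ℕ} {f : Ed d → ℝ} (hf : ContDiff ℝ ∞ f) (k : ℕ) : Continuous (DN f k) := by
  have : Continuous (iteratedFDeriv ℝ k f) := hf.continuous_iteratedFDeriv (by exact_mod_cast le_top)
  exact this.enorm

theorem DN_zero {d : ℕ} {f : Ed d → ℝ} (k : ℕ) {x : Ed d} (hx : x ∉ tsupport f) : DN f k x = 0 := by
  unfold DN
  rw [image_eq_zero_of_notMem_tsupport (fun h => hx (tsupport_iteratedFDeriv_subset k h))]
  simp

theorem ray_step {d : ℕ} {f : Ed d → ℝ} (hf : ContDiff ℝ ∞ f) (x v : Ed d) {c : ℝ} (hc : ‖v‖ ≤ c)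
    (hv : x + v ∉ tsupport f) (k : ℕ) {τ : ℝ} (h1 : τ ≤ 1) :
    DN f k (x + τ • v) ≤ ENNReal.ofReal c * ∫⁻ t in Ioc τ 1, DN f (k + 1) (x + t • v) := by
  set G : ℝ → _ := fun t => iteratedFDeriv ℝ k f (x + t • v)
  have hk : (k : ℕ∞ω) < ((⊤ : ℕ∞) : ℕ∞ω) := by exact_mod_cast ENat.natCast_lt_top _
  have hd : ∀ y, DifferentiableAt ℝ (iteratedFDeriv ℝ k f) y := fun y =>
    (hf.differentiable_iteratedFDeriv hk) y
  have hG : ∀ t, HasDerivAt G (fderiv ℝ (iteratedFDeriv ℝ k f) (x + t • v) v) t := by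
    intro t
    have h2 : HasDerivAt (fun t : ℝ => x + t • v) v t := by
      simpa using ((hasDerivAt_id t).smul_const v).const_add x
    exact (hd _).hasFDerivAt.comp_hasDerivAt t h2
  have hcont : Continuous (fun t : ℝ => fderiv ℝ (iteratedFDeriv ℝ k f) (x + t • v) v) := by
    have : ContDiff ℝ ∞ (iteratedFDeriv ℝ k f) := hf.iteratedFDeriv_right (by have h9 : ((⊤ : ℕ∞) + (k : ℕ∞)) ≤ ⊤ := le_top; exact_mod_cast h9)
    have := this.continuous_fderiv (by simp)
    exact (this.comp (by fun_prop)).clm_apply continuous_const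
  have hG1 : G 1 = 0 := by
    simp only [G, one_smul]
    exact image_eq_zero_of_notMem_tsupport (fun h => hv (tsupport_iteratedFDeriv_subset k h))
  have hft := intervalIntegral.integral_eq_sub_of_hasDerivAt (a := τ) (b := 1) (fun t _ => hG t)
    (hcont.intervalIntegrable _ _)
  rw [hG1, zero_sub] at hft
  have e : DN f k (x + τ • v) = ‖∫ t in τ..1, fderiv ℝ (iteratedFDeriv ℝ k f) (x + t • v) v‖ₑ := by
    rw [hft, enorm_neg]; rfl
  rw [e, intervalIntegral.integral_of_le h1, ← lintegral_const_mul' _ _ (by simp)]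
  refine (enorm_integral_le_lintegral_enorm _).trans (lintegral_mono fun t => ?_)
  change _ ≤ ENNReal.ofReal c * ‖iteratedFDeriv ℝ (k + 1) f (x + t • v)‖ₑ
  rw [← ofReal_norm, ← ofReal_norm, ← ENNReal.ofReal_mul ((norm_nonneg v).trans hc)]
  apply ENNReal.ofReal_le_ofReal
  refine (ContinuousLinearMap.le_opNorm _ _).trans ?_
  rw [norm_fderiv_iteratedFDeriv, mul_comm]
  gcongr

theorem ray_iter (h : ℕ → ℝ → ℝ≥0∞) (hm : ∀ k, Measurable (h k)) (c : ℝ≥0∞)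
    (hh : ∀ k τ, 0 ≤ τ → τ ≤ 1 → h k τ ≤ c * ∫⁻ t in Ioc τ 1, h (k + 1) t) (s : ℕ) :
    h 0 0 ≤ c ^ (s + 1) * ∫⁻ t in Ioc (0 : ℝ) 1, ENNReal.ofReal t ^ s * h (s + 1) t := by
  induction s with
  | zero => simpa using hh 0 0 le_rfl zero_le_one
  | succ s ih =>
    refine ih.trans ?_
    rw [pow_succ c (s + 1), mul_assoc]
    gcongr
    have h1 : ∫⁻ t in Ioc (0 : ℝ) 1, ENNReal.ofReal t ^ s * h (s + 1) t
        ≤ ∫⁻ t in Ioc (0 : ℝ) 1, c * ∫⁻ σ in Ioc (0 : ℝ) 1, (Ioc 0 σ).indicator (fun _ => ENNReal.ofReal σ ^ s * h (s + 2) σ) t := by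
      apply setLIntegral_mono' measurableSet_Ioc
      intro t ht
      have h2 := hh (s + 1) t ht.1.le ht.2
      calc ENNReal.ofReal t ^ s * h (s + 1) t ≤ ENNReal.ofReal t ^ s * (c * ∫⁻ σ in Ioc t 1, h (s + 2) σ) := by gcongr
        _ = c * ∫⁻ σ in Ioc t 1, ENNReal.ofReal t ^ s * h (s + 2) σ := by
          rw [lintegral_const_mul _ (hm _)]; ring
        _ ≤ _ := by
          gcongr 1
          rw [← lintegral_indicator measurableSet_Ioc, ← lintegral_indicator measurableSet_Ioc]
          apply lintegral_mono
          intro σ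
          by_cases hσ : σ ∈ Ioc t 1
          · have h3 : σ ∈ Ioc (0 : ℝ) 1 := ⟨ht.1.trans hσ.1, hσ.2⟩
            have h4 : t ∈ Ioc 0 σ := ⟨ht.1, hσ.1.le⟩
            simp only [indicator_of_mem hσ, indicator_of_mem h3, indicator_of_mem h4]
            gcongr
            exact hσ.1.le
          · simp [indicator_of_notMem hσ]
    refine h1.trans ?_
    have hmeas : Measurable (Function.uncurry fun (t σ : ℝ) => (Ioc 0 σ).indicator (fun _ => ENNReal.ofReal σ ^ s * h (s + 2) σ) t) := by
      have : (Function.uncurry fun (t σ : ℝ) => (Ioc 0 σ).indicator (fun _ => ENNReal.ofReal σ ^ s * h (s + 2) σ) t) =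
        ({q : ℝ × ℝ | 0 < q.1 ∧ q.1 ≤ q.2}).indicator (fun q => ENNReal.ofReal q.2 ^ s * h (s + 2) q.2) := by
        funext ⟨t, σ⟩
        simp [indicator]
      rw [this]
      apply Measurable.indicator
      · exact ((ENNReal.measurable_ofReal.comp measurable_snd).pow_const _).mul ((hm _).comp measurable_snd)
      · exact (measurableSet_lt measurable_const measurable_fst).inter (measurableSet_le measurable_fst measurable_snd)
    rw [lintegral_const_mul _ (Measurable.lintegral_prod_right hmeas)]
    gcongr 1
    rw [lintegral_lintegral_swap hmeas.aemeasurable]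
    apply setLIntegral_mono' measurableSet_Ioc
    intro σ hσ
    rw [lintegral_indicator measurableSet_Ioc, lintegral_const]
    have : (volume.restrict (Ioc (0 : ℝ) 1)).restrict (Ioc 0 σ) univ ≤ ENNReal.ofReal σ := by
      rw [Measure.restrict_apply_univ]
      refine (Measure.restrict_apply_le _ _).trans ?_
      simp
    calc _ ≤ ENNReal.ofReal σ ^ s * h (s + 2) σ * ENNReal.ofReal σ := by gcongr
      _ = _ := by rw [pow_succ]; ring

/-- The measures `t^{s-1} dt` on `(0,1]`, respectively the Dirac mass at `0` for `s = 0`. -/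
def muS : ℕ → Measure ℝ
  | 0 => Measure.dirac 0
  | (s + 1) => (volume.restrict (Ioc (0 : ℝ) 1)).withDensity (fun t => ENNReal.ofReal t ^ s)

instance (s : ℕ) : SFinite (muS s) := by
  cases s <;> unfold muS <;> infer_instance

theorem ray_mu {d : ℕ} {f : Ed d → ℝ} (hf : ContDiff ℝ ∞ f) (x v : Ed d) {c : ℝ} (hc : ‖v‖ ≤ c)
    (hv : x + v ∉ tsupport f) (i s : ℕ) :
    DN f i x ≤ ENNReal.ofReal c ^ s * ∫⁻ t, DN f (i + s) (x + t • v) ∂(muS s) := by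
  cases s with
  | zero => simp [muS]
  | succ s =>
    have hmeas : ∀ k, Measurable (fun t : ℝ => DN f (i + k) (x + t • v)) := fun k =>
      ((DN_cont hf (i + k)).comp (by fun_prop)).measurable
    have := ray_iter (fun k t => DN f (i + k) (x + t • v)) hmeas
      (ENNReal.ofReal c) (fun k τ _ h1 => ray_step hf x v hc hv (i + k) h1) s
    simp only [zero_smul, add_zero] at this
    refine this.trans (le_of_eq ?_)
    unfold muS
    rw [lintegral_withDensity_eq_lintegral_mul _ (by fun_prop) (hmeas (s + 1))]
    rfl

theorem muS_good (s : ℕ) (κ : ℝ) (hκ : s = 0 → κ = 0) : ∀ᵐ t ∂(muS s), (0 < t ∨ κ = 0) ∧ 0 ≤ t ∧ t ≤ 1 := by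
  cases s with
  | zero =>
    unfold muS
    rw [ae_dirac_eq]
    simp [hκ rfl]
  | succ s =>
    unfold muS
    apply (withDensity_absolutelyContinuous _ _).ae_le
    filter_upwards [ae_restrict_mem measurableSet_Ioc] with t ht
    exact ⟨Or.inl ht.1, ht.1.le, ht.2⟩

theorem muS_fin (s : ℕ) (κ : ℝ) (hκ : s = 0 → κ = 0) (hκ' : s ≠ 0 → κ < s) :
    ∫⁻ t, ENNReal.ofReal t ^ (-κ) ∂(muS s) ≠ ⊤ := by
  cases s with
  | zero => simp [muS, hκ rfl]
  | succ s =>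
    have hk := hκ' (by simp)
    push_cast at hk
    unfold muS
    rw [lintegral_withDensity_eq_lintegral_mul _ (by fun_prop) (by fun_prop)]
    have e : ∫⁻ t in Ioc (0 : ℝ) 1, ((fun t : ℝ => ENNReal.ofReal t ^ s) * fun t => ENNReal.ofReal t ^ (-κ)) t
        = ∫⁻ t in Ioc (0 : ℝ) 1, ENNReal.ofReal (t ^ (s - κ)) := by
      apply setLIntegral_congr_fun measurableSet_Ioc
      intro t ht
      simp only [Pi.mul_apply]
      rw [← ENNReal.rpow_natCast, ← ENNReal.rpow_add _ _ (by simpa using ht.1) (by simp),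
        ENNReal.ofReal_rpow_of_pos ht.1]
      rfl
    rw [e]
    have hIntg := (intervalIntegral.intervalIntegrable_rpow' (a := 0) (b := 1) (r := (s : ℝ) - κ) (by linarith))
    rw [intervalIntegrable_iff_integrableOn_Ioc_of_le zero_le_one] at hIntg
    exact (Integrable.lintegral_lt_top hIntg).ne

/-- A ball far away from the origin, used as set of directions. -/
def dirW (d : ℕ) : Set (Ed d) := if h : 0 < d then ball (EuclideanSpace.single (⟨0, h⟩ : Fin d) (6 : ℝ)) 1 else ∅

theorem dirW_meas (d : ℕ) : MeasurableSet (dirW d) := by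
  unfold dirW; split_ifs <;> measurability

theorem dirW_vol_ne_zero {d : ℕ} (hd : 0 < d) : volume (dirW d) ≠ 0 := by
  unfold dirW; rw [dif_pos hd]; exact (measure_ball_pos _ _ one_pos).ne'

theorem dirW_vol_ne_top (d : ℕ) : volume (dirW d) ≠ ⊤ := by
  unfold dirW; split_ifs
  · exact measure_ball_lt_top.ne
  · simp

theorem dirW_norm {d : ℕ} {w : Ed d} (hw : w ∈ dirW d) : 5 < ‖w‖ ∧ ‖w‖ < 7 := by
  unfold dirW at hw
  split_ifs at hw with h
  · rw [mem_ball, dist_eq_norm] at hw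
    have h1 : ‖(EuclideanSpace.single (⟨0, h⟩ : Fin d) (6 : ℝ))‖ = 6 := by simp
    have h2 := norm_sub_norm_le (EuclideanSpace.single (⟨0, h⟩ : Fin d) (6 : ℝ)) w
    have h3 := norm_sub_norm_le w (EuclideanSpace.single (⟨0, h⟩ : Fin d) (6 : ℝ))
    rw [norm_sub_rev] at h2
    constructor <;> linarith
  · exact absurd hw (by simp)

theorem pot_avg {d : ℕ} {f : Ed d → ℝ} (hf : ContDiff ℝ ∞ f) {z : Ed d} {r : ℝ} (hr : 0 < r)
    (hs : tsupport f ⊆ closedBall z (2 * r)) (i s : ℕ) (x : Ed d) :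
    DN f i x * volume (dirW d) ≤ ENNReal.ofReal (7 * r) ^ s *
      ∫⁻ q, DN f (i + s) (x + (q.1 * r) • q.2) ∂((muS s).prod (volume.restrict (dirW d))) := by
  by_cases hx : x ∈ tsupport f
  swap
  · rw [DN_zero _ hx]; simp
  have hmeas : Measurable (fun q : ℝ × Ed d => DN f (i + s) (x + (q.1 * r) • q.2)) :=
    ((DN_cont hf (i + s)).comp (by fun_prop)).measurable
  rw [lintegral_prod_symm _ hmeas.aemeasurable, ← lintegral_const_mul' _ _ (ENNReal.pow_ne_top ENNReal.ofReal_ne_top), ← setLIntegral_const]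
  apply setLIntegral_mono' (dirW_meas d)
  intro w hw
  have hn := dirW_norm hw
  have h1 : ‖r • w‖ ≤ 7 * r := by
    rw [norm_smul, Real.norm_of_nonneg hr.le]; nlinarith
  have h2 : x + r • w ∉ tsupport f := by
    intro h
    have h3 := hs h
    have h4 := hs hx
    rw [mem_closedBall, dist_eq_norm] at h3 h4
    have h5 : ‖r • w‖ ≤ ‖x + r • w - z‖ + ‖x - z‖ := by
      calc ‖r • w‖ = ‖(x + r • w - z) - (x - z)‖ := by congr 1; abel
        _ ≤ _ := norm_sub_le _ _
    rw [norm_smul, Real.norm_of_nonneg hr.le] at h5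
    nlinarith
  have := ray_mu hf x (r • w) h1 h2 i s
  simpa [smul_smul] using this

/-- weight function -/
def thS (κ p t : ℝ) : ℝ≥0∞ := (ENNReal.ofReal t ^ κ) ^ p * ENNReal.ofReal t ^ (-κ)

theorem thS_meas (κ p : ℝ) : Measurable (thS κ p) := by unfold thS; fun_prop

/-- averages -/
def AVf {d : ℕ} (Φ : Ed d → ℝ≥0∞) (r t : ℝ) (x : Ed d) : ℝ≥0∞ := ∫⁻ w in dirW d, Φ (x + (t * r) • w)

theorem AVf_meas {d : ℕ} {Φ : Ed d → ℝ≥0∞} (hΦ : Continuous Φ) (r : ℝ) :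
    Measurable (fun q : ℝ × Ed d => AVf Φ r q.1 q.2) := by
  unfold AVf
  have : Measurable (fun q : (ℝ × Ed d) × Ed d => Φ (q.1.2 + (q.1.1 * r) • q.2)) :=
    (hΦ.comp (by fun_prop)).measurable
  exact this.lintegral_prod_right'

theorem pot_jensen {d : ℕ} (hd : 0 < d) {p : ℝ} (hp : 1 ≤ p) (i s : ℕ) (κ : ℝ) (hκ0 : 0 ≤ κ) (hκ : s = 0 → κ = 0)
    (hκ' : s ≠ 0 → κ < s) (k : ℕ) (hk : i + s = k) : ∃ C : ℝ≥0∞, C ≠ ⊤ ∧ ∀ (f : Ed d → ℝ) (_ : ContDiff ℝ ∞ f) (z : Ed d) (r : ℝ)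
      (_ : 0 < r) (_ : tsupport f ⊆ closedBall z (2 * r)) (x : Ed d),
      (DN f i x) ^ p ≤ C * ENNReal.ofReal r ^ ((s : ℝ) * p) * ∫⁻ t, thS κ p t * AVf (fun y => DN f k y ^ p) r t x ∂(muS s) := by
  subst hk
  have hp0 : 0 < p := by linarith
  set vW := volume (dirW d)
  have hvW0 : vW ≠ 0 := dirW_vol_ne_zero hd
  have hvWt : vW ≠ ⊤ := dirW_vol_ne_top d
  set A := ∫⁻ t, ENNReal.ofReal t ^ (-κ) ∂(muS s)
  have hA : A ≠ ⊤ := muS_fin s κ hκ hκ'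
  refine ⟨vW⁻¹ ^ p * (ENNReal.ofReal 7 ^ ((s : ℝ) * p) * (A * vW) ^ (p - 1)), ?_, ?_⟩
  · refine ENNReal.mul_ne_top (ENNReal.rpow_ne_top_of_nonneg hp0.le (ENNReal.inv_ne_top.2 hvW0)) (ENNReal.mul_ne_top ?_ ?_)
    · exact ENNReal.rpow_ne_top_of_nonneg (by positivity) (by simp)
    · exact ENNReal.rpow_ne_top_of_nonneg (by linarith) (ENNReal.mul_ne_top hA hvWt)
  intro f hf z r hr hs x
  set ν := (muS s).prod (volume.restrict (dirW d))
  have h1 := pot_avg hf hr hs i s x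
  set F : ℝ × Ed d → ℝ≥0∞ := fun q => DN f (i + s) (x + (q.1 * r) • q.2)
  have hF : Measurable F := ((DN_cont hf (i + s)).comp (by fun_prop)).measurable
  set a : ℝ × Ed d → ℝ≥0∞ := fun q => F q * ENNReal.ofReal q.1 ^ κ
  set w : ℝ × Ed d → ℝ≥0∞ := fun q => ENNReal.ofReal q.1 ^ (-κ)
  have ha : Measurable a := hF.mul (by fun_prop)
  have hw : Measurable w := by fun_prop
  have hgood : ∀ᵐ q ∂ν, (0 < q.1 ∨ κ = 0) ∧ 0 ≤ q.1 ∧ q.1 ≤ 1 :=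
    (Measure.quasiMeasurePreserving_fst (μ := muS s) (ν := volume.restrict (dirW d))).ae (muS_good s κ hκ)
  have h2 : ∫⁻ q, F q ∂ν = ∫⁻ q, a q * w q ∂ν := by
    apply lintegral_congr_ae
    filter_upwards [hgood] with q hq
    simp only [a, w]
    rcases hq.1 with h | h
    · rw [mul_assoc, ← ENNReal.rpow_add _ _ (by simpa using h) (by simp)]; simp
    · simp [h]
  have hW : ∫⁻ q, w q ∂ν = A * vW := by
    simp only [ν, w]
    rw [lintegral_prod _ hw.aemeasurable]
    have e : ∀ t : ℝ, ∫⁻ y : Ed d, ENNReal.ofReal (t, y).1 ^ (-κ) ∂(volume.restrict (dirW d)) = ENNReal.ofReal t ^ (-κ) * vW := by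
      intro t
      exact setLIntegral_const (dirW d) (ENNReal.ofReal t ^ (-κ))
    rw [lintegral_congr e, lintegral_mul_const _ (by fun_prop)]
  have h3 := jensen_w (μ := ν) hp ha.aemeasurable hw.aemeasurable
  rw [hW] at h3
  have h4 : ∫⁻ q, a q ^ p * w q ∂ν = ∫⁻ t, thS κ p t * AVf (fun y => DN f (i + s) y ^ p) r t x ∂(muS s) := by
    simp only [ν]
    have hm4 : Measurable (fun q => a q ^ p * w q) := (ha.pow_const p).mul hw
    rw [lintegral_prod _ hm4.aemeasurable]
    apply lintegral_congr
    intro t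
    unfold AVf thS
    rw [← lintegral_const_mul]
    · apply lintegral_congr
      intro y
      simp only [a, w, F]
      rw [ENNReal.mul_rpow_of_nonneg _ _ hp0.le]; ring
    · exact ((DN_cont hf (i + s)).comp (by fun_prop)).measurable.pow_const p
  rw [h4] at h3
  have h5 : DN f i x ≤ vW⁻¹ * (ENNReal.ofReal (7 * r) ^ s * ∫⁻ q, a q * w q ∂ν) := by
    rw [← h2]
    calc DN f i x = vW⁻¹ * (DN f i x * vW) := by
          rw [mul_comm, mul_assoc, ENNReal.mul_inv_cancel hvW0 hvWt, mul_one]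
      _ ≤ _ := by gcongr
  calc (DN f i x) ^ p ≤ (vW⁻¹ * (ENNReal.ofReal (7 * r) ^ s * ∫⁻ q, a q * w q ∂ν)) ^ p := by gcongr
    _ = vW⁻¹ ^ p * (ENNReal.ofReal (7 * r) ^ ((s : ℝ) * p) * (∫⁻ q, a q * w q ∂ν) ^ p) := by
        rw [ENNReal.mul_rpow_of_nonneg _ _ hp0.le, ENNReal.mul_rpow_of_nonneg _ _ hp0.le, ENNReal.rpow_mul, ENNReal.rpow_natCast]
    _ = vW⁻¹ ^ p * ((ENNReal.ofReal 7 ^ ((s : ℝ) * p) * ENNReal.ofReal r ^ ((s : ℝ) * p)) * (∫⁻ q, a q * w q ∂ν) ^ p) := by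
        rw [ENNReal.ofReal_mul (by norm_num), ENNReal.mul_rpow_of_nonneg _ _ (by positivity)]
    _ ≤ vW⁻¹ ^ p * ((ENNReal.ofReal 7 ^ ((s : ℝ) * p) * ENNReal.ofReal r ^ ((s : ℝ) * p)) * ((A * vW) ^ (p - 1) * ∫⁻ t, thS κ p t * AVf (fun y => DN f (i + s) y ^ p) r t x ∂(muS s))) := by gcongr
    _ = _ := by ring

theorem AVf_int {d : ℕ} {Φ : Ed d → ℝ≥0∞} (hΦ : Continuous Φ) (r t : ℝ) :
    ∫⁻ x, AVf Φ r t x = volume (dirW d) * ∫⁻ x, Φ x := by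
  unfold AVf
  have hm : Measurable (fun q : Ed d × Ed d => Φ (q.1 + (t * r) • q.2)) :=
    (hΦ.comp (by fun_prop)).measurable
  rw [lintegral_lintegral_swap (f := fun x w => Φ (x + (t * r) • w)) hm.aemeasurable]
  simp_rw [lintegral_add_right_eq_self (μ := (volume : Measure (Ed d))) Φ]
  rw [setLIntegral_const, mul_comm]

theorem AVf_sup {d : ℕ} {Φ : Ed d → ℝ≥0∞} (hΦ : Continuous Φ) {r t : ℝ} (hr : 0 < r) (ht : 0 < t) (x : Ed d) :
    AVf Φ r t x ≤ ENNReal.ofReal (t * r) ^ (-(d : ℝ)) * ∫⁻ x, Φ x := by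
  unfold AVf
  have hR : 0 < t * r := mul_pos ht hr
  refine (setLIntegral_le_lintegral _ _).trans ?_
  have h1 : ∫⁻ w, Φ (x + (t * r) • w) = ∫⁻ y, Φ (x + y) ∂(Measure.map (fun w : Ed d => (t * r) • w) volume) := by
    have hm : Measurable (fun y => Φ (x + y)) := (hΦ.comp (by fun_prop)).measurable
    rw [lintegral_map hm (by fun_prop)]
  rw [h1, Measure.map_addHaar_smul _ hR.ne', lintegral_smul_measure, lintegral_add_left_eq_self]
  simp only [finrank_euclideanSpace, Fintype.card_fin, smul_eq_mul]
  gcongr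
  rw [abs_of_pos (by positivity), ENNReal.ofReal_inv_of_pos (by positivity), ENNReal.ofReal_pow hR.le, ENNReal.rpow_neg, ENNReal.rpow_natCast]

theorem rpow_anti {x y : ℝ≥0∞} (h : x ≤ y) {q : ℝ} (hq : 0 ≤ q) : y ^ (-q) ≤ x ^ (-q) := by
  rw [ENNReal.rpow_neg, ENNReal.rpow_neg]
  exact ENNReal.inv_le_inv.2 (ENNReal.rpow_le_rpow h hq)

theorem AVf_mul_one {d : ℕ} {Φ Ψ : Ed d → ℝ≥0∞} (hΦ : Continuous Φ) (hΨ : Continuous Ψ) {r t τ q1 q2 : ℝ}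
    (hr : 0 < r) (hq1 : 0 ≤ q1) (hq : q1 + q2 = d) (htτ : t ≤ τ) (hτ : 0 < τ) :
    ∫⁻ x, AVf Φ r t x * AVf Ψ r τ x ≤ volume (dirW d) * ENNReal.ofReal r ^ (-(d : ℝ)) *
      (ENNReal.ofReal t ^ (-q1) * ENNReal.ofReal τ ^ (-q2)) * ((∫⁻ x, Φ x) * ∫⁻ x, Ψ x) := by
  have hm : Measurable (fun x => AVf Φ r t x) := (AVf_meas hΦ r).comp (measurable_const.prodMk measurable_id)
  calc ∫⁻ x, AVf Φ r t x * AVf Ψ r τ x ≤ ∫⁻ x, AVf Φ r t x * (ENNReal.ofReal (τ * r) ^ (-(d : ℝ)) * ∫⁻ x, Ψ x) := by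
        gcongr; exact AVf_sup hΨ hr hτ _
    _ = volume (dirW d) * (∫⁻ x, Φ x) * (ENNReal.ofReal (τ * r) ^ (-(d : ℝ)) * ∫⁻ x, Ψ x) := by
        rw [lintegral_mul_const _ hm, AVf_int hΦ]
    _ = volume (dirW d) * ENNReal.ofReal r ^ (-(d : ℝ)) *
      (ENNReal.ofReal τ ^ (-q1) * ENNReal.ofReal τ ^ (-q2)) * ((∫⁻ x, Φ x) * ∫⁻ x, Ψ x) := by
        rw [← ENNReal.rpow_add _ _ (by simpa using hτ) (by simp), ENNReal.ofReal_mul hτ.le,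
          ENNReal.mul_rpow_of_ne_top (by simp) (by simp)]
        have : -q1 + -q2 = -(d : ℝ) := by linarith
        rw [this]; ring
    _ ≤ _ := by
        have h9 := rpow_anti (ENNReal.ofReal_le_ofReal htτ) hq1
        exact mul_le_mul' (mul_le_mul' le_rfl (mul_le_mul' h9 le_rfl)) le_rfl

theorem AVf_mul {d : ℕ} (hd : 0 < d) {Φ Ψ : Ed d → ℝ≥0∞} (hΦ : Continuous Φ) (hΨ : Continuous Ψ) {r t τ q1 q2 : ℝ}
    (hr : 0 < r) (hq1 : 0 ≤ q1) (hq2 : 0 ≤ q2) (hq : q1 + q2 = d) (ht : (0 < t ∨ q1 = 0) ∧ 0 ≤ t)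
    (hτ : (0 < τ ∨ q2 = 0) ∧ 0 ≤ τ) :
    ∫⁻ x, AVf Φ r t x * AVf Ψ r τ x ≤ volume (dirW d) * ENNReal.ofReal r ^ (-(d : ℝ)) *
      (ENNReal.ofReal t ^ (-q1) * ENNReal.ofReal τ ^ (-q2)) * ((∫⁻ x, Φ x) * ∫⁻ x, Ψ x) := by
  have hd' : (0 : ℝ) < d := by exact_mod_cast hd
  rcases le_total t τ with h | h
  · apply AVf_mul_one hΦ hΨ hr hq1 hq h
    rcases hτ.1 with h1 | h1
    · exact h1
    · rcases ht.1 with h2 | h2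
      · linarith
      · linarith
  · have := AVf_mul_one (t := τ) (τ := t) (q1 := q2) (q2 := q1) hΨ hΦ hr hq2 (by linarith) h (by
      rcases ht.1 with h1 | h1
      · exact h1
      · rcases hτ.1 with h2 | h2
        · linarith
        · linarith)
    calc ∫⁻ x, AVf Φ r t x * AVf Ψ r τ x = ∫⁻ x, AVf Ψ r τ x * AVf Φ r t x := by
          simp_rw [mul_comm]
      _ ≤ _ := this
      _ = _ := by ring

theorem pot_key {d : ℕ} (hd : 0 < d) {p : ℝ} (hp0 : 0 < p) (s1 s2 : ℕ) (κ1 κ2 : ℝ) (hk1n : 0 ≤ κ1) (hk2n : 0 ≤ κ2)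
    (hz1 : s1 = 0 → κ1 = 0) (hz2 : s2 = 0 → κ2 = 0) (hκp : (κ1 + κ2) * p = d) {Φ Ψ : Ed d → ℝ≥0∞} (hΦ : Continuous Φ) (hΨ : Continuous Ψ)
    {r : ℝ} (hr : 0 < r) :
    ∫⁻ x, (∫⁻ t, thS κ1 p t * AVf Φ r t x ∂(muS s1)) * (∫⁻ τ, thS κ2 p τ * AVf Ψ r τ x ∂(muS s2))
      ≤ volume (dirW d) * ENNReal.ofReal r ^ (-(d : ℝ)) * ((∫⁻ x, Φ x) * ∫⁻ x, Ψ x) * ((∫⁻ t, ENNReal.ofReal t ^ (-κ1) ∂(muS s1)) *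
        ∫⁻ t, ENNReal.ofReal t ^ (-κ2) ∂(muS s2)) := by
  have mΦ := AVf_meas hΦ r
  have mΨ := AVf_meas hΨ r
  have mF : Measurable (fun q : Ed d × ℝ => thS κ1 p q.2 * AVf Φ r q.2 q.1) :=
    ((thS_meas κ1 p).comp measurable_snd).mul (mΦ.comp measurable_swap)
  have mG : Measurable (fun q : Ed d × ℝ => thS κ2 p q.2 * AVf Ψ r q.2 q.1) :=
    ((thS_meas κ2 p).comp measurable_snd).mul (mΨ.comp measurable_swap)
  have mI : Measurable (fun x => ∫⁻ t, thS κ1 p t * AVf Φ r t x ∂(muS s1)) := mF.lintegral_prod_right'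
  have mJ : Measurable (fun x => ∫⁻ t, thS κ2 p t * AVf Ψ r t x ∂(muS s2)) := mG.lintegral_prod_right'
  set B := volume (dirW d) * ENNReal.ofReal r ^ (-(d : ℝ)) * ((∫⁻ x, Φ x) * ∫⁻ x, Ψ x)
  have sw1 : ∫⁻ x, (∫⁻ t, thS κ1 p t * AVf Φ r t x ∂(muS s1)) * (∫⁻ τ, thS κ2 p τ * AVf Ψ r τ x ∂(muS s2))
      = ∫⁻ t, (∫⁻ τ, (∫⁻ x, (thS κ1 p t * AVf Φ r t x) * (thS κ2 p τ * AVf Ψ r τ x)) ∂(muS s2)) ∂(muS s1) := by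
    have a1 : ∀ x, (∫⁻ t, thS κ1 p t * AVf Φ r t x ∂(muS s1)) * (∫⁻ τ, thS κ2 p τ * AVf Ψ r τ x ∂(muS s2))
        = ∫⁻ t, (thS κ1 p t * AVf Φ r t x) * (∫⁻ τ, thS κ2 p τ * AVf Ψ r τ x ∂(muS s2)) ∂(muS s1) := by
      intro x
      rw [lintegral_mul_const]
      exact mF.comp (measurable_const.prodMk measurable_id)
    rw [lintegral_congr a1, lintegral_lintegral_swap]
    swap
    · exact (mF.mul (mJ.comp measurable_fst)).aemeasurable
    apply lintegral_congr
    intro t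
    have a2 : ∀ x, (thS κ1 p t * AVf Φ r t x) * (∫⁻ τ, thS κ2 p τ * AVf Ψ r τ x ∂(muS s2))
        = ∫⁻ τ, (thS κ1 p t * AVf Φ r t x) * (thS κ2 p τ * AVf Ψ r τ x) ∂(muS s2) := by
      intro x
      rw [lintegral_const_mul]
      exact mG.comp (measurable_const.prodMk measurable_id)
    rw [lintegral_congr a2, lintegral_lintegral_swap]
    exact ((mF.comp (measurable_fst.prodMk measurable_const)).mul mG).aemeasurable
  rw [sw1]
  have b1 : ∀ᵐ t ∂(muS s1), (∫⁻ τ, (∫⁻ x, (thS κ1 p t * AVf Φ r t x) * (thS κ2 p τ * AVf Ψ r τ x)) ∂(muS s2))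
      ≤ ∫⁻ τ, B * ENNReal.ofReal t ^ (-κ1) * ENNReal.ofReal τ ^ (-κ2) ∂(muS s2) := by
    filter_upwards [muS_good s1 κ1 hz1] with t ht
    apply lintegral_mono_ae
    filter_upwards [muS_good s2 κ2 hz2] with τ hτ
    have c1 := AVf_mul hd hΦ hΨ (r := r) (t := t) (τ := τ) (q1 := κ1 * p) (q2 := κ2 * p) hr (by positivity) (by positivity)
      (by rw [← add_mul, hκp]) ⟨ht.1.imp id (fun h => by rw [h, zero_mul]), ht.2.1⟩
      ⟨hτ.1.imp id (fun h => by rw [h, zero_mul]), hτ.2.1⟩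
    have th : ∀ (κ t : ℝ), (0 < t ∨ κ = 0) → thS κ p t * ENNReal.ofReal t ^ (-(κ * p)) = ENNReal.ofReal t ^ (-κ) := by
      intro κ t h
      unfold thS
      rcases h with h | h
      · have h0 : ENNReal.ofReal t ≠ 0 := by simpa using h
        rw [← ENNReal.rpow_mul, ← ENNReal.rpow_add _ _ h0 (by simp), ← ENNReal.rpow_add _ _ h0 (by simp)]
        congr 1; ring
      · simp [h]
    have mm : Measurable (fun x => AVf Φ r t x * AVf Ψ r τ x) :=
      (mΦ.comp (measurable_const.prodMk measurable_id)).mul (mΨ.comp (measurable_const.prodMk measurable_id))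
    calc ∫⁻ x, (thS κ1 p t * AVf Φ r t x) * (thS κ2 p τ * AVf Ψ r τ x)
        = thS κ1 p t * thS κ2 p τ * ∫⁻ x, AVf Φ r t x * AVf Ψ r τ x := by
          rw [← lintegral_const_mul _ mm]
          apply lintegral_congr; intro x; ring
      _ ≤ thS κ1 p t * thS κ2 p τ * (volume (dirW d) * ENNReal.ofReal r ^ (-(d : ℝ)) *
          (ENNReal.ofReal t ^ (-(κ1 * p)) * ENNReal.ofReal τ ^ (-(κ2 * p))) * ((∫⁻ x, Φ x) * ∫⁻ x, Ψ x)) := by gcongr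
      _ = B * (thS κ1 p t * ENNReal.ofReal t ^ (-(κ1 * p))) * (thS κ2 p τ * ENNReal.ofReal τ ^ (-(κ2 * p))) := by
          simp only [B]; ring
      _ = _ := by rw [th κ1 t ht.1, th κ2 τ hτ.1]
  refine (lintegral_mono_ae b1).trans (le_of_eq ?_)
  have b2 : ∀ t, ∫⁻ τ, B * ENNReal.ofReal t ^ (-κ1) * ENNReal.ofReal τ ^ (-κ2) ∂(muS s2) = B * ENNReal.ofReal t ^ (-κ1) * ∫⁻ t, ENNReal.ofReal t ^ (-κ2) ∂(muS s2) := by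
    intro t
    rw [lintegral_const_mul _ (by fun_prop)]
  rw [lintegral_congr b2, lintegral_mul_const _ (by fun_prop), lintegral_const_mul _ (by fun_prop)]
  ring

theorem pot_meas {d : ℕ} {Φ : Ed d → ℝ≥0∞} (hΦ : Continuous Φ) (κ p r : ℝ) (s : ℕ) :
    Measurable (fun x => ∫⁻ t, thS κ p t * AVf Φ r t x ∂(muS s)) := by
  have mF : Measurable (fun q : Ed d × ℝ => thS κ p q.2 * AVf Φ r q.2 q.1) :=
    ((thS_meas κ p).comp measurable_snd).mul ((AVf_meas hΦ r).comp measurable_swap)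
  exact mF.lintegral_prod_right'

theorem lint_const2 {X : Type*} [MeasurableSpace X] {μ : Measure X} (c1 c2 : ℝ≥0∞) {F G : X → ℝ≥0∞}
    (hF : Measurable F) (hG : Measurable G) :
    ∫⁻ x, (c1 * F x) * (c2 * G x) ∂μ = c1 * c2 * ∫⁻ x, F x * G x ∂μ := by
  have h : Measurable (fun x => F x * G x) := hF.mul hG
  rw [← lintegral_const_mul _ h]
  apply lintegral_congr; intro x; ring

theorem bil_comb {d : ℕ} (hd : 0 < d) {p : ℝ} (hp : 1 ≤ p) (i j m s1 s2 : ℕ) (e1 : i + s1 = m) (e2 : j + s2 = m)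
    (κ1 κ2 : ℝ) (hk1n : 0 ≤ κ1) (hk2n : 0 ≤ κ2)
    (hz1 : s1 = 0 → κ1 = 0) (hz2 : s2 = 0 → κ2 = 0) (hl1 : s1 ≠ 0 → κ1 < s1) (hl2 : s2 ≠ 0 → κ2 < s2)
    (hκp : (κ1 + κ2) * p = d) : ∃ C : ℝ≥0∞, C ≠ ⊤ ∧ ∀ (f g : Ed d → ℝ) (_ : ContDiff ℝ ∞ f) (_ : ContDiff ℝ ∞ g)
      (z : Ed d) (r : ℝ)
      (_ : 0 < r) (_ : tsupport f ⊆ closedBall z (2 * r)) (_ : tsupport g ⊆ closedBall z (2 * r)),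
      ∫⁻ x, (DN f i x * DN g j x) ^ p ≤ C * ENNReal.ofReal r ^ (((s1 : ℝ) + (s2 : ℝ)) * p - d) *
        ((∫⁻ x, DN f m x ^ p) * ∫⁻ x, DN g m x ^ p) := by
  have hp0 : 0 < p := by linarith
  obtain ⟨C1, hC1, H1⟩ := pot_jensen hd hp i s1 κ1 hk1n hz1 hl1 m e1
  obtain ⟨C2, hC2, H2⟩ := pot_jensen hd hp j s2 κ2 hk2n hz2 hl2 m e2
  set A1 := ∫⁻ t, ENNReal.ofReal t ^ (-κ1) ∂(muS s1)
  set A2 := ∫⁻ t, ENNReal.ofReal t ^ (-κ2) ∂(muS s2)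
  have hA1 : A1 ≠ ⊤ := muS_fin s1 κ1 hz1 hl1
  have hA2 : A2 ≠ ⊤ := muS_fin s2 κ2 hz2 hl2
  refine ⟨C1 * C2 * (volume (dirW d) * (A1 * A2)), ?_, ?_⟩
  · exact ENNReal.mul_ne_top (ENNReal.mul_ne_top hC1 hC2) (ENNReal.mul_ne_top (dirW_vol_ne_top d) (ENNReal.mul_ne_top hA1 hA2))
  intro f g hf hg z r hr hsf hsg
  have hΦ : Continuous (fun x => DN f m x ^ p) := ENNReal.continuous_rpow_const.comp (DN_cont hf m)
  have hΨ : Continuous (fun x => DN g m x ^ p) := ENNReal.continuous_rpow_const.comp (DN_cont hg m)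
  have H1' := H1 f hf z r hr hsf
  have H2' := H2 g hg z r hr hsg
  have key := pot_key hd hp0 s1 s2 κ1 κ2 hk1n hk2n hz1 hz2 hκp hΦ hΨ hr
  set R := ENNReal.ofReal r
  have hR0 : R ≠ 0 := by simpa [R] using hr
  have hRt : R ≠ ⊤ := by simp [R]
  have mI := pot_meas hΦ κ1 p r s1
  have mJ := pot_meas hΨ κ2 p r s2
  calc ∫⁻ x, (DN f i x * DN g j x) ^ p = ∫⁻ x, DN f i x ^ p * DN g j x ^ p := by
        simp_rw [ENNReal.mul_rpow_of_nonneg _ _ hp0.le]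
    _ ≤ ∫⁻ x, (C1 * R ^ ((s1 : ℝ) * p) * ∫⁻ t, thS κ1 p t * AVf (fun y => DN f m y ^ p) r t x ∂(muS s1)) *
          (C2 * R ^ ((s2 : ℝ) * p) * ∫⁻ t, thS κ2 p t * AVf (fun y => DN g m y ^ p) r t x ∂(muS s2)) := by
        apply lintegral_mono; intro x
        exact mul_le_mul' (H1' x) (H2' x)
    _ = C1 * C2 * (R ^ ((s1 : ℝ) * p) * R ^ ((s2 : ℝ) * p)) * ∫⁻ x, (∫⁻ t, thS κ1 p t * AVf (fun y => DN f m y ^ p) r t x ∂(muS s1)) * (∫⁻ τ, thS κ2 p τ * AVf (fun y => DN g m y ^ p) r τ x ∂(muS s2)) := by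
        rw [lint_const2 _ _ mI mJ]; ring
    _ ≤ C1 * C2 * (R ^ ((s1 : ℝ) * p) * R ^ ((s2 : ℝ) * p)) * (volume (dirW d) * R ^ (-(d : ℝ)) * ((∫⁻ x, DN f m x ^ p) * ∫⁻ x, DN g m x ^ p) * (A1 * A2)) := by gcongr
    _ = C1 * C2 * (volume (dirW d) * (A1 * A2)) * (R ^ ((s1 : ℝ) * p) * R ^ ((s2 : ℝ) * p) * R ^ (-(d : ℝ))) * ((∫⁻ x, DN f m x ^ p) * ∫⁻ x, DN g m x ^ p) := by ring
    _ = _ := by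
        rw [← ENNReal.rpow_add _ _ hR0 hRt, ← ENNReal.rpow_add _ _ hR0 hRt]
        congr 3; ring

theorem bil_pot {d m : ℕ} (hd : 0 < d) {p : ℝ} (hp : 1 ≤ p) (hdp : (d : ℝ) / p < m)
    (i j : ℕ) (hij : i + j ≤ m) : ∃ C : ℝ≥0∞, C ≠ ⊤ ∧ ∀ (f g : Ed d → ℝ) (_ : ContDiff ℝ ∞ f) (_ : ContDiff ℝ ∞ g)
      (z : Ed d) (r : ℝ)
      (_ : 0 < r) (_ : tsupport f ⊆ closedBall z (2 * r)) (_ : tsupport g ⊆ closedBall z (2 * r)),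
      ∫⁻ x, (DN f i x * DN g j x) ^ p ≤ C * ENNReal.ofReal r ^ ((((m - i : ℕ) : ℝ) + ((m - j : ℕ) : ℝ)) * p - d) *
        ((∫⁻ x, DN f m x ^ p) * ∫⁻ x, DN g m x ^ p) := by
  have hp0 : 0 < p := by linarith
  have hd' : (0 : ℝ) < d := by exact_mod_cast hd
  set s1 := m - i with hs1
  set s2 := m - j with hs2
  set κ := (d : ℝ) / p
  have hκ : 0 < κ := by positivity
  have hκp : κ * p = d := by simp only [κ]; field_simp
  have hS : (m : ℝ) ≤ s1 + s2 := by
    have : m ≤ s1 + s2 := by omega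
    exact_mod_cast this
  have hS0 : (0 : ℝ) < s1 + s2 := by linarith
  have hlt : κ / ((s1 : ℝ) + s2) < 1 := by rw [div_lt_one hS0]; linarith
  set κ1 := κ / ((s1 : ℝ) + s2) * s1 with hk1
  set κ2 := κ / ((s1 : ℝ) + s2) * s2 with hk2
  have hk1n : 0 ≤ κ1 := by positivity
  have hk2n : 0 ≤ κ2 := by positivity
  have hsum : κ1 + κ2 = κ := by simp only [hk1, hk2]; field_simp
  have hz1 : s1 = 0 → κ1 = 0 := by intro h; simp [hk1, h]
  have hz2 : s2 = 0 → κ2 = 0 := by intro h; simp [hk2, h]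
  have hl1 : s1 ≠ 0 → κ1 < s1 := by
    intro h
    have : (0 : ℝ) < s1 := by exact_mod_cast Nat.pos_of_ne_zero h
    simp only [hk1]; nlinarith
  have hl2 : s2 ≠ 0 → κ2 < s2 := by
    intro h
    have : (0 : ℝ) < s2 := by exact_mod_cast Nat.pos_of_ne_zero h
    simp only [hk2]; nlinarith
  exact bil_comb hd hp i j m s1 s2 (by omega) (by omega) κ1 κ2 hk1n hk2n hz1 hz2 hl1 hl2 (by rw [hsum, hκp])

theorem DN_update {d : ℕ} {f : Ed d → ℝ} (hf : ContDiff ℝ ∞ f) (hc : HasCompactSupport f) (k : ℕ) (a : Fin d)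
    (y : Fin d → ℝ) : DN f k (WithLp.toLp 2 y) ≤ ∫⁻ t, DN f (k + 1) (WithLp.toLp 2 (Function.update y a t)) := by
  set γ : ℝ → Ed d := fun t => WithLp.toLp 2 (Function.update y a t)
  have hγ : γ = fun t => WithLp.toLp 2 y + (t - y a) • EuclideanSpace.single a (1 : ℝ) := by
    funext t
    ext i
    by_cases hi : i = a
    · subst hi; simp [γ]
    · simp [γ, hi]
  have hγd : ∀ t, HasDerivAt γ (EuclideanSpace.single a (1 : ℝ)) t := by
    intro t
    rw [hγ]
    simpa using (((hasDerivAt_id t).sub_const (y a)).smul_const (EuclideanSpace.single a (1 : ℝ))).const_add (WithLp.toLp 2 y)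
  have hγc : ContDiff ℝ 1 γ := by rw [hγ]; fun_prop
  have hemb : Topology.IsClosedEmbedding γ :=
    (EuclideanSpace.equiv (Fin d) ℝ).symm.toHomeomorph.isClosedEmbedding.comp (isClosedEmbedding_update y a)
  have hk : ContDiff ℝ ∞ (iteratedFDeriv ℝ k f) := hf.iteratedFDeriv_right (by have h9 : ((⊤ : ℕ∞) + (k : ℕ∞)) ≤ ⊤ := le_top; exact_mod_cast h9)
  have hG : ContDiff ℝ 1 (iteratedFDeriv ℝ k f ∘ γ) := (hk.of_le (by exact_mod_cast le_top)).comp hγc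
  have hs : HasCompactSupport (iteratedFDeriv ℝ k f ∘ γ) :=
    (hc.iteratedFDeriv (𝕜 := ℝ) k).comp_isClosedEmbedding hemb
  have h := HasCompactSupport.enorm_le_lintegral_Ici_deriv hG hs (y a)
  have e : γ (y a) = WithLp.toLp 2 y := by simp [γ]
  unfold DN
  rw [← e]
  refine h.trans ((setLIntegral_le_lintegral _ _).trans (lintegral_mono fun t => ?_))
  have hd : HasDerivAt (iteratedFDeriv ℝ k f ∘ γ) (fderiv ℝ (iteratedFDeriv ℝ k f) (γ t) (EuclideanSpace.single a (1 : ℝ))) t :=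
    ((hk.differentiable (by simp)) (γ t)).hasFDerivAt.comp_hasDerivAt t (hγd t)
  change ‖deriv (iteratedFDeriv ℝ k f ∘ γ) t‖ₑ ≤ ‖iteratedFDeriv ℝ (k + 1) f (γ t)‖ₑ
  rw [hd.deriv, ← ofReal_norm, ← ofReal_norm]
  apply ENNReal.ofReal_le_ofReal
  refine (ContinuousLinearMap.le_opNorm _ _).trans ?_
  rw [norm_fderiv_iteratedFDeriv]
  simp

/-- derivative size in coordinates -/
def DNc {d : ℕ} (f : Ed d → ℝ) (k : ℕ) (y : Fin d → ℝ) : ℝ≥0∞ := DN f k (WithLp.toLp 2 y)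

theorem DNc_meas {d : ℕ} {f : Ed d → ℝ} (hf : ContDiff ℝ ∞ f) (k : ℕ) : Measurable (DNc f k) :=
  (DN_cont hf k).measurable.comp (WithLp.measurable_toLp 2 _)

theorem DNc_lmarginal {d : ℕ} {f : Ed d → ℝ} (hf : ContDiff ℝ ∞ f) (hc : HasCompactSupport f) (i : ℕ)
    (S : Finset (Fin d)) : DNc f i ≤ lmarginal (fun _ => (volume : Measure ℝ)) S (DNc f (i + S.card)) := by
  induction S using Finset.induction_on with
  | empty => simp
  | insert a S ha ih =>
    rw [lmarginal_insert' _ (DNc_meas hf _) ha]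
    refine ih.trans (lmarginal_mono ?_)
    intro y
    rw [Finset.card_insert_of_notMem ha]
    exact DN_update hf hc (i + S.card) a y

theorem lmarginal_mul_left {d : ℕ} (S : Finset (Fin d)) (A B : (Fin d → ℝ) → ℝ≥0∞) (hB : Measurable B) :
    lmarginal (fun _ => (volume : Measure ℝ)) S (fun y => lmarginal (fun _ => (volume : Measure ℝ)) S A y * B y) =
      fun y => lmarginal (fun _ => (volume : Measure ℝ)) S A y * lmarginal (fun _ => (volume : Measure ℝ)) S B y := by
  funext y
  have h : ∀ v : (i : S) → ℝ, lmarginal (fun _ => (volume : Measure ℝ)) S A (Function.updateFinset y S v) =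
      lmarginal (fun _ => (volume : Measure ℝ)) S A y := by
    intro v
    apply lmarginal_congr
    intro i hi
    simp [Function.updateFinset, hi]
  conv_lhs => rw [lmarginal]
  simp_rw [h]
  have hm : Measurable (fun v : (i : S) → ℝ => B (Function.updateFinset y S v)) := hB.comp measurable_updateFinset
  rw [lintegral_const_mul _ hm]
  rfl

theorem lmarginal_tensor {d : ℕ} (S : Finset (Fin d)) (A B : (Fin d → ℝ) → ℝ≥0∞) (hA : Measurable A) (hB : Measurable B) :
    ∫⁻ y, lmarginal (fun _ => (volume : Measure ℝ)) S A y * lmarginal (fun _ => (volume : Measure ℝ)) Sᶜ B y =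
      (∫⁻ y, A y) * ∫⁻ y, B y := by
  have hu : ∀ F : (Fin d → ℝ) → ℝ≥0∞, Measurable F → 
      lmarginal (fun _ => (volume : Measure ℝ)) Sᶜ (lmarginal (fun _ => (volume : Measure ℝ)) S F) = fun _ => ∫⁻ y, F y := by
    intro F hF
    rw [← lmarginal_union _ _ hF (disjoint_compl_left), Finset.union_comm, Finset.union_compl, lmarginal_univ]
    rfl
  have hu' : ∀ F : (Fin d → ℝ) → ℝ≥0∞, Measurable F → 
      lmarginal (fun _ => (volume : Measure ℝ)) S (lmarginal (fun _ => (volume : Measure ℝ)) Sᶜ F) = fun _ => ∫⁻ y, F y := by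
    intro F hF
    rw [← lmarginal_union _ _ hF (disjoint_compl_right), Finset.union_compl, lmarginal_univ]
    rfl
  have mA : Measurable (lmarginal (fun _ => (volume : Measure ℝ)) S A) := hA.lmarginal _
  have mB : Measurable (lmarginal (fun _ => (volume : Measure ℝ)) Sᶜ B) := hB.lmarginal _
  have hm : Measurable (fun y => lmarginal (fun _ => (volume : Measure ℝ)) S A y * lmarginal (fun _ => (volume : Measure ℝ)) Sᶜ B y) :=
    mA.mul mB
  have h1 := hu _ hm
  rw [lmarginal_mul_left S A _ mB, hu' B hB] at h1
  have h2 := congrFun h1 0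
  simp only at h2
  rw [← h2]
  unfold lmarginal at *
  rw [lintegral_mul_const]
  · congr 1
    exact congrFun (hu A hA) 0
  · exact mA.comp measurable_updateFinset

theorem bil_one {d m : ℕ} (hdm : d ≤ m) (i j : ℕ) (hij : i + j ≤ m) : ∃ s t : ℕ, i + s ≤ m ∧ j + t ≤ m ∧ s + t = d ∧
    ∀ (f g : Ed d → ℝ) (_ : ContDiff ℝ ∞ f) (_ : ContDiff ℝ ∞ g) (_ : HasCompactSupport f) (_ : HasCompactSupport g),
    ∫⁻ x, DN f i x * DN g j x ≤ (∫⁻ x, DN f (i + s) x) * ∫⁻ x, DN g (j + t) x := by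
  set s := min (m - i) d
  have hs : s ≤ d := min_le_right _ _
  obtain ⟨S, -, hS⟩ := Finset.exists_subset_card_eq (s := (Finset.univ : Finset (Fin d))) (n := s) (by simpa using hs)
  have hSc : (Sᶜ).card = d - s := by rw [Finset.card_compl, hS]; simp
  refine ⟨s, d - s, by omega, by omega, by omega, ?_⟩
  intro f g hf hg hcf hcg
  have mp := PiLp.volume_preserving_toLp (Fin d)
  have conv : ∀ F : Ed d → ℝ≥0∞, Measurable F → ∫⁻ x, F x = ∫⁻ y : Fin d → ℝ, F (WithLp.toLp 2 y) := by
    intro F hF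
    rw [← mp.lintegral_comp hF]
  have mf := fun k => (DN_cont hf k).measurable
  have mg := fun k => (DN_cont hg k).measurable
  rw [conv _ (mf _), conv _ (mg _), conv (fun x => DN f i x * DN g j x) ((mf i).mul (mg j))]
  have h1 := lmarginal_tensor S _ _ (DNc_meas hf (i + s)) (DNc_meas hg (j + (d - s)))
  refine le_trans ?_ (le_of_eq h1)
  apply lintegral_mono
  intro y
  have a1 := DNc_lmarginal hf hcf i S y
  have a2 := DNc_lmarginal hg hcg j Sᶜ y
  rw [hS] at a1
  rw [hSc] at a2
  exact mul_le_mul' a1 a2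

/-- `L^p` size of an `ℝ≥0∞`-valued function -/
def LpE {d : ℕ} (p : ℝ) (F : Ed d → ℝ≥0∞) : ℝ≥0∞ := (∫⁻ x, F x ^ p) ^ (1 / p)

theorem LpE_mono {d : ℕ} {p : ℝ} (hp : 1 ≤ p) {F G : Ed d → ℝ≥0∞} (h : ∀ x, F x ≤ G x) : LpE p F ≤ LpE p G := by
  have hp0 : 0 < p := by linarith
  unfold LpE
  gcongr with x
  exact h x

theorem LpE_zero {d : ℕ} {p : ℝ} (hp : 1 ≤ p) : LpE p (fun _ : Ed d => 0) = 0 := by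
  have hp0 : 0 < p := by linarith
  unfold LpE
  simp [hp0]

theorem LpE_add {d : ℕ} {p : ℝ} (hp : 1 ≤ p) {F G : Ed d → ℝ≥0∞} (hF : Measurable F) (hG : Measurable G) :
    LpE p (fun x => F x + G x) ≤ LpE p F + LpE p G :=
  ENNReal.lintegral_Lp_add_le hF.aemeasurable hG.aemeasurable hp

theorem LpE_sum {d : ℕ} {p : ℝ} (hp : 1 ≤ p) {ι : Type*} (s : Finset ι) {F : ι → Ed d → ℝ≥0∞} (hF : ∀ i, Measurable (F i)) :
    LpE p (fun x => ∑ i ∈ s, F i x) ≤ ∑ i ∈ s, LpE p (F i) := by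
  classical
  induction s using Finset.induction_on with
  | empty => simp [LpE_zero hp]
  | insert a s ha ih =>
    simp only [Finset.sum_insert ha]
    refine (LpE_add hp (hF a) (Finset.measurable_fun_sum _ fun i _ => hF i)).trans ?_
    gcongr

theorem LpE_const_mul {d : ℕ} {p : ℝ} (hp : 1 ≤ p) {F : Ed d → ℝ≥0∞} (hF : Measurable F) (c : ℝ≥0∞) :
    LpE p (fun x => c * F x) = c * LpE p F := by
  have hp0 : 0 < p := by linarith
  unfold LpE
  simp_rw [ENNReal.mul_rpow_of_nonneg _ _ hp0.le]
  rw [lintegral_const_mul _ (hF.pow_const p), ENNReal.mul_rpow_of_nonneg _ _ (by positivity), ← ENNReal.rpow_mul]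
  congr 1
  rw [mul_one_div_cancel hp0.ne', ENNReal.rpow_one]

/-- scaled Sobolev norm -/
def NR {d : ℕ} (p r : ℝ) (m : ℕ) (f : Ed d → ℝ) : ℝ≥0∞ :=
  ∑ k ∈ Finset.range (m + 1), ENNReal.ofReal r ^ k * LpE p (DN f k)

theorem le_NR {d : ℕ} (p r : ℝ) {m k : ℕ} (f : Ed d → ℝ) (hk : k ≤ m) : ENNReal.ofReal r ^ k * LpE p (DN f k) ≤ NR p r m f := by
  unfold NR
  exact Finset.single_le_sum (f := fun k => ENNReal.ofReal r ^ k * LpE p (DN f k)) (fun _ _ => zero_le) (Finset.mem_range.2 (by omega))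

theorem NR_add {d : ℕ} {p : ℝ} (hp : 1 ≤ p) (r : ℝ) (m : ℕ) {f g : Ed d → ℝ} (hf : ContDiff ℝ ∞ f) (hg : ContDiff ℝ ∞ g) :
    NR p r m (fun x => f x + g x) ≤ NR p r m f + NR p r m g := by
  unfold NR
  rw [← Finset.sum_add_distrib]
  apply Finset.sum_le_sum
  intro k _
  rw [← mul_add]
  gcongr
  refine le_trans (LpE_mono hp fun x => ?_) (LpE_add hp (DN_cont hf k).measurable (DN_cont hg k).measurable)
  unfold DN
  have : iteratedFDeriv ℝ k (fun x => f x + g x) x = iteratedFDeriv ℝ k f x + iteratedFDeriv ℝ k g x :=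
    iteratedFDeriv_add_apply (hf.contDiffAt.of_le (by exact_mod_cast le_top)) (hg.contDiffAt.of_le (by exact_mod_cast le_top))
  rw [this]
  exact enorm_add_le _ _

/-- The bilinear estimate, abstractly. -/
def BilC (d m : ℕ) (p : ℝ) (C : ℝ≥0∞) : Prop := ∀ i j : ℕ, i + j ≤ m → ∀ (f g : Ed d → ℝ) (_ : ContDiff ℝ ∞ f) (_ : ContDiff ℝ ∞ g)
      (z : Ed d) (r : ℝ)
      (_ : 0 < r) (_ : tsupport f ⊆ closedBall z (2 * r)) (_ : tsupport g ⊆ closedBall z (2 * r)),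
      ENNReal.ofReal r ^ (i + j) * LpE p (fun x => DN f i x * DN g j x) ≤ C * ENNReal.ofReal r ^ (-((d : ℝ) / p)) * (NR p r m f * NR p r m g)

theorem bilC_of_each {d m : ℕ} {p : ℝ} (h : ∀ i j : ℕ, i + j ≤ m → ∃ C : ℝ≥0∞, C ≠ ⊤ ∧ ∀ (f g : Ed d → ℝ) (_ : ContDiff ℝ ∞ f) (_ : ContDiff ℝ ∞ g)
      (z : Ed d) (r : ℝ)
      (_ : 0 < r) (_ : tsupport f ⊆ closedBall z (2 * r)) (_ : tsupport g ⊆ closedBall z (2 * r)),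
      ENNReal.ofReal r ^ (i + j) * LpE p (fun x => DN f i x * DN g j x) ≤ C * ENNReal.ofReal r ^ (-((d : ℝ) / p)) * (NR p r m f * NR p r m g)) :
    ∃ C : ℝ≥0∞, C ≠ ⊤ ∧ BilC d m p C := by
  choose! C hC hb using h
  set I := (Finset.range (m + 1) ×ˢ Finset.range (m + 1)).filter (fun q => q.1 + q.2 ≤ m)
  refine ⟨∑ q ∈ I, C q.1 q.2, ?_, ?_⟩
  · refine (ENNReal.sum_lt_top.2 fun q hq => ?_).ne
    exact (hC q.1 q.2 (Finset.mem_filter.1 hq).2).lt_top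
  · intro i j hij f g hf hg z r hr hsf hsg
    refine (hb i j hij f g hf hg z r hr hsf hsg).trans ?_
    gcongr
    refine Finset.single_le_sum (f := fun q : ℕ × ℕ => C q.1 q.2) (fun _ _ => zero_le) (a := (i, j)) ?_
    simp only [I, Finset.mem_filter, Finset.mem_product, Finset.mem_range]
    omega

theorem bilC_exists {d m : ℕ} (hd : 0 < d) {p : ℝ} (hp : 1 ≤ p)
    (halg : (1 < p ∧ (d : ℝ) / p < m) ∨ (p = 1 ∧ d ≤ m)) : ∃ C : ℝ≥0∞, C ≠ ⊤ ∧ BilC d m p C := by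
  have hp0 : 0 < p := by linarith
  apply bilC_of_each
  intro i j hij
  rcases halg with ⟨-, hdp⟩ | ⟨hp1, hdm⟩
  · obtain ⟨C, hC, H⟩ := bil_pot hd hp hdp i j hij
    refine ⟨C ^ (1 / p), ENNReal.rpow_ne_top_of_nonneg (by positivity) hC, ?_⟩
    intro f g hf hg z r hr hsf hsg
    have h := H f g hf hg z r hr hsf hsg
    have h2 : LpE p (fun x => DN f i x * DN g j x) ≤ C ^ (1 / p) * ENNReal.ofReal r ^ (((m - i : ℕ) : ℝ) + ((m - j : ℕ) : ℝ) - d / p) *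
        (LpE p (DN f m) * LpE p (DN g m)) := by
      unfold LpE
      refine (ENNReal.rpow_le_rpow h (by positivity)).trans (le_of_eq ?_)
      rw [ENNReal.mul_rpow_of_nonneg _ _ (by positivity), ENNReal.mul_rpow_of_nonneg _ _ (by positivity),
        ENNReal.mul_rpow_of_nonneg _ _ (by positivity), ← ENNReal.rpow_mul]
      congr 3
      field_simp
    have hR0 : ENNReal.ofReal r ≠ 0 := by simpa using hr
    have hRt : ENNReal.ofReal r ≠ ⊤ := by simp
    calc _ ≤ ENNReal.ofReal r ^ (i + j) * (C ^ (1 / p) * ENNReal.ofReal r ^ (((m - i : ℕ) : ℝ) + ((m - j : ℕ) : ℝ) - d / p) *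
        (LpE p (DN f m) * LpE p (DN g m))) := by gcongr
      _ = C ^ (1 / p) * (ENNReal.ofReal r ^ (i + j) * ENNReal.ofReal r ^ (((m - i : ℕ) : ℝ) + ((m - j : ℕ) : ℝ) - d / p)) * (LpE p (DN f m) * LpE p (DN g m)) := by ring
      _ = C ^ (1 / p) * (ENNReal.ofReal r ^ (-((d : ℝ) / p)) * (ENNReal.ofReal r ^ m * ENNReal.ofReal r ^ m)) * (LpE p (DN f m) * LpE p (DN g m)) := by
        congr 2
        rw [← pow_add, ← ENNReal.rpow_natCast, ← ENNReal.rpow_natCast, ← ENNReal.rpow_add _ _ hR0 hRt, ← ENNReal.rpow_add _ _ hR0 hRt]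
        congr 1
        rw [Nat.cast_sub (by omega), Nat.cast_sub (by omega)]
        push_cast; ring
      _ = C ^ (1 / p) * ENNReal.ofReal r ^ (-((d : ℝ) / p)) * ((ENNReal.ofReal r ^ m * LpE p (DN f m)) * (ENNReal.ofReal r ^ m * LpE p (DN g m))) := by ring
      _ ≤ _ := by
        gcongr
        · exact le_NR p r f le_rfl
        · exact le_NR p r g le_rfl
  · subst hp1
    obtain ⟨s, t, hs, ht, hst, H⟩ := bil_one hdm i j hij
    refine ⟨1, by simp, ?_⟩
    intro f g hf hg z r hr hsf hsg
    have hcf : HasCompactSupport f := HasCompactSupport.of_support_subset_isCompact (isCompact_closedBall z (2 * r)) ((subset_tsupport f).trans hsf)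
    have hcg : HasCompactSupport g := HasCompactSupport.of_support_subset_isCompact (isCompact_closedBall z (2 * r)) ((subset_tsupport g).trans hsg)
    have h := H f g hf hg hcf hcg
    have e : ∀ F : Ed d → ℝ≥0∞, LpE 1 F = ∫⁻ x, F x := by intro F; simp [LpE]
    rw [e]
    have hR0 : ENNReal.ofReal r ≠ 0 := by simpa using hr
    have hRt : ENNReal.ofReal r ≠ ⊤ := by simp
    calc _ ≤ ENNReal.ofReal r ^ (i + j) * ((∫⁻ x, DN f (i + s) x) * ∫⁻ x, DN g (j + t) x) := by gcongr
      _ = (ENNReal.ofReal r ^ (-((d : ℝ) / 1)) * (ENNReal.ofReal r ^ (i + s) * ENNReal.ofReal r ^ (j + t))) * ((∫⁻ x, DN f (i + s) x) * ∫⁻ x, DN g (j + t) x) := by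
        congr 1
        rw [← pow_add, ← ENNReal.rpow_natCast, ← ENNReal.rpow_natCast, ← ENNReal.rpow_add _ _ hR0 hRt]
        congr 1
        rw [← hst]; push_cast; ring
      _ = 1 * ENNReal.ofReal r ^ (-((d : ℝ) / 1)) * ((ENNReal.ofReal r ^ (i + s) * LpE 1 (DN f (i + s))) * (ENNReal.ofReal r ^ (j + t) * LpE 1 (DN g (j + t)))) := by
        rw [e, e]; ring
      _ ≤ _ := by
        gcongr
        · exact le_NR 1 r f hs
        · exact le_NR 1 r g ht

theorem DN_mul {d : ℕ} {f g : Ed d → ℝ} (hf : ContDiff ℝ ∞ f) (hg : ContDiff ℝ ∞ g) (k : ℕ) (x : Ed d) :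
    DN (fun x => f x * g x) k x ≤ ∑ i ∈ Finset.range (k + 1), (k.choose i : ℝ≥0∞) * (DN f i x * DN g (k - i) x) := by
  have h := norm_iteratedFDeriv_mul_le (n := k) (𝕜 := ℝ) (hf.of_le (m := k) (by exact_mod_cast le_top)) (hg.of_le (m := k) (by exact_mod_cast le_top)) x le_rfl
  unfold DN
  simp_rw [← ofReal_norm]
  refine (ENNReal.ofReal_le_ofReal h).trans (le_of_eq ?_)
  rw [ENNReal.ofReal_sum_of_nonneg (fun i _ => by positivity)]
  apply Finset.sum_congr rfl
  intro i _
  rw [ENNReal.ofReal_mul (by positivity), ENNReal.ofReal_mul (by positivity), ENNReal.ofReal_natCast, mul_assoc]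

theorem NR_mul {d m : ℕ} {p : ℝ} (hp : 1 ≤ p) {C : ℝ≥0∞} (hC : BilC d m p C) {f g : Ed d → ℝ} (hf : ContDiff ℝ ∞ f) (hg : ContDiff ℝ ∞ g)
    {z : Ed d} {r : ℝ} (hr : 0 < r) (hsf : tsupport f ⊆ closedBall z (2 * r)) (hsg : tsupport g ⊆ closedBall z (2 * r)) :
    NR p r m (fun x => f x * g x) ≤ ((∑ k ∈ Finset.range (m + 1), ∑ i ∈ Finset.range (k + 1), (k.choose i : ℝ≥0∞)) * C) * ENNReal.ofReal r ^ (-((d : ℝ) / p)) *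
      (NR p r m f * NR p r m g) := by
  conv_lhs => unfold NR
  rw [Finset.sum_mul, Finset.sum_mul, Finset.sum_mul]
  apply Finset.sum_le_sum
  intro k hk
  rw [Finset.mem_range] at hk
  have mm : ∀ i, Measurable (fun x => (DN f i x * DN g (k - i) x)) := fun i =>
    (DN_cont hf i).measurable.mul (DN_cont hg (k - i)).measurable
  calc ENNReal.ofReal r ^ k * LpE p (DN (fun x => f x * g x) k)
      ≤ ENNReal.ofReal r ^ k * ∑ i ∈ Finset.range (k + 1), (k.choose i : ℝ≥0∞) * LpE p (fun x => DN f i x * DN g (k - i) x) := by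
        gcongr
        refine (LpE_mono hp (DN_mul hf hg k)).trans ((LpE_sum hp _ fun i => (mm i).const_mul _).trans (le_of_eq ?_))
        apply Finset.sum_congr rfl
        intro i _
        rw [LpE_const_mul hp (mm i)]
    _ = ∑ i ∈ Finset.range (k + 1), (k.choose i : ℝ≥0∞) * (ENNReal.ofReal r ^ k * LpE p (fun x => DN f i x * DN g (k - i) x)) := by
        rw [Finset.mul_sum]; apply Finset.sum_congr rfl; intro i _; ring
    _ ≤ ∑ i ∈ Finset.range (k + 1), (k.choose i : ℝ≥0∞) * (C * ENNReal.ofReal r ^ (-((d : ℝ) / p)) * (NR p r m f * NR p r m g)) := by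
        apply Finset.sum_le_sum
        intro i hi
        rw [Finset.mem_range] at hi
        refine mul_le_mul' le_rfl ?_
        have := hC i (k - i) (by omega) f g hf hg z r hr hsf hsg
        rwa [show i + (k - i) = k by omega] at this
    _ = _ := by
        rw [← Finset.sum_mul]; ring

/-- Algebra property with constant `C`. -/
def AlgC (d m : ℕ) (p : ℝ) (C : ℝ≥0∞) : Prop := ∀ (f g : Ed d → ℝ) (_ : ContDiff ℝ ∞ f) (_ : ContDiff ℝ ∞ g)
    (z : Ed d) (r : ℝ) (_ : 0 < r) (_ : tsupport f ⊆ closedBall z (2 * r)) (_ : tsupport g ⊆ closedBall z (2 * r)),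
    NR p r m (fun x => f x * g x) ≤ C * ENNReal.ofReal r ^ (-((d : ℝ) / p)) * (NR p r m f * NR p r m g)

theorem algC_exists {d m : ℕ} (hd : 0 < d) {p : ℝ} (hp : 1 ≤ p)
    (halg : (1 < p ∧ (d : ℝ) / p < m) ∨ (p = 1 ∧ d ≤ m)) : ∃ C : ℝ≥0∞, C ≠ ⊤ ∧ AlgC d m p C := by
  obtain ⟨C, hC, H⟩ := bilC_exists hd hp halg
  refine ⟨(∑ k ∈ Finset.range (m + 1), ∑ i ∈ Finset.range (k + 1), (k.choose i : ℝ≥0∞)) * C, ?_, ?_⟩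
  · apply ENNReal.mul_ne_top _ hC
    refine (ENNReal.sum_lt_top.2 fun k _ => ENNReal.sum_lt_top.2 fun i _ => ?_).ne
    exact (ENNReal.natCast_ne_top _).lt_top
  · intro f g hf hg z r hr hsf hsg
    exact NR_mul hp H hf hg hr hsf hsg

theorem tsupport_pow_sub {d : ℕ} {f : Ed d → ℝ} {B : Set (Ed d)} (h : tsupport f ⊆ B) (n : ℕ) :
    tsupport (fun x => f x ^ (n + 1)) ⊆ B := by
  refine (closure_mono ?_).trans h
  intro x hx
  simp only [Function.mem_support] at *
  intro h0
  simp [h0] at hx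

theorem tsupport_sub_sub {d : ℕ} {f g : Ed d → ℝ} {B : Set (Ed d)} (hf : tsupport f ⊆ B) (hg : tsupport g ⊆ B) :
    tsupport (fun x => f x - g x) ⊆ B := by
  have : tsupport (fun x => f x - g x) ⊆ tsupport f ∪ tsupport g := tsupport_sub f g
  exact this.trans (union_subset hf hg)

theorem NR_pow {d m : ℕ} {p : ℝ} {C : ℝ≥0∞} (hC : AlgC d m p C) {f : Ed d → ℝ} (hf : ContDiff ℝ ∞ f)
    {z : Ed d} {r : ℝ} (hr : 0 < r) (hsf : tsupport f ⊆ closedBall z (2 * r)) (n : ℕ) :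
    NR p r m (fun x => f x ^ (n + 1)) ≤ (C * ENNReal.ofReal r ^ (-((d : ℝ) / p))) ^ n * NR p r m f ^ (n + 1) := by
  induction n with
  | zero => simp
  | succ n ih =>
    have h := hC (fun x => f x ^ (n + 1)) f (hf.pow _) hf z r hr (tsupport_pow_sub hsf n) hsf
    simp_rw [← pow_succ] at h
    refine h.trans ?_
    calc _ ≤ C * ENNReal.ofReal r ^ (-((d : ℝ) / p)) * (((C * ENNReal.ofReal r ^ (-((d : ℝ) / p))) ^ n * NR p r m f ^ (n + 1)) * NR p r m f) := by
          gcongr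
      _ = _ := by ring

theorem NR_pow_sub {d m : ℕ} {p : ℝ} (hp : 1 ≤ p) {C : ℝ≥0∞} (hC : AlgC d m p C) {f g : Ed d → ℝ} (hf : ContDiff ℝ ∞ f) (hg : ContDiff ℝ ∞ g)
    {z : Ed d} {r : ℝ} (hr : 0 < r) (hsf : tsupport f ⊆ closedBall z (2 * r)) (hsg : tsupport g ⊆ closedBall z (2 * r))
    {M : ℝ≥0∞} (hfM : NR p r m f ≤ M) (hgM : NR p r m g ≤ M) (n : ℕ) :
    NR p r m (fun x => f x ^ (n + 1) - g x ^ (n + 1)) ≤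
      (n + 1 : ℕ) * ((C * ENNReal.ofReal r ^ (-((d : ℝ) / p))) * M) ^ n * NR p r m (fun x => f x - g x) := by
  induction n with
  | zero => simp
  | succ n ih =>
    set K := C * ENNReal.ofReal r ^ (-((d : ℝ) / p))
    have e : (fun x => f x ^ (n + 1 + 1) - g x ^ (n + 1 + 1)) = fun x => f x * (f x ^ (n + 1) - g x ^ (n + 1)) + (f x - g x) * g x ^ (n + 1) := by
      funext x; ring
    rw [e]
    have hd1 : ContDiff ℝ ∞ (fun x => f x ^ (n + 1) - g x ^ (n + 1)) := (hf.pow _).sub (hg.pow _)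
    have hd2 : ContDiff ℝ ∞ (fun x => f x - g x) := hf.sub hg
    refine (NR_add hp r m (hf.mul hd1) (hd2.mul (hg.pow _))).trans ?_
    have h1 := hC f _ hf hd1 z r hr hsf (tsupport_sub_sub (tsupport_pow_sub hsf n) (tsupport_pow_sub hsg n))
    have h2 := hC _ (fun x => g x ^ (n + 1)) hd2 (hg.pow _) z r hr (tsupport_sub_sub hsf hsg) (tsupport_pow_sub hsg n)
    have h3 := NR_pow hC hg hr hsg n
    calc _ ≤ K * (NR p r m f * NR p r m (fun x => f x ^ (n + 1) - g x ^ (n + 1))) + K * (NR p r m (fun x => f x - g x) * NR p r m (fun x => g x ^ (n + 1))) :=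
          add_le_add h1 h2
      _ ≤ K * (M * ((n + 1 : ℕ) * (K * M) ^ n * NR p r m (fun x => f x - g x))) + K * (NR p r m (fun x => f x - g x) * (K ^ n * M ^ (n + 1))) := by
          have h4 : NR p r m (fun x => g x ^ (n + 1)) ≤ K ^ n * M ^ (n + 1) := h3.trans (by gcongr)
          gcongr
      _ = _ := by push_cast; ring

theorem DN_bdd {d : ℕ} {f : Ed d → ℝ} (hf : ContDiff ℝ ∞ f) (hc : HasCompactSupport f) (i : ℕ) :
    ∃ C : ℝ≥0∞, C ≠ ⊤ ∧ ∀ x, DN f i x ≤ C := by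
  have h1 : Continuous (iteratedFDeriv ℝ i f) := hf.continuous_iteratedFDeriv (by exact_mod_cast le_top)
  have h2 : HasCompactSupport (iteratedFDeriv ℝ i f) := hc.iteratedFDeriv i
  obtain ⟨C, hC⟩ := h1.bounded_above_of_compact_support h2
  refine ⟨ENNReal.ofReal C, by simp, fun x => ?_⟩
  unfold DN
  rw [← ofReal_norm]
  exact ENNReal.ofReal_le_ofReal (hC x)

/-- Properties of a cutoff function. -/
def IsCut (d m : ℕ) (Cx : ℝ≥0∞) (z : Ed d) (r : ℝ) (χ : Ed d → ℝ) : Prop :=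
  ContDiff ℝ ∞ χ ∧ tsupport χ ⊆ closedBall z (2 * r) ∧ (∀ x ∈ closedBall z r, χ x = 1) ∧
    ∀ i ≤ m, ∀ x, ENNReal.ofReal r ^ i * DN χ i x ≤ Cx

theorem cut_exists (d m : ℕ) : ∃ Cx : ℝ≥0∞, Cx ≠ ⊤ ∧ ∀ (z : Ed d) (r : ℝ), 0 < r → ∃ χ, IsCut d m Cx z r χ := by
  let b : ContDiffBump (0 : Ed d) := ⟨1, 2, by norm_num, by norm_num⟩
  have hb : ContDiff ℝ ∞ (b : Ed d → ℝ) := b.contDiff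
  choose C hC hCb using fun i => DN_bdd hb b.hasCompactSupport i
  refine ⟨∑ i ∈ Finset.range (m + 1), C i, (ENNReal.sum_lt_top.2 fun i _ => (hC i).lt_top).ne, ?_⟩
  intro z r hr
  refine ⟨fun x => b (r⁻¹ • (x - z)), ?_, ?_, ?_, ?_⟩
  · exact hb.comp (by fun_prop)
  · refine closure_minimal ?_ isClosed_closedBall
    intro x hx
    have : r⁻¹ • (x - z) ∈ Function.support b := hx
    rw [b.support_eq, mem_ball_zero_iff, norm_smul, norm_inv, Real.norm_of_nonneg hr.le] at this
    rw [mem_closedBall, dist_eq_norm]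
    have h2 : r⁻¹ * ‖x - z‖ < 2 := this
    rw [inv_mul_lt_iff₀ hr] at h2
    linarith
  · intro x hx
    apply b.one_of_mem_closedBall
    rw [mem_closedBall, dist_eq_norm] at hx
    rw [mem_closedBall_zero_iff, norm_smul, norm_inv, Real.norm_of_nonneg hr.le]
    change r⁻¹ * ‖x - z‖ ≤ 1
    rw [inv_mul_le_iff₀ hr]
    linarith
  · intro i hi x
    have e : DN (fun x => b (r⁻¹ • (x - z))) i x = ENNReal.ofReal (r⁻¹) ^ i * DN b i (r⁻¹ • (x - z)) := by
      unfold DN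
      have e1 := iteratedFDeriv_comp_sub (𝕜 := ℝ) (f := fun y => b (r⁻¹ • y)) i z x
      rw [e1]
      have e2 := iteratedFDeriv_comp_const_smul (𝕜 := ℝ) (r⁻¹) (i := i) (hb.of_le (m := i) (by exact_mod_cast le_top)) 
      rw [e2]
      rw [enorm_smul, enorm_pow, Real.enorm_of_nonneg (by positivity)]
    rw [e, ← mul_assoc, ← mul_pow, ← ENNReal.ofReal_mul hr.le, mul_inv_cancel₀ hr.ne']
    simp only [ENNReal.ofReal_one, one_pow, one_mul]
    exact (hCb i _).trans (Finset.single_le_sum (f := C) (fun _ _ => zero_le) (Finset.mem_range.2 (by omega)))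

theorem NR_cut {d m : ℕ} {p : ℝ} (hp : 1 ≤ p) {Cx : ℝ≥0∞} {z : Ed d} {r : ℝ} {χ : Ed d → ℝ}
    (hχ : IsCut d m Cx z r χ) {U : Ed d → ℝ} (hU : ContDiff ℝ ∞ U) {V : (Fin d → ℕ) → Ed d → ℝ}
    (hV : ∀ β, Measurable (V β)) (hUV : ∀ β ∈ multiIdx d m, ∀ x ∈ closedBall z (2 * r), pderivA d β U x = V β x) :
    NR p r m (fun x => χ x * U x) ≤
      (∑ k ∈ Finset.range (m + 1), ∑ i ∈ Finset.range (k + 1), (k.choose i : ℝ≥0∞) * Cx * (d ^ (k - i) : ℕ)) *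
        ∑ β ∈ multiIdx d m, ENNReal.ofReal r ^ (∑ i, β i) * LpE p (fun x => ‖V β x‖ₑ) := by
  obtain ⟨hχs, hχt, -, hχD⟩ := hχ
  set R := ENNReal.ofReal r
  set S : Ed d → ℝ≥0∞ := fun x => ∑ β ∈ multiIdx d m, R ^ (∑ i, β i) * ‖V β x‖ₑ with hS
  have hVm : ∀ β, Measurable (fun x => ‖V β x‖ₑ) := fun β => (hV β).enorm
  have hSm : Measurable S := Finset.measurable_fun_sum _ fun β _ => (hVm β).const_mul _
  have hSL : LpE p S ≤ ∑ β ∈ multiIdx d m, R ^ (∑ i, β i) * LpE p (fun x => ‖V β x‖ₑ) := by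
    refine (LpE_sum hp _ (F := fun β x => R ^ (∑ i, β i) * ‖V β x‖ₑ) fun β => (hVm β).const_mul _).trans (le_of_eq ?_)
    exact Finset.sum_congr rfl fun β _ => LpE_const_mul hp (hVm β) _
  refine le_trans ?_ (mul_le_mul_right hSL _)
  rw [Finset.sum_mul]
  unfold NR
  apply Finset.sum_le_sum
  intro k hk
  rw [Finset.mem_range] at hk
  have hfs : ContDiff ℝ ∞ (fun x => χ x * U x) := hχs.mul hU
  rw [← LpE_const_mul hp (DN_cont hfs k).measurable, ← LpE_const_mul hp hSm]
  refine LpE_mono hp fun x => ?_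
  by_cases hx : x ∈ closedBall z (2 * r)
  · calc R ^ k * DN (fun x => χ x * U x) k x
        ≤ R ^ k * ∑ i ∈ Finset.range (k + 1), (k.choose i : ℝ≥0∞) * (DN χ i x * DN U (k - i) x) := by
          gcongr; exact DN_mul hχs hU k x
      _ = ∑ i ∈ Finset.range (k + 1), (k.choose i : ℝ≥0∞) * ((R ^ i * DN χ i x) * (R ^ (k - i) * DN U (k - i) x)) := by
          rw [Finset.mul_sum]
          refine Finset.sum_congr rfl fun i hi => ?_
          rw [Finset.mem_range] at hi
          have : R ^ k = R ^ i * R ^ (k - i) := by rw [← pow_add]; congr 1; omega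
          rw [this]; ring
      _ ≤ ∑ i ∈ Finset.range (k + 1), (k.choose i : ℝ≥0∞) * (Cx * ((d ^ (k - i) : ℕ) * S x)) := by
          refine Finset.sum_le_sum fun i hi => ?_
          rw [Finset.mem_range] at hi
          refine mul_le_mul_right (mul_le_mul' (hχD i (by omega) x) ?_) _
          · have := iter_le_sum (d := d) (m := m) (k := k - i) (by omega) hU x
            refine (mul_le_mul_right this _).trans ?_
            rw [mul_left_comm]
            gcongr
            rw [Finset.mul_sum, hS]
            refine le_trans (Finset.sum_le_sum fun β hβ => ?_) (Finset.sum_le_sum_of_subset (Finset.filter_subset _ _))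
            rw [Finset.mem_filter] at hβ
            rw [hUV β hβ.1 x hx, hβ.2]
      _ = _ := by
          rw [Finset.sum_mul]
          refine Finset.sum_congr rfl fun i hi => ?_
          ring
  · have : DN (fun x => χ x * U x) k x = 0 := by
      apply DN_zero
      intro h
      exact hx (hχt (closure_mono (Function.support_mul_subset_left χ U) h))
    rw [this]; simp

theorem setInt_full {d : ℕ} {Ω : Set (Ed d)} {φ : Ed d → ℝ} (h : tsupport φ ⊆ Ω) (u : Ed d → ℝ) :
    ∫ x in Ω, u x * φ x = ∫ x, u x * φ x := by
  apply setIntegral_eq_integral_of_forall_compl_eq_zero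
  intro x hx
  rw [image_eq_zero_of_notMem_tsupport (fun h' => hx (h h')), mul_zero]

theorem setInt_full_d {d : ℕ} {Ω : Set (Ed d)} {φ : Ed d → ℝ} (h : tsupport φ ⊆ Ω) (u : Ed d → ℝ) (α : Fin d → ℕ) :
    ∫ x in Ω, u x * pderivA d α φ x = ∫ x, u x * pderivA d α φ x := by
  apply setInt_full
  rw [pderivA_eq]
  exact (pderivL_tsupport _ _).trans h

theorem weak_restrict {d : ℕ} {Ω Ω' : Set (Ed d)} (h : Ω' ⊆ Ω) {α : Fin d → ℕ} {u v : Ed d → ℝ}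
    (hw : HasWeakDerivOn d Ω α u v) : HasWeakDerivOn d Ω' α u v := by
  refine ⟨hw.1.mono_set h, hw.2.1.mono_set h, ?_⟩
  intro φ hφ
  have := hw.2.2 φ ⟨hφ.1, hφ.2.1, hφ.2.2.trans h⟩
  rw [setInt_full_d (hφ.2.2.trans h), setInt_full (hφ.2.2.trans h)] at this
  rw [setInt_full_d hφ.2.2, setInt_full hφ.2.2, this]

theorem loc_congr {d : ℕ} {Ω : Set (Ed d)} (hΩ : MeasurableSet Ω) {u v : Ed d → ℝ} (h : u =ᵐ[volume.restrict Ω] v)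
    (hu : LocallyIntegrableOn u Ω volume) : LocallyIntegrableOn v Ω volume := by
  intro x hx
  obtain ⟨t, ht, hti⟩ := hu x hx
  refine ⟨t ∩ Ω, inter_mem ht self_mem_nhdsWithin, ?_⟩
  have h1 : IntegrableOn u (t ∩ Ω) volume := hti.mono_set inter_subset_left
  exact h1.congr_fun_ae (ae_restrict_of_ae_restrict_of_subset inter_subset_right h)

theorem weak_congr {d : ℕ} {Ω : Set (Ed d)} (hΩ : MeasurableSet Ω) {α : Fin d → ℕ} {u v u' v' : Ed d → ℝ}
    (hu : u =ᵐ[volume.restrict Ω] u') (hv : v =ᵐ[volume.restrict Ω] v')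
    (hw : HasWeakDerivOn d Ω α u v) : HasWeakDerivOn d Ω α u' v' := by
  refine ⟨loc_congr hΩ hu hw.1, loc_congr hΩ hv hw.2.1, ?_⟩
  intro φ hφ
  have := hw.2.2 φ hφ
  rw [integral_congr_ae (f := fun x => u x * pderivA d α φ x) (g := fun x => u' x * pderivA d α φ x) (hu.mono fun x hx => by simp only [hx]),
    integral_congr_ae (f := fun x => v x * φ x) (g := fun x => v' x * φ x) (hv.mono fun x hx => by simp only [hx])] at this
  exact this

theorem loc_int_mul {d : ℕ} {Ω : Set (Ed d)} {u φ : Ed d → ℝ} (hu : LocallyIntegrableOn u Ω volume) (hφ : Continuous φ)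
    (hc : HasCompactSupport φ) (hs : tsupport φ ⊆ Ω) : Integrable (fun x => u x * φ x) := by
  have h1 : IntegrableOn u (tsupport φ) volume := hu.integrableOn_compact_subset hs hc
  have h2 : IntegrableOn (fun x => u x * φ x) (tsupport φ) volume :=
    h1.mul_continuousOn hφ.continuousOn hc
  rw [← integrableOn_iff_integrable_of_support_subset (s := tsupport φ)]
  · exact h2
  · exact (Function.support_mul_subset_right u φ).trans (subset_tsupport φ)

theorem weak_unique {d : ℕ} {Ω : Set (Ed d)} (hΩ : IsOpen Ω) {α : Fin d → ℕ} {u v v' : Ed d → ℝ}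
    (hw : HasWeakDerivOn d Ω α u v) (hw' : HasWeakDerivOn d Ω α u v') : v =ᵐ[volume.restrict Ω] v' := by
  have := hΩ.ae_eq_zero_of_integral_contDiff_smul_eq_zero (f := v - v') (hw.2.1.sub hw'.2.1) ?_
  · rw [EventuallyEq, ae_restrict_iff' hΩ.measurableSet]
    filter_upwards [this] with x hx hxΩ
    have := hx hxΩ
    simpa [sub_eq_zero] using this
  · intro g hg hc hs
    have h1 := hw.2.2 g ⟨hg, hc, hs⟩
    have h2 := hw'.2.2 g ⟨hg, hc, hs⟩
    rw [h1, setInt_full hs, setInt_full hs] at h2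
    have h3 : ∫ x, v x * g x = ∫ x, v' x * g x := mul_left_cancel₀ (by simp) h2
    simp only [Pi.sub_apply, smul_eq_mul, mul_comm (g _), sub_mul]
    rw [integral_sub (loc_int_mul hw.2.1 hg.continuous hc hs) (loc_int_mul hw'.2.1 hg.continuous hc hs), h3, sub_self]

theorem weak_zero {d : ℕ} {Ω : Set (Ed d)} {u : Ed d → ℝ} (hu : LocallyIntegrableOn u Ω volume) :
    HasWeakDerivOn d Ω 0 u u := by
  refine ⟨hu, hu, ?_⟩
  intro φ hφ
  have : pderivA d 0 φ = φ := by
    rw [pderivA_eq]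
    have h : (idxList d 0).length = 0 := by rw [idxList_length]; simp
    rw [List.length_eq_zero_iff.1 h]; rfl
  simp [this]

theorem Lp_lim {d : ℕ} {p : ℝ} (hp : 1 ≤ p) {g : ℕ → Ed d → ℝ} (hg : ∀ k, MemLp (g k) (ENNReal.ofReal p) volume)
    (hc : Tendsto (fun n : ℕ × ℕ => eLpNorm (g n.1 - g n.2) (ENNReal.ofReal p) volume) atTop (𝓝 0)) :
    ∃ E : Ed d → ℝ, MemLp E (ENNReal.ofReal p) volume ∧ Tendsto (fun k => eLpNorm (g k - E) (ENNReal.ofReal p) volume) atTop (𝓝 0) := by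
  haveI : Fact (1 ≤ ENNReal.ofReal p) := ⟨one_le_ofReal hp⟩
  have h1 : CauchySeq (fun k => (hg k).toLp (g k)) := by
    rw [Lp.cauchySeq_Lp_iff_cauchySeq_eLpNorm]
    refine hc.congr fun n => eLpNorm_congr_ae ?_
    exact ((hg n.1).coeFn_toLp.sub (hg n.2).coeFn_toLp).symm
  obtain ⟨E, hE⟩ := cauchySeq_tendsto_of_complete h1
  refine ⟨E, Lp.memLp E, ?_⟩
  rw [← Lp.tendsto_Lp_iff_tendsto_eLpNorm'' g hg E (Lp.memLp E)]
  simpa using hE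

theorem tendsto_pair {d : ℕ} {p : ℝ} (hp : 1 ≤ p) {g : ℕ → Ed d → ℝ} {E φ : Ed d → ℝ} (hg : ∀ k, MemLp (g k) (ENNReal.ofReal p) volume)
    (hE : MemLp E (ENNReal.ofReal p) volume) (hgE : Tendsto (fun k => eLpNorm (g k - E) (ENNReal.ofReal p) volume) atTop (𝓝 0))
    (hφ : Continuous φ) (hc : HasCompactSupport φ) :
    Tendsto (fun k => ∫ x, g k x * φ x) atTop (𝓝 (∫ x, E x * φ x)) := by
  have h1p := one_le_ofReal hp
  have hIntg : ∀ {h : Ed d → ℝ}, MemLp h (ENNReal.ofReal p) volume → Integrable (fun x => h x * φ x) := fun hh =>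
    loc_int_mul (Ω := univ) (locallyIntegrableOn_univ.2 (hh.locallyIntegrable h1p)) hφ hc (subset_univ _)
  haveI : Fact (1 ≤ ENNReal.ofReal p) := ⟨h1p⟩
  have hq : ENNReal.HolderConjugate (ENNReal.conjExponent (ENNReal.ofReal p)) (ENNReal.ofReal p) :=
    (ENNReal.HolderConjugate.conjExponent h1p).symm
  have hφq : MemLp φ (ENNReal.conjExponent (ENNReal.ofReal p)) volume := hφ.memLp_of_hasCompactSupport hc
  apply tendsto_integral_of_L1' _ (hIntg hE).1 (Eventually.of_forall fun k => hIntg (hg k))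
  have hb : ∀ k, eLpNorm ((fun x => g k x * φ x) - fun x => E x * φ x) 1 volume ≤
      eLpNorm φ (ENNReal.conjExponent (ENNReal.ofReal p)) volume * eLpNorm (g k - E) (ENNReal.ofReal p) volume := by
    intro k
    have := eLpNorm_smul_le_mul_eLpNorm (p := ENNReal.conjExponent (ENNReal.ofReal p)) (q := ENNReal.ofReal p) (r := 1)
      ((hg k).sub hE).1 hφq.1
    refine le_trans (le_of_eq ?_) this
    congr 1
    funext x
    simp; ring
  refine tendsto_of_tendsto_of_tendsto_of_le_of_le tendsto_const_nhds ?_ (fun _ => zero_le) hb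
  have := ENNReal.Tendsto.const_mul hgE (a := eLpNorm φ (ENNReal.conjExponent (ENNReal.ofReal p)) volume) (Or.inr hφq.2.ne)
  simpa using this

theorem weak_lim {d : ℕ} {p : ℝ} (hp : 1 ≤ p) {h : ℕ → Ed d → ℝ} (hh : ∀ k, ContDiff ℝ ∞ (h k)) {α : Fin d → ℕ} {E0 E : Ed d → ℝ}
    (h0 : ∀ k, MemLp (h k) (ENNReal.ofReal p) volume) (h1 : ∀ k, MemLp (pderivA d α (h k)) (ENNReal.ofReal p) volume)
    (hE0 : MemLp E0 (ENNReal.ofReal p) volume) (hE : MemLp E (ENNReal.ofReal p) volume)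
    (ht0 : Tendsto (fun k => eLpNorm (h k - E0) (ENNReal.ofReal p) volume) atTop (𝓝 0))
    (ht1 : Tendsto (fun k => eLpNorm (pderivA d α (h k) - E) (ENNReal.ofReal p) volume) atTop (𝓝 0)) :
    HasWeakDerivOn d univ α E0 E := by
  have h1p := one_le_ofReal hp
  refine ⟨locallyIntegrableOn_univ.2 (hE0.locallyIntegrable h1p), locallyIntegrableOn_univ.2 (hE.locallyIntegrable h1p), ?_⟩
  intro φ hφ
  have hφ1 : ContDiff ℝ ∞ φ := hφ.1
  rw [setIntegral_univ, setIntegral_univ]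
  have a1 := tendsto_pair hp h0 hE0 ht0 (φ := pderivA d α φ) (pderivA_contDiff α hφ1).continuous
    (by rw [pderivA_eq]; exact pderivL_hcs _ hφ.2.1)
  have a2 := (tendsto_pair hp h1 hE ht1 hφ1.continuous hφ.2.1).const_mul ((-1 : ℝ) ^ (∑ i, α i))
  simp_rw [← ibp α (hh _) hφ1 hφ.2.1] at a2
  exact tendsto_nhds_unique a1 a2

/-- The constant in the cutoff estimate. -/
def QC (d m : ℕ) (Cx : ℝ≥0∞) : ℝ≥0∞ :=
  ∑ k ∈ Finset.range (m + 1), ∑ i ∈ Finset.range (k + 1), (k.choose i : ℝ≥0∞) * Cx * (d ^ (k - i) : ℕ)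

theorem QC_ne_top (d m : ℕ) {Cx : ℝ≥0∞} (h : Cx ≠ ⊤) : QC d m Cx ≠ ⊤ := by
  unfold QC
  refine (ENNReal.sum_lt_top.2 fun k _ => ENNReal.sum_lt_top.2 fun i _ => ?_).ne
  exact ENNReal.mul_lt_top (ENNReal.mul_lt_top (ENNReal.natCast_ne_top _).lt_top h.lt_top) (ENNReal.natCast_ne_top _).lt_top

theorem hcs_of_sub {d : ℕ} {f : Ed d → ℝ} {z : Ed d} {R : ℝ} (h : tsupport f ⊆ closedBall z R) : HasCompactSupport f :=
  (isCompact_closedBall z R).of_isClosed_subset (isClosed_tsupport f) h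

theorem eLp_pderiv_le {d m : ℕ} {p : ℝ} (hp : 1 ≤ p) (r : ℝ) {f : Ed d → ℝ} (hf : ContDiff ℝ ∞ f) {α : Fin d → ℕ}
    (hα : α ∈ multiIdx d m) :
    ENNReal.ofReal r ^ (∑ i, α i) * eLpNorm (pderivA d α f) (ENNReal.ofReal p) volume ≤ NR p r m f := by
  refine le_trans ?_ (le_NR p r f (mem_multiIdx.1 hα))
  gcongr
  rw [eLpNorm_eq_l hp]
  exact LpE_mono hp fun x => abs_pderivA_le α hf x

theorem pderivA_sub {d : ℕ} (α : Fin d → ℕ) {f g : Ed d → ℝ} (hf : ContDiff ℝ ∞ f)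
    (hg : ContDiff ℝ ∞ g) : pderivA d α (fun x => f x - g x) = pderivA d α f - pderivA d α g := by
  rw [pderivA_eq, pderivA_eq, pderivA_eq]; exact pderivL_sub _ hf hg

theorem smooth_seq {d m : ℕ} {p : ℝ} (hp : 1 ≤ p) {C : ℝ≥0∞} (hCt : C ≠ ⊤) (hC : AlgC d m p C)
    {z : Ed d} {r : ℝ} (hr : 0 < r) {f : ℕ → Ed d → ℝ} (hf : ∀ k, ContDiff ℝ ∞ (f k)) (hs : ∀ k, tsupport (f k) ⊆ closedBall z (2 * r))
    {M : ℝ≥0∞} (hM : M ≠ ⊤) (hfM : ∀ k, NR p r m (f k) ≤ M)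
    (hfc : Tendsto (fun n : ℕ × ℕ => NR p r m (fun x => f n.1 x - f n.2 x)) atTop (𝓝 0)) (n : ℕ) {α : Fin d → ℕ} (hα : α ∈ multiIdx d m) :
    (∀ k, MemLp (pderivA d α (fun x => f k x ^ (n + 1))) (ENNReal.ofReal p) volume) ∧
    ∃ E : Ed d → ℝ, MemLp E (ENNReal.ofReal p) volume ∧
      Tendsto (fun k => eLpNorm (pderivA d α (fun x => f k x ^ (n + 1)) - E) (ENNReal.ofReal p) volume) atTop (𝓝 0) ∧
      ENNReal.ofReal r ^ (∑ i, α i) * eLpNorm E (ENNReal.ofReal p) volume ≤ (C * ENNReal.ofReal r ^ (-((d : ℝ) / p))) ^ n * M ^ (n + 1) := by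
  have hR0 : ENNReal.ofReal r ≠ 0 := by simpa using hr
  have hRt : ENNReal.ofReal r ≠ ⊤ := ENNReal.ofReal_ne_top
  set R := ENNReal.ofReal r
  set A := C * R ^ (-((d : ℝ) / p)) with hA
  have hAt : A ≠ ⊤ := ENNReal.mul_ne_top hCt (by rw [ne_eq, ENNReal.rpow_eq_top_iff]; simp [hR0, hRt])
  set s := ∑ i, α i with hsdef
  have hRs0 : R ^ s ≠ 0 := pow_ne_zero _ hR0
  have hRst : R ^ s ≠ ⊤ := ENNReal.pow_ne_top hRt
  have hfn : ∀ k, ContDiff ℝ ∞ (fun x => f k x ^ (n + 1)) := fun k => (hf k).pow _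
  have hmem : ∀ k, MemLp (pderivA d α (fun x => f k x ^ (n + 1))) (ENNReal.ofReal p) volume := by
    intro k
    refine (pderivA_contDiff α (hfn k)).continuous.memLp_of_hasCompactSupport ?_
    rw [pderivA_eq]
    exact pderivL_hcs _ (hcs_of_sub (tsupport_pow_sub (hs k) n))
  refine ⟨hmem, ?_⟩
  have hbd : ∀ k, R ^ s * eLpNorm (pderivA d α (fun x => f k x ^ (n + 1))) (ENNReal.ofReal p) volume ≤ A ^ n * M ^ (n + 1) := by
    intro k
    refine (eLp_pderiv_le hp r (hfn k) hα).trans ((NR_pow hC (hf k) hr (hs k) n).trans ?_)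
    gcongr
    exact hfM k
  have hcau : Tendsto (fun q : ℕ × ℕ => eLpNorm (pderivA d α (fun x => f q.1 x ^ (n + 1)) - pderivA d α (fun x => f q.2 x ^ (n + 1)))
      (ENNReal.ofReal p) volume) atTop (𝓝 0) := by
    have hle : ∀ q : ℕ × ℕ, eLpNorm (pderivA d α (fun x => f q.1 x ^ (n + 1)) - pderivA d α (fun x => f q.2 x ^ (n + 1)))
      (ENNReal.ofReal p) volume ≤ ((R ^ s)⁻¹ * ((n + 1 : ℕ) * (A * M) ^ n)) * NR p r m (fun x => f q.1 x - f q.2 x) := by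
      intro q
      rw [mul_assoc, mul_comm, ← div_eq_mul_inv, ENNReal.le_div_iff_mul_le (Or.inl hRs0) (Or.inl hRst), mul_comm, ← pderivA_sub α (hfn q.1) (hfn q.2)]
      refine (eLp_pderiv_le hp r ((hfn q.1).sub (hfn q.2)) hα).trans ?_
      exact NR_pow_sub hp hC (hf _) (hf _) hr (hs _) (hs _) (hfM _) (hfM _) n
    refine tendsto_of_tendsto_of_tendsto_of_le_of_le tendsto_const_nhds ?_ (fun _ => zero_le) hle
    have := ENNReal.Tendsto.const_mul hfc (a := (R ^ s)⁻¹ * ((n + 1 : ℕ) * (A * M) ^ n)) (Or.inr ?_)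
    · simpa using this
    · exact ENNReal.mul_ne_top (ENNReal.inv_ne_top.2 hRs0) (ENNReal.mul_ne_top (ENNReal.natCast_ne_top _) (ENNReal.pow_ne_top (ENNReal.mul_ne_top hAt hM)))
  obtain ⟨E, hE, hEt⟩ := Lp_lim hp hmem hcau
  refine ⟨E, hE, hEt, ?_⟩
  have hlim : Tendsto (fun k => A ^ n * M ^ (n + 1) + R ^ s * eLpNorm (pderivA d α (fun x => f k x ^ (n + 1)) - E) (ENNReal.ofReal p) volume) atTop
      (𝓝 (A ^ n * M ^ (n + 1) + R ^ s * 0)) := tendsto_const_nhds.add (ENNReal.Tendsto.const_mul hEt (Or.inr hRst))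
  rw [mul_zero, add_zero] at hlim
  refine ge_of_tendsto' hlim fun k => ?_
  have h3 : eLpNorm E (ENNReal.ofReal p) volume ≤ eLpNorm (pderivA d α (fun x => f k x ^ (n + 1))) (ENNReal.ofReal p) volume +
      eLpNorm (pderivA d α (fun x => f k x ^ (n + 1)) - E) (ENNReal.ofReal p) volume := by
    have e : E = pderivA d α (fun x => f k x ^ (n + 1)) - (pderivA d α (fun x => f k x ^ (n + 1)) - E) := by abel
    conv_lhs => rw [e]
    exact eLpNorm_sub_le (hmem k).1 ((hmem k).sub hE).1 (one_le_ofReal hp)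
  calc _ ≤ R ^ s * (eLpNorm (pderivA d α (fun x => f k x ^ (n + 1))) (ENNReal.ofReal p) volume +
      eLpNorm (pderivA d α (fun x => f k x ^ (n + 1)) - E) (ENNReal.ofReal p) volume) := by gcongr
    _ ≤ _ := by rw [mul_add]; exact add_le_add_left (hbd k) _

theorem pderivA_zero' {d : ℕ} (φ : Ed d → ℝ) : pderivA d 0 φ = φ := by
  rw [pderivA_eq]
  have h : (idxList d 0).length = 0 := by rw [idxList_length]; simp
  rw [List.length_eq_zero_iff.1 h]; rfl

theorem zero_mem_multiIdx (d m : ℕ) : (0 : Fin d → ℕ) ∈ multiIdx d m := by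
  rw [mem_multiIdx]; simp

theorem indic_loc {d : ℕ} {Ω : Set (Ed d)} {u : Ed d → ℝ} (hu : LocallyIntegrableOn u Ω volume) {z : Ed d} {R : ℝ}
    (h : closedBall z R ⊆ Ω) : LocallyIntegrable ((closedBall z R).indicator u) volume := by
  apply Integrable.locallyIntegrable
  rw [integrable_indicator_iff measurableSet_closedBall]
  exact hu.integrableOn_compact_subset h (isCompact_closedBall z R)

theorem moll_seq {d m : ℕ} {p : ℝ} (hp : 1 ≤ p) {Cx : ℝ≥0∞} (hCx : Cx ≠ ⊤) {z : Ed d} {r : ℝ} (hr : 0 < r) {χ : Ed d → ℝ}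
    (hχ : IsCut d m Cx z r χ) {Ω : Set (Ed d)} (hΩ : IsOpen Ω) {u : Ed d → ℝ} {D : (Fin d → ℕ) → Ed d → ℝ}
    (hu : LocallyIntegrableOn u Ω volume)
    (hD : IsWeakDerivFamily d Ω m u D) (hK : closedBall z (4 * r) ⊆ Ω)
    (hDp : ∀ β, MemLp ((closedBall z (4 * r)).indicator (D β)) (ENNReal.ofReal p) volume) :
    ∃ U : ℕ → Ed d → ℝ, (∀ k, ContDiff ℝ ∞ (U k)) ∧
      (∀ k, NR p r m (fun x => χ x * U k x) ≤ QC d m Cx * ∑ β ∈ multiIdx d m, ENNReal.ofReal r ^ (∑ i, β i) *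
        eLpNorm ((closedBall z (4 * r)).indicator (D β)) (ENNReal.ofReal p) volume) ∧
      Tendsto (fun n : ℕ × ℕ => NR p r m (fun x => χ x * U n.1 x - χ x * U n.2 x)) atTop (𝓝 0) ∧
      Tendsto (fun k => eLpNorm (U k - (closedBall z (4 * r)).indicator u) (ENNReal.ofReal p) volume) atTop (𝓝 0) ∧
      MemLp ((closedBall z (4 * r)).indicator u) (ENNReal.ofReal p) volume := by
  have h1p := one_le_ofReal hp
  set K := closedBall z (4 * r) with hKdef
  have huK : LocallyIntegrable (K.indicator u) volume := indic_loc hu hK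
  have hDK : ∀ β, LocallyIntegrable (K.indicator (D β)) volume := fun β => (hDp β).locallyIntegrable h1p
  obtain ⟨k0, hk0⟩ := exists_nat_one_div_lt (show (0 : ℝ) < 2 * r by positivity)
  set U : ℕ → Ed d → ℝ := fun k => moll d (mker d (k0 + k)) (K.indicator u) with hU
  set V : ℕ → (Fin d → ℕ) → Ed d → ℝ := fun k β => moll d (mker d (k0 + k)) (K.indicator (D β)) with hV
  have hUs : ∀ k, ContDiff ℝ ∞ (U k) := fun k => moll_contDiff huK (mker_contDiff _ _) (mker_hcs _ _)
  have hVs : ∀ k β, ContDiff ℝ ∞ (V k β) := fun k β => moll_contDiff (hDK β) (mker_contDiff _ _) (mker_hcs _ _)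
  have hVm : ∀ k β, Measurable (V k β) := fun k β => (hVs k β).continuous.measurable
  have hUV : ∀ k, ∀ β ∈ multiIdx d m, ∀ x ∈ closedBall z (2 * r), pderivA d β (U k) x = V k β x := by
    intro k β hβ x hx
    refine pderivA_moll_weak hΩ.measurableSet measurableSet_closedBall hK (hD β hβ) huK (mker_contDiff _ _) (mker_hcs _ _) x ?_
    intro y hy
    rw [mker_tsupport, mem_closedBall_zero_iff] at hy
    rw [mem_closedBall] at hx ⊢
    have h2 : (1 : ℝ) / (((k0 + k : ℕ) : ℝ) + 1) ≤ 1 / ((k0 : ℝ) + 1) := by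
      apply one_div_le_one_div_of_le (by positivity)
      push_cast
      have := Nat.cast_nonneg (α := ℝ) k
      linarith
    have h3 : dist y x ≤ 2 * r := by
      rw [dist_comm, dist_eq_norm]; linarith
    calc dist y z ≤ dist y x + dist x z := dist_triangle _ _ _
      _ ≤ 4 * r := by linarith
  have hu0 : u =ᵐ[volume.restrict Ω] D 0 := weak_unique hΩ (weak_zero hu) (hD 0 (zero_mem_multiIdx d m))
  have hu1 : K.indicator (D 0) =ᵐ[volume] K.indicator u := by
    have h := ae_restrict_of_ae_restrict_of_subset hK hu0
    rw [ae_restrict_iff' measurableSet_closedBall] at h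
    filter_upwards [h] with x hx
    by_cases hxK : x ∈ K
    · simp [hxK, hx hxK]
    · simp [hxK]
  have huM : MemLp (K.indicator u) (ENNReal.ofReal p) volume := (memLp_congr_ae hu1).1 (hDp 0)
  have hsh : Tendsto (fun k => k0 + k) atTop atTop := tendsto_atTop_mono (fun k => Nat.le_add_left k k0) tendsto_id
  refine ⟨U, hUs, ?_, ?_, ?_, huM⟩
  · intro k
    refine (NR_cut hp hχ (hUs k) (hVm k) (hUV k)).trans ?_
    unfold QC
    gcongr with β hβ
    have := moll_bound hp (hDp β).1 (k0 + k)
    rw [eLpNorm_eq_l hp] at this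
    exact this
  · have hle : ∀ q : ℕ × ℕ, NR p r m (fun x => χ x * U q.1 x - χ x * U q.2 x) ≤
        QC d m Cx * ∑ β ∈ multiIdx d m, ENNReal.ofReal r ^ (∑ i, β i) *
          (eLpNorm (V q.1 β - K.indicator (D β)) (ENNReal.ofReal p) volume + eLpNorm (V q.2 β - K.indicator (D β)) (ENNReal.ofReal p) volume) := by
      intro q
      have e : (fun x => χ x * U q.1 x - χ x * U q.2 x) = fun x => χ x * (U q.1 x - U q.2 x) := by funext x; ring
      rw [e]
      refine (NR_cut hp hχ (U := fun x => U q.1 x - U q.2 x) ((hUs q.1).sub (hUs q.2)) (V := fun β => V q.1 β - V q.2 β) (fun β => (hVm q.1 β).sub (hVm q.2 β)) ?_).trans ?_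
      · intro β hβ x hx
        rw [pderivA_sub β (hUs q.1) (hUs q.2), Pi.sub_apply, Pi.sub_apply, hUV _ β hβ x hx, hUV _ β hβ x hx]
      · unfold QC
        gcongr with β hβ
        have e2 : V q.1 β - V q.2 β = (V q.1 β - K.indicator (D β)) - (V q.2 β - K.indicator (D β)) := by abel
        have e3 : LpE p (fun x => ‖(V q.1 β - V q.2 β) x‖ₑ) = eLpNorm (V q.1 β - V q.2 β) (ENNReal.ofReal p) volume := (eLpNorm_eq_l hp _).symm
        rw [e3, e2]
        exact eLpNorm_sub_le ((hVm _ β).aestronglyMeasurable.sub (hDp β).1) ((hVm _ β).aestronglyMeasurable.sub (hDp β).1) h1p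
    refine tendsto_of_tendsto_of_tendsto_of_le_of_le tendsto_const_nhds ?_ (fun _ => zero_le) hle
    have hVt : ∀ β, Tendsto (fun k => eLpNorm (V k β - K.indicator (D β)) (ENNReal.ofReal p) volume) atTop (𝓝 0) := fun β =>
      (moll_tendsto hp (hDp β)).comp hsh
    have h1 : Tendsto (fun q : ℕ × ℕ => ∑ β ∈ multiIdx d m, ENNReal.ofReal r ^ (∑ i, β i) *
          (eLpNorm (V q.1 β - K.indicator (D β)) (ENNReal.ofReal p) volume + eLpNorm (V q.2 β - K.indicator (D β)) (ENNReal.ofReal p) volume)) atTop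
          (𝓝 (∑ β ∈ multiIdx d m, ENNReal.ofReal r ^ (∑ i, β i) * ((0 : ℝ≥0∞) + 0))) := by
      refine tendsto_finsetSum _ fun β _ => ?_
      refine ENNReal.Tendsto.const_mul ?_ (Or.inr (ENNReal.pow_ne_top ENNReal.ofReal_ne_top))
      rw [← prod_atTop_atTop_eq]
      exact ((hVt β).comp tendsto_fst).add ((hVt β).comp tendsto_snd)
    have := ENNReal.Tendsto.const_mul h1 (a := QC d m Cx) (Or.inr (QC_ne_top d m hCx))
    simpa using this
  · exact (moll_tendsto hp huM).comp hsh

theorem local_pow {d m : ℕ} {p : ℝ} (hp : 1 ≤ p) {C Cx : ℝ≥0∞} (hCt : C ≠ ⊤) (hC : AlgC d m p C) (hCx : Cx ≠ ⊤) {z : Ed d} {r : ℝ} (hr : 0 < r) {χ : Ed d → ℝ}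
    (hχ : IsCut d m Cx z r χ) {Ω : Set (Ed d)} (hΩ : IsOpen Ω) {u : Ed d → ℝ} {D : (Fin d → ℕ) → Ed d → ℝ}
    (hu : LocallyIntegrableOn u Ω volume)
    (hD : IsWeakDerivFamily d Ω m u D) (hK : closedBall z (4 * r) ⊆ Ω)
    (hDp : ∀ β, MemLp ((closedBall z (4 * r)).indicator (D β)) (ENNReal.ofReal p) volume) (n : ℕ) :
    ∃ E : (Fin d → ℕ) → Ed d → ℝ, ∀ α ∈ multiIdx d m, HasWeakDerivOn d (ball z r) α (fun x => u x ^ (n + 1)) (E α) ∧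
      MemLp (E α) (ENNReal.ofReal p) volume ∧
      ENNReal.ofReal r ^ (∑ i, α i) * eLpNorm (E α) (ENNReal.ofReal p) volume ≤ (C * ENNReal.ofReal r ^ (-((d : ℝ) / p))) ^ n *
        (QC d m Cx * ∑ β ∈ multiIdx d m, ENNReal.ofReal r ^ (∑ i, β i) *
        eLpNorm ((closedBall z (4 * r)).indicator (D β)) (ENNReal.ofReal p) volume) ^ (n + 1) := by
  obtain ⟨U, hUs, hUM, hUc, hUt, huM⟩ := moll_seq hp hCx hr hχ hΩ hu hD hK hDp
  set M := QC d m Cx * ∑ β ∈ multiIdx d m, ENNReal.ofReal r ^ (∑ i, β i) *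
        eLpNorm ((closedBall z (4 * r)).indicator (D β)) (ENNReal.ofReal p) volume with hMdef
  have hMt : M ≠ ⊤ := by
    refine ENNReal.mul_ne_top (QC_ne_top d m hCx) (ENNReal.sum_lt_top.2 fun β _ => ?_).ne
    exact ENNReal.mul_lt_top (ENNReal.pow_ne_top ENNReal.ofReal_ne_top).lt_top (hDp β).2
  have hfs : ∀ k, ContDiff ℝ ∞ (fun x => χ x * U k x) := fun k => hχ.1.mul (hUs k)
  have hft : ∀ k, tsupport (fun x => χ x * U k x) ⊆ closedBall z (2 * r) := fun k =>
    (closure_mono (Function.support_mul_subset_left χ (U k))).trans hχ.2.1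
  have H := fun (α : Fin d → ℕ) (hα : α ∈ multiIdx d m) => smooth_seq hp hCt hC hr (f := fun k x => χ x * U k x) hfs hft hMt hUM hUc n hα
  choose! hmem E hE hEt hEb using H
  have h0 := zero_mem_multiIdx d m
  have hm0 := hmem 0 h0
  have ht0 := hEt 0 h0
  simp only [pderivA_zero'] at hm0 ht0
  have hn0 : ENNReal.ofReal p ≠ 0 := (lt_of_lt_of_le zero_lt_one (one_le_ofReal hp)).ne'
  -- identify the limit
  have hid : E 0 =ᵐ[volume.restrict (ball z r)] fun x => u x ^ (n + 1) := by
    obtain ⟨ns, hns, h1⟩ := (tendstoInMeasure_of_tendsto_eLpNorm hn0 (fun k => (hUs k).continuous.aestronglyMeasurable) huM.1 hUt).exists_seq_tendsto_ae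
    have h2 := (tendstoInMeasure_of_tendsto_eLpNorm hn0 (fun k => (hm0 (ns k)).1) (hE 0 h0).1 (ht0.comp hns.tendsto_atTop))
    obtain ⟨ns2, hns2, h3⟩ := h2.exists_seq_tendsto_ae
    rw [EventuallyEq, ae_restrict_iff' measurableSet_ball]
    filter_upwards [h1, h3] with x hx1 hx3 hxb
    have hx4 := (hx1.comp hns2.tendsto_atTop).pow (n + 1)
    have hxK : x ∈ closedBall z (4 * r) := by
      rw [mem_closedBall]; rw [mem_ball] at hxb; linarith
    rw [indicator_of_mem hxK] at hx4
    refine tendsto_nhds_unique hx3 (hx4.congr fun k => ?_)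
    simp [hχ.2.2.1 x (ball_subset_closedBall hxb)]
  refine ⟨E, fun α hα => ⟨?_, hE α hα, hEb α hα⟩⟩
  refine weak_congr measurableSet_ball hid (ae_eq_refl _) (weak_restrict (subset_univ _) ?_)
  exact weak_lim hp (fun k => (hfs k).pow (n + 1)) hm0 (hmem α hα) (hE 0 h0) (hE α hα) ht0 (hEt α hα)

theorem pou {d : ℕ} {ι : Type*} {B : ι → Set (Ed d)} (hB : ∀ i, IsOpen (B i)) {K : Set (Ed d)} (hK : IsCompact K)
    (hKB : K ⊆ ⋃ i, B i) : ∃ (s : Finset ι) (ψ : s → Ed d → ℝ), (∀ i, ContDiff ℝ ∞ (ψ i)) ∧ (∀ i, tsupport (ψ i) ⊆ B i) ∧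
      ∀ x ∈ K, ∑ i, ψ i x = 1 := by
  obtain ⟨t, ht⟩ := hK.elim_finite_subcover B hB hKB
  have ht' : K ⊆ ⋃ i : t, B i := by
    intro x hx
    obtain ⟨i, hi, hxi⟩ := mem_iUnion₂.1 (ht hx)
    exact mem_iUnion.2 ⟨⟨i, hi⟩, hxi⟩
  obtain ⟨f, hf⟩ := SmoothPartitionOfUnity.exists_isSubordinate (modelWithCornersSelf ℝ (Ed d)) hK.isClosed (fun i : t => B i) (fun i => hB i) ht'
  refine ⟨t, fun i => f i, fun i => ?_, hf, fun x hx => ?_⟩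
  · exact (f i).contMDiff.contDiff
  · rw [← finsum_eq_sum_of_fintype]
    exact f.sum_eq_one hx

theorem weak_glue {d : ℕ} {ι : Type*} {B : ι → Set (Ed d)} (hB : ∀ i, IsOpen (B i)) {α : Fin d → ℕ} {v E : Ed d → ℝ}
    (h : ∀ i, HasWeakDerivOn d (B i) α v E) : HasWeakDerivOn d (⋃ i, B i) α v E := by
  have hloc : ∀ {w : Ed d → ℝ}, (∀ i, LocallyIntegrableOn w (B i) volume) → LocallyIntegrableOn w (⋃ i, B i) volume := by
    intro w hw x hx
    obtain ⟨i, hi⟩ := mem_iUnion.1 hx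
    have := hw i x hi
    rw [(hB i).nhdsWithin_eq hi] at this
    exact this.filter_mono nhdsWithin_le_nhds
  refine ⟨hloc fun i => (h i).1, hloc fun i => (h i).2.1, ?_⟩
  rintro φ ⟨hφ, hc, hs⟩
  have hφ : ContDiff ℝ ∞ φ := hφ
  obtain ⟨s, ψ, hψ, hψB, hψ1⟩ := pou hB hc hs
  rw [setInt_full_d hs, setInt_full hs]
  have hps : ∀ i, ContDiff ℝ ∞ (fun x => ψ i x * φ x) := fun i => (hψ i).mul hφ
  have hsum : φ = fun x => ∑ i, ψ i x * φ x := by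
    funext x
    by_cases hx : x ∈ tsupport φ
    · rw [← Finset.sum_mul, hψ1 x hx, one_mul]
    · simp [image_eq_zero_of_notMem_tsupport hx]
  have hts : ∀ i, tsupport (fun x => ψ i x * φ x) ⊆ B i := fun i =>
    (closure_mono (Function.support_mul_subset_left (ψ i) φ)).trans (hψB i)
  have hcs : ∀ i, HasCompactSupport (fun x => ψ i x * φ x) := fun i => hc.mul_left
  have hD : pderivA d α φ = fun x => ∑ i, pderivA d α (fun x => ψ i x * φ x) x := by
    conv_lhs => rw [hsum]
    simp only [pderivA_eq]
    exact pderivL_sum _ _ fun i _ => hps i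
  have h1 : ∀ i : s, ∫ x, v x * pderivA d α (fun x => ψ i x * φ x) x = (-1 : ℝ) ^ (∑ i, α i) * ∫ x, E x * (ψ i x * φ x) := by
    intro i
    have := (h i).2.2 _ ⟨hps i, hcs i, hts i⟩
    rwa [setInt_full_d (hts i), setInt_full (hts i)] at this
  have e1 : ∫ x, v x * pderivA d α φ x = ∑ i, ∫ x, v x * pderivA d α (fun x => ψ i x * φ x) x := by
    rw [← integral_finsetSum]
    · congr 1; funext x; rw [hD]; simp only [Finset.mul_sum]
    · intro i _
      refine loc_int_mul (h i).1 (pderivA_contDiff α (hps i)).continuous ?_ ?_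
      · rw [pderivA_eq]; exact pderivL_hcs _ (hcs i)
      · rw [pderivA_eq]; exact (pderivL_tsupport _ _).trans (hts i)
  have e2 : ∫ x, E x * φ x = ∑ i, ∫ x, E x * (ψ i x * φ x) := by
    rw [← integral_finsetSum]
    · congr 1; funext x; conv_lhs => rw [hsum]
      simp only [Finset.mul_sum]
    · intro i _
      exact loc_int_mul (h i).2.1 (hps i).continuous (hcs i) (hts i)
  rw [e1, e2, Finset.mul_sum]
  exact Finset.sum_congr rfl fun i _ => h1 i

theorem weak_glue_exists {d : ℕ} {Ω : Set (Ed d)} {α : Fin d → ℕ} {v : Ed d → ℝ}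
    (h : ∀ z ∈ Ω, ∃ r : ℝ, 0 < r ∧ ball z r ⊆ Ω ∧ ∃ E, HasWeakDerivOn d (ball z r) α v E) :
    ∃ E, HasWeakDerivOn d Ω α v E := by
  classical
  choose! r hr hrΩ E hE using h
  obtain ⟨T, hTΩ, hTc, hT⟩ := TopologicalSpace.isOpen_biUnion_countable Ω (fun z => ball z (r z)) (fun _ _ => isOpen_ball)
  have hcov : ⋃ t : T, ball (t : Ed d) (r t) = Ω := by
    rw [show ⋃ t : T, ball (t : Ed d) (r t) = ⋃ i ∈ T, ball i (r i) from (biUnion_eq_iUnion T (fun z _ => ball z (r z))).symm, hT]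
    apply subset_antisymm
    · exact iUnion₂_subset hrΩ
    · intro x hx; exact mem_iUnion₂.2 ⟨x, hx, mem_ball_self (hr x hx)⟩
  have : Countable T := hTc.to_subtype
  have hag : ∀ᵐ x : Ed d, ∀ i j : T, x ∈ ball (i : Ed d) (r i) ∩ ball (j : Ed d) (r j) → E i x = E j x := by
    rw [ae_all_iff]; intro i
    rw [ae_all_iff]; intro j
    have := weak_unique (isOpen_ball.inter isOpen_ball) (weak_restrict inter_subset_left (hE i (hTΩ i.2)))
      (weak_restrict (inter_subset_right (s := ball (i : Ed d) (r i))) (hE j (hTΩ j.2)))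
    rwa [EventuallyEq, ae_restrict_iff' (measurableSet_ball.inter measurableSet_ball)] at this
  let F : Ed d → ℝ := fun x => if hx : ∃ i : T, x ∈ ball (i : Ed d) (r i) then E hx.choose x else 0
  refine ⟨F, ?_⟩
  rw [← hcov]
  refine weak_glue (fun _ => isOpen_ball) fun i => ?_
  refine weak_congr measurableSet_ball (ae_eq_refl _) ?_ (hE i (hTΩ i.2))
  rw [EventuallyEq, ae_restrict_iff' measurableSet_ball]
  filter_upwards [hag] with x hx hxi
  have hex : ∃ i : T, x ∈ ball (i : Ed d) (r i) := ⟨i, hxi⟩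
  simp only [F, dif_pos hex]
  exact hx _ _ ⟨hxi, hex.choose_spec⟩

theorem swap_set {X : Type*} [MeasurableSpace X] {μ ν : Measure X} [SFinite μ] [SFinite ν] {S : Set (X × X)} (hS : MeasurableSet S)
    {w g : X → ℝ≥0∞} (hw : Measurable w) (hg : Measurable g) :
    ∫⁻ z, w z * (∫⁻ x in {x | (z, x) ∈ S}, g x ∂ν) ∂μ = ∫⁻ x, g x * (∫⁻ z in {z | (z, x) ∈ S}, w z ∂μ) ∂ν := by
  have hF : Measurable (S.indicator (fun q : X × X => w q.1 * g q.2)) :=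
    ((hw.comp measurable_fst).mul (hg.comp measurable_snd)).indicator hS
  have h := lintegral_lintegral_swap (μ := μ) (ν := ν) (f := fun z x => S.indicator (fun q : X × X => w q.1 * g q.2) (z, x)) hF.aemeasurable
  calc _ = ∫⁻ z, ∫⁻ x, S.indicator (fun q : X × X => w q.1 * g q.2) (z, x) ∂ν ∂μ := by
        congr 1; funext z
        have hm : MeasurableSet {x | (z, x) ∈ S} := measurable_prodMk_left hS
        rw [← lintegral_indicator hm, ← lintegral_const_mul _ (hg.indicator hm)]
        congr 1; funext x
        by_cases hx : (z, x) ∈ S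
        · rw [indicator_of_mem hx, indicator_of_mem (by exact hx)]
        · rw [indicator_of_notMem hx, indicator_of_notMem (by exact hx), mul_zero]
    _ = _ := h
    _ = _ := by
        congr 1; funext x
        have hm : MeasurableSet {z | (z, x) ∈ S} := measurable_prodMk_right hS
        rw [← lintegral_indicator hm, ← lintegral_const_mul _ (hw.indicator hm)]
        congr 1; funext z
        by_cases hx : (z, x) ∈ S
        · rw [indicator_of_mem hx, indicator_of_mem (by exact hx), mul_comm]
        · rw [indicator_of_notMem hx, indicator_of_notMem (by exact hx), mul_zero]

/-- The weight hypotheses. -/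
def IsWt (d : ℕ) (ρ : Ed d → ℝ) : Prop := Continuous ρ ∧ ∀ x y, ρ x ≤ ρ y + dist x y

theorem avg_lower {d : ℕ} {ρ : Ed d → ℝ} (hρ : IsWt d ρ) :
    ∃ C : ℝ≥0∞, C ≠ ⊤ ∧ ∀ g : Ed d → ℝ≥0∞, Measurable g → ∫⁻ x in {x | 0 < ρ x}, g x ≤
      C * ∫⁻ z in {x | 0 < ρ x}, ENNReal.ofReal (ρ z) ^ (-(d : ℝ)) * ∫⁻ x in ball z (ρ z / 16), g x := by
  set V := volume (ball (0 : Ed d) 1) with hV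
  have hV0 : V ≠ 0 := (measure_ball_pos _ _ one_pos).ne'
  have hVt : V ≠ ⊤ := measure_ball_lt_top.ne
  set c0 : ℝ≥0∞ := ENNReal.ofReal ((1 / 64) ^ d) * V with hc0
  have hc00 : c0 ≠ 0 := mul_ne_zero (by simp) hV0
  have hc0t : c0 ≠ ⊤ := ENNReal.mul_ne_top ENNReal.ofReal_ne_top hVt
  have hm1 : MeasurableSet {x | 0 < ρ x} := (isOpen_lt continuous_const hρ.1).measurableSet
  refine ⟨c0⁻¹, ENNReal.inv_ne_top.2 hc00, fun g hg => ?_⟩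
  have hS : MeasurableSet {q : Ed d × Ed d | q.2 ∈ ball q.1 (ρ q.1 / 16)} := by
    have : IsOpen {q : Ed d × Ed d | dist q.2 q.1 < ρ q.1 / 16} :=
      isOpen_lt (by fun_prop) ((hρ.1.comp continuous_fst).div_const _)
    exact this.measurableSet
  have hw : Measurable (fun z => ENNReal.ofReal (ρ z) ^ (-(d : ℝ))) := (hρ.1.measurable.ennreal_ofReal).pow_const _
  have e := swap_set (μ := volume.restrict {x | 0 < ρ x}) (ν := volume) hS hw hg
  have e2 : ∫⁻ z in {x | 0 < ρ x}, ENNReal.ofReal (ρ z) ^ (-(d : ℝ)) * ∫⁻ x in ball z (ρ z / 16), g x =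
    ∫⁻ x, g x * (∫⁻ z in {z | x ∈ ball z (ρ z / 16)}, ENNReal.ofReal (ρ z) ^ (-(d : ℝ)) ∂(volume.restrict {x | 0 < ρ x})) := e
  rw [e2, mul_comm, ← div_eq_mul_inv, ENNReal.le_div_iff_mul_le (Or.inl hc00) (Or.inl hc0t), mul_comm,
    ← lintegral_const_mul _ hg]
  refine le_trans ?_ (setLIntegral_le_lintegral {x | 0 < ρ x} _)
  refine setLIntegral_mono' hm1 fun x hx => ?_
  rw [mul_comm]
  gcongr
  have hx : 0 < ρ x := hx
  have hsub : ball x (ρ x / 32) ⊆ {z | x ∈ ball z (ρ z / 16)} ∩ {x | 0 < ρ x} := by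
    intro z hz
    rw [mem_ball] at hz
    have h1 := hρ.2 x z
    rw [dist_comm] at h1
    refine ⟨?_, ?_⟩
    · change dist x z < ρ z / 16
      rw [dist_comm]; linarith
    · change 0 < ρ z
      linarith
  have hS' : MeasurableSet {z | x ∈ ball z (ρ z / 16)} := measurable_prodMk_right hS
  rw [Measure.restrict_restrict hS']
  refine le_trans ?_ (lintegral_mono_set hsub)
  calc c0 = ∫⁻ z in ball x (ρ x / 32), (ENNReal.ofReal ((2 * ρ x) ^ d))⁻¹ := by
        rw [setLIntegral_const, Measure.addHaar_ball_of_pos _ _ (by positivity), finrank_euclideanSpace, Fintype.card_fin, hc0,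
          ← mul_assoc, ← ENNReal.ofReal_inv_of_pos (by positivity), ← ENNReal.ofReal_mul (by positivity)]
        congr 2
        rw [← inv_pow, ← mul_pow]
        congr 1
        field_simp
        norm_num
    _ ≤ _ := by
        refine setLIntegral_mono' measurableSet_ball fun z hz => ?_
        rw [mem_ball] at hz
        have h1 := hρ.2 z x
        rw [ENNReal.rpow_neg, ENNReal.rpow_natCast, ENNReal.ofReal_pow (by positivity)]
        gcongr
        linarith

theorem avg_upper {d : ℕ} {ρ : Ed d → ℝ} (hρ : IsWt d ρ) :
    ∃ C : ℝ≥0∞, C ≠ ⊤ ∧ ∀ g : Ed d → ℝ≥0∞, Measurable g →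
      ∫⁻ z in {x | 0 < ρ x}, ENNReal.ofReal (ρ z) ^ (-(d : ℝ)) * ∫⁻ x in closedBall z (ρ z / 4), g x ≤
      C * ∫⁻ x in {x | 0 < ρ x}, g x := by
  set V := volume (ball (0 : Ed d) 1) with hV
  have hVt : V ≠ ⊤ := measure_ball_lt_top.ne
  have hm1 : MeasurableSet {x | 0 < ρ x} := (isOpen_lt continuous_const hρ.1).measurableSet
  refine ⟨V, hVt, fun g hg => ?_⟩
  have hS : MeasurableSet {q : Ed d × Ed d | q.2 ∈ closedBall q.1 (ρ q.1 / 4)} := by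
    have : IsClosed {q : Ed d × Ed d | dist q.2 q.1 ≤ ρ q.1 / 4} :=
      isClosed_le (by fun_prop) ((hρ.1.comp continuous_fst).div_const _)
    exact this.measurableSet
  have hw : Measurable (fun z => ENNReal.ofReal (ρ z) ^ (-(d : ℝ))) := (hρ.1.measurable.ennreal_ofReal).pow_const _
  have e := swap_set (μ := volume.restrict {x | 0 < ρ x}) (ν := volume) hS hw hg
  have e2 : ∫⁻ z in {x | 0 < ρ x}, ENNReal.ofReal (ρ z) ^ (-(d : ℝ)) * ∫⁻ x in closedBall z (ρ z / 4), g x =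
    ∫⁻ x, g x * (∫⁻ z in {z | x ∈ closedBall z (ρ z / 4)}, ENNReal.ofReal (ρ z) ^ (-(d : ℝ)) ∂(volume.restrict {x | 0 < ρ x})) := e
  rw [e2, ← lintegral_const_mul _ hg, ← lintegral_indicator hm1]
  refine lintegral_mono fun x => ?_
  have hS' : MeasurableSet {z | x ∈ closedBall z (ρ z / 4)} := measurable_prodMk_right hS
  rw [Measure.restrict_restrict hS']
  by_cases hx : 0 < ρ x
  · rw [indicator_of_mem (by exact hx), mul_comm]
    gcongr
    have hsub : {z | x ∈ closedBall z (ρ z / 4)} ∩ {x | 0 < ρ x} ⊆ closedBall x (ρ x / 2) := by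
      rintro z ⟨hz, hz0⟩
      have hz : dist x z ≤ ρ z / 4 := hz
      have h1 := hρ.2 z x
      rw [dist_comm] at h1
      rw [mem_closedBall, dist_comm]; linarith
    refine (lintegral_mono_set hsub).trans ?_
    calc _ ≤ ∫⁻ z in closedBall x (ρ x / 2), (ENNReal.ofReal ((ρ x / 2) ^ d))⁻¹ := by
          refine setLIntegral_mono' measurableSet_closedBall fun z hz => ?_
          rw [mem_closedBall] at hz
          have h1 := hρ.2 x z
          rw [dist_comm] at h1
          rw [ENNReal.rpow_neg, ENNReal.rpow_natCast, ENNReal.ofReal_pow (by positivity)]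
          gcongr
          linarith
      _ = V := by
          rw [setLIntegral_const, Measure.addHaar_closedBall _ _ (by positivity), finrank_euclideanSpace, Fintype.card_fin,
            ← mul_assoc, ENNReal.inv_mul_cancel (by simp; positivity) ENNReal.ofReal_ne_top, one_mul]
  · rw [indicator_of_notMem (by exact hx)]
    have hemp : {z | x ∈ closedBall z (ρ z / 4)} ∩ {x | 0 < ρ x} = ∅ := by
      rw [eq_empty_iff_forall_notMem]
      rintro z ⟨hz, hz0⟩
      have hz : dist x z ≤ ρ z / 4 := hz
      have hz0 : 0 < ρ z := hz0
      have h1 := hρ.2 z x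
      rw [dist_comm] at h1
      apply hx; linarith
    rw [hemp]; simp

/-- Weighted integrand in `ℝ≥0∞`. -/
def GW (d : ℕ) (ρ : Ed d → ℝ) (s p : ℝ) (g : Ed d → ℝ) (x : Ed d) : ℝ≥0∞ := (ENNReal.ofReal (ρ x) ^ s * ‖g x‖ₑ) ^ p

theorem GW_meas {d : ℕ} {ρ : Ed d → ℝ} (hρ : Continuous ρ) (s p : ℝ) {g : Ed d → ℝ} (hg : Measurable g) : Measurable (GW d ρ s p g) :=
  (((hρ.measurable.ennreal_ofReal).pow_const s).mul hg.enorm).pow_const p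

theorem rpow_comp {A B : ℝ} (hA : 0 < A) (hB : 0 < B) (h1 : A ≤ 2 * B) (h2 : B ≤ 2 * A) (s : ℝ) :
    ENNReal.ofReal A ^ s ≤ 2 ^ |s| * ENNReal.ofReal B ^ s := by
  have e2 : (2 : ℝ≥0∞) = ENNReal.ofReal 2 := by simp
  rw [e2, ENNReal.ofReal_rpow_of_pos hA, ENNReal.ofReal_rpow_of_pos hB, ENNReal.ofReal_rpow_of_pos (by norm_num),
    ← ENNReal.ofReal_mul (by positivity)]
  apply ENNReal.ofReal_le_ofReal
  rcases le_or_gt 0 s with hs | hs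
  · rw [abs_of_nonneg hs, ← Real.mul_rpow (by norm_num) hB.le]
    exact Real.rpow_le_rpow hA.le h1 hs
  · rw [abs_of_neg hs]
    have : B / 2 ≤ A := by linarith
    refine (Real.rpow_le_rpow_of_nonpos (by positivity) this hs.le).trans (le_of_eq ?_)
    rw [Real.div_rpow hB.le (by norm_num), Real.rpow_neg (by norm_num)]
    field_simp

theorem wt_int {d : ℕ} {ρ : Ed d → ℝ} {p : ℝ} (hp : 1 ≤ p) (s : ℝ) {z : Ed d} (hz : 0 < ρ z) {S : Set (Ed d)} (hS : MeasurableSet S)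
    (h : ∀ x ∈ S, ρ x ≤ 2 * ρ z ∧ ρ z ≤ 2 * ρ x) (g : Ed d → ℝ) :
    (ENNReal.ofReal (ρ z) ^ s) ^ p * ∫⁻ x in S, ‖g x‖ₑ ^ p ≤ (2 ^ |s|) ^ p * ∫⁻ x in S, GW d ρ s p g x ∧
    ∫⁻ x in S, GW d ρ s p g x ≤ (2 ^ |s|) ^ p * ((ENNReal.ofReal (ρ z) ^ s) ^ p * ∫⁻ x in S, ‖g x‖ₑ ^ p) := by
  have hp0 : 0 ≤ p := by linarith
  have hP0 : ENNReal.ofReal (ρ z) ≠ 0 := by simpa using hz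
  have hPs : (ENNReal.ofReal (ρ z) ^ s) ^ p ≠ ⊤ :=
    ENNReal.rpow_ne_top_of_nonneg hp0 (by rw [ne_eq, ENNReal.rpow_eq_top_iff]; simp [hz.not_ge])
  have h2s : ((2 : ℝ≥0∞) ^ |s|) ^ p ≠ ⊤ :=
    ENNReal.rpow_ne_top_of_nonneg hp0 (ENNReal.rpow_ne_top_of_nonneg (abs_nonneg s) (by simp))
  rw [← lintegral_const_mul' _ _ hPs, ← lintegral_const_mul' _ _ h2s, ← lintegral_const_mul' _ _ h2s]
  constructor
  · refine setLIntegral_mono' hS fun x hx => ?_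
    obtain ⟨h1, h2⟩ := h x hx
    unfold GW
    rw [← ENNReal.mul_rpow_of_nonneg _ _ hp0, ← ENNReal.mul_rpow_of_nonneg _ _ hp0, ← mul_assoc]
    gcongr
    exact rpow_comp hz (by linarith) h2 h1 s
  · refine setLIntegral_mono' hS fun x hx => ?_
    obtain ⟨h1, h2⟩ := h x hx
    unfold GW
    rw [← ENNReal.mul_rpow_of_nonneg _ _ hp0, ← ENNReal.mul_rpow_of_nonneg _ _ hp0, ← mul_assoc]
    gcongr
    exact rpow_comp (by linarith) hz h1 h2 s

theorem eLp_ind {d : ℕ} {p : ℝ} (hp : 1 ≤ p) {S : Set (Ed d)} (hS : MeasurableSet S) (g : Ed d → ℝ) :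
    eLpNorm (S.indicator g) (ENNReal.ofReal p) volume = (∫⁻ x in S, ‖g x‖ₑ ^ p) ^ (1 / p) := by
  rw [eLpNorm_indicator_eq_eLpNorm_restrict hS, eLpNorm_eq_l hp]

theorem ball_comp {d : ℕ} {ρ : Ed d → ℝ} (hρ : IsWt d ρ) {z : Ed d} (hz : 0 < ρ z) :
    ∀ x ∈ closedBall z (ρ z / 4), ρ x ≤ 2 * ρ z ∧ ρ z ≤ 2 * ρ x := by
  intro x hx
  rw [mem_closedBall] at hx
  have h1 := hρ.2 x z
  have h2 := hρ.2 z x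
  rw [dist_comm] at h2
  constructor <;> linarith

/-- One-term bound. -/
theorem step1 {d : ℕ} {ρ : Ed d → ℝ} (hρ : IsWt d ρ) {p : ℝ} (hp : 1 ≤ p) (s κ : ℝ) (hs : |s| ≤ κ) {z : Ed d} (hz : 0 < ρ z) (g : Ed d → ℝ) :
    ENNReal.ofReal (ρ z) ^ s * eLpNorm ((closedBall z (ρ z / 4)).indicator g) (ENNReal.ofReal p) volume ≤
      2 ^ κ * (∫⁻ x in closedBall z (ρ z / 4), GW d ρ s p g x) ^ (1 / p) := by
  have hp0 : 0 < p := by linarith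
  have h := (wt_int hp s hz measurableSet_closedBall (ball_comp hρ hz) g).1
  have h1 := ENNReal.rpow_le_rpow h (z := 1 / p) (by positivity)
  have hX : ∀ X : ℝ≥0∞, (X ^ p) ^ (1 / p) = X := fun X => by
    rw [← ENNReal.rpow_mul, mul_one_div_cancel hp0.ne', ENNReal.rpow_one]
  rw [ENNReal.mul_rpow_of_nonneg _ _ (by positivity), ENNReal.mul_rpow_of_nonneg _ _ (by positivity), hX, hX] at h1
  rw [eLp_ind hp measurableSet_closedBall]
  refine h1.trans ?_
  gcongr
  norm_num

theorem alg_bound {ι : Type*} (I : Finset ι) (k : ι → ℕ) (m : ℕ) (hk : ∀ i ∈ I, k i ≤ m) (a δ : ℝ) {P R C Q K τ x : ℝ≥0∞}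
    (hP0 : P ≠ 0) (hPt : P ≠ ⊤) (hPR : P = 16 * R) (e : ι → ℝ≥0∞) (n : ℕ) (i : ι) (hi : i ∈ I)
    (h1 : ∀ j ∈ I, P ^ ((k j : ℝ) - a) * e j ≤ K * τ)
    (h2 : R ^ (k i) * x ≤ (C * R ^ (-δ)) ^ n * (Q * ∑ j ∈ I, R ^ (k j) * e j) ^ (n + 1)) :
    P ^ ((k i : ℝ) - (((n + 1 : ℕ) : ℝ) * a - δ * n)) * x ≤
      (16 ^ m * (1 + C * 16 ^ δ) * (Q * (I.card * K))) ^ (n + 1) * τ ^ (n + 1) := by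
  have hRP : R ≤ P := by
    rw [hPR]
    calc R = 1 * R := (one_mul R).symm
      _ ≤ 16 * R := by gcongr; norm_num
  have hsum : ∑ j ∈ I, R ^ (k j) * e j ≤ I.card * (P ^ a * (K * τ)) := by
    rw [← nsmul_eq_mul]
    refine Finset.sum_le_card_nsmul _ _ _ fun j hj => ?_
    calc R ^ (k j) * e j ≤ P ^ (k j) * e j := by gcongr
      _ = P ^ a * (P ^ ((k j : ℝ) - a) * e j) := by
        rw [← mul_assoc, ← ENNReal.rpow_add _ _ hP0 hPt, ← ENNReal.rpow_natCast]
        congr 2; ring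
      _ ≤ _ := mul_le_mul_right (h1 j hj) _
  have hα : P ^ (k i) ≤ 16 ^ m * R ^ (k i) := by
    rw [hPR, mul_pow]
    gcongr
    · norm_num
    · exact hk i hi
  have hR : R ^ (-δ) = 16 ^ δ * P ^ (-δ) := by
    rw [hPR, ENNReal.mul_rpow_of_ne_top (by norm_num) (by rintro rfl; simp [hPR] at hPt), ← mul_assoc,
      ← ENNReal.rpow_add _ _ (by norm_num) (by norm_num)]
    simp
  set b : ℝ := ((n + 1 : ℕ) : ℝ) * a - δ * n with hb
  have hPP : P ^ (-b) * ((P ^ (-δ)) ^ n * (P ^ a) ^ (n + 1)) = 1 := by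
    rw [← ENNReal.rpow_natCast, ← ENNReal.rpow_natCast, ← ENNReal.rpow_mul, ← ENNReal.rpow_mul, ← ENNReal.rpow_add _ _ hP0 hPt,
      ← ENNReal.rpow_add _ _ hP0 hPt]
    rw [show -b + (-δ * (n : ℝ) + a * ((n + 1 : ℕ) : ℝ)) = 0 by rw [hb]; ring, ENNReal.rpow_zero]
  calc P ^ ((k i : ℝ) - b) * x = P ^ (-b) * (P ^ (k i) * x) := by
        rw [← mul_assoc, ← ENNReal.rpow_natCast, ← ENNReal.rpow_add _ _ hP0 hPt]
        congr 2; ring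
    _ ≤ P ^ (-b) * (16 ^ m * R ^ (k i) * x) := by gcongr
    _ = P ^ (-b) * (16 ^ m * (R ^ (k i) * x)) := by rw [mul_assoc]
    _ ≤ P ^ (-b) * (16 ^ m * ((C * (16 ^ δ * P ^ (-δ))) ^ n * (Q * (I.card * (P ^ a * (K * τ)))) ^ (n + 1))) := by
        rw [← hR]
        refine mul_le_mul_right (mul_le_mul_right (h2.trans ?_) _) _
        gcongr
    _ = (P ^ (-b) * ((P ^ (-δ)) ^ n * (P ^ a) ^ (n + 1))) * (16 ^ m * (C * 16 ^ δ) ^ n * (Q * (I.card * K)) ^ (n + 1) * τ ^ (n + 1)) := by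
        simp only [mul_pow]
        ring
    _ = 16 ^ m * (C * 16 ^ δ) ^ n * (Q * (I.card * K)) ^ (n + 1) * τ ^ (n + 1) := by rw [hPP, one_mul]
    _ ≤ (16 ^ m) ^ (n + 1) * (1 + C * 16 ^ δ) ^ (n + 1) * (Q * (I.card * K)) ^ (n + 1) * τ ^ (n + 1) := by
        have g1 : (16 : ℝ≥0∞) ^ m ≤ (16 ^ m) ^ (n + 1) := le_self_pow₀ (one_le_pow₀ (by norm_num)) (by omega)
        have g2 : (C * 16 ^ δ) ^ n ≤ (1 + C * 16 ^ δ) ^ (n + 1) :=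
          calc (C * 16 ^ δ) ^ n ≤ (1 + C * 16 ^ δ) ^ n := by gcongr; exact le_add_self
            _ ≤ _ := pow_le_pow_right₀ le_self_add (by omega)
        exact mul_le_mul_left (mul_le_mul_left (mul_le_mul' g1 g2) _) _
    _ = _ := by simp only [mul_pow]

theorem GW_le_sum {d m : ℕ} (ρ : Ed d → ℝ) (a p : ℝ) (D : (Fin d → ℕ) → Ed d → ℝ) (S : Set (Ed d)) {β : Fin d → ℕ} (hβ : β ∈ multiIdx d m) :
    ∫⁻ x in S, GW d ρ (((∑ i, β i : ℕ) : ℝ) - a) p (D β) x ≤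
      ∫⁻ x in S, ∑ β ∈ multiIdx d m, GW d ρ (((∑ i, β i : ℕ) : ℝ) - a) p (D β) x := by
  refine lintegral_mono fun x => ?_
  exact Finset.single_le_sum (f := fun β : Fin d → ℕ => GW d ρ (((∑ i, β i : ℕ) : ℝ) - a) p (D β) x) (fun _ _ => zero_le) hβ

set_option maxHeartbeats 600000 in
/-- Local weighted estimate. -/
theorem local_wt {d m : ℕ} {ρ : Ed d → ℝ} (hρ : IsWt d ρ) {p : ℝ} (hp : 1 ≤ p) (a : ℝ) {C Cx : ℝ≥0∞} (hCt : C ≠ ⊤) (hC : AlgC d m p C)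
    (hCx : Cx ≠ ⊤) (hcut : ∀ (z : Ed d) r, 0 < r → ∃ χ, IsCut d m Cx z r χ) :
    ∃ A : ℝ≥0∞, A ≠ ⊤ ∧ ∀ (u : Ed d → ℝ) (D : (Fin d → ℕ) → Ed d → ℝ), (∀ β, Measurable (D β)) → (∀ β ∉ multiIdx d m, D β = 0) →
      IsWeakDerivFamily d {x | 0 < ρ x} m u D →
      (∫⁻ x in {x | 0 < ρ x}, ∑ β ∈ multiIdx d m, GW d ρ (((∑ i, β i : ℕ) : ℝ) - a) p (D β) x) ≠ ⊤ →
      ∀ (n : ℕ) (z : Ed d), 0 < ρ z → ∃ E : (Fin d → ℕ) → Ed d → ℝ, ∀ α ∈ multiIdx d m,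
        HasWeakDerivOn d (ball z (ρ z / 16)) α (fun x => u x ^ (n + 1)) (E α) ∧
        ∫⁻ x in ball z (ρ z / 16), GW d ρ (((∑ i, α i : ℕ) : ℝ) - (((n + 1 : ℕ) : ℝ) * a - (d : ℝ) / p * n)) p (E α) x ≤
          A ^ (n + 1) * (∫⁻ x in closedBall z (ρ z / 4), ∑ β ∈ multiIdx d m, GW d ρ (((∑ i, β i : ℕ) : ℝ) - a) p (D β) x) ^ (n + 1) := by
  have hp0 : 0 < p := by linarith
  set κ : ℝ := m + |a| with hκ
  have hκ0 : 0 ≤ κ := by positivity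
  have hδ : 0 ≤ (d : ℝ) / p := by positivity
  set H : ℝ≥0∞ := 16 ^ m * (1 + C * 16 ^ ((d : ℝ) / p)) * (QC d m Cx * ((multiIdx d m).card * 2 ^ κ)) with hH
  have h2κ : (2 : ℝ≥0∞) ^ κ ≠ ⊤ := ENNReal.rpow_ne_top_of_nonneg hκ0 (by simp)
  have h16 : (16 : ℝ≥0∞) ^ ((d : ℝ) / p) ≠ ⊤ := ENNReal.rpow_ne_top_of_nonneg hδ (by simp)
  have hHt : H ≠ ⊤ := by
    refine ENNReal.mul_ne_top (ENNReal.mul_ne_top (by simp) (ENNReal.add_ne_top.2 ⟨by simp, ENNReal.mul_ne_top hCt h16⟩))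
      (ENNReal.mul_ne_top (QC_ne_top d m hCx) (ENNReal.mul_ne_top (by simp) h2κ))
  set L : ℝ≥0∞ := 2 ^ (κ + (d : ℝ) / p) with hL
  have hLt : L ≠ ⊤ := ENNReal.rpow_ne_top_of_nonneg (by positivity) (by simp)
  refine ⟨(L * H) ^ p, ENNReal.rpow_ne_top_of_nonneg hp0.le (ENNReal.mul_ne_top hLt hHt), ?_⟩
  intro u D hDm hD0 hD hT n z hz
  set G : Ed d → ℝ≥0∞ := fun x => ∑ β ∈ multiIdx d m, GW d ρ (((∑ i, β i : ℕ) : ℝ) - a) p (D β) x with hG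
  set Tz := ∫⁻ x in closedBall z (ρ z / 4), G x with hTz
  have hsub : closedBall z (ρ z / 4) ⊆ {x | 0 < ρ x} := fun x hx => by
    have := (ball_comp hρ hz x hx).2
    simp only [mem_setOf_eq]; linarith
  have hTzt : Tz ≠ ⊤ := ((lintegral_mono_set hsub).trans_lt hT.lt_top).ne
  have habs : ∀ β ∈ multiIdx d m, |((∑ i, β i : ℕ) : ℝ) - a| ≤ κ := fun β hβ => by
    have : ((∑ i, β i : ℕ) : ℝ) ≤ m := by exact_mod_cast (mem_multiIdx.1 hβ)
    refine (abs_sub _ _).trans ?_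
    rw [abs_of_nonneg (by positivity)]
    linarith
  set P := ENNReal.ofReal (ρ z) with hP
  have hP0 : P ≠ 0 := by simpa [hP] using hz
  have hPt : P ≠ ⊤ := ENNReal.ofReal_ne_top
  set e : (Fin d → ℕ) → ℝ≥0∞ := fun β => eLpNorm ((closedBall z (ρ z / 4)).indicator (D β)) (ENNReal.ofReal p) volume with he
  have h1 : ∀ β ∈ multiIdx d m, P ^ (((∑ i, β i : ℕ) : ℝ) - a) * e β ≤ 2 ^ κ * Tz ^ (1 / p) := fun β hβ => by
    refine (step1 hρ hp _ κ (habs β hβ) hz (D β)).trans ?_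
    exact mul_le_mul_right (ENNReal.rpow_le_rpow (GW_le_sum ρ a p D _ hβ) (by positivity)) _
  have hMem : ∀ β, MemLp ((closedBall z (4 * (ρ z / 16))).indicator (D β)) (ENNReal.ofReal p) volume := fun β => by
    rw [show 4 * (ρ z / 16) = ρ z / 4 by ring]
    by_cases hβ : β ∈ multiIdx d m
    · refine ⟨((hDm β).indicator measurableSet_closedBall).aestronglyMeasurable, ?_⟩
      have hfin : P ^ (((∑ i, β i : ℕ) : ℝ) - a) * e β < ⊤ := (h1 β hβ).trans_lt
        (ENNReal.mul_ne_top h2κ (ENNReal.rpow_ne_top_of_nonneg (by positivity) hTzt)).lt_top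
      by_contra hcon
      rw [not_lt, top_le_iff] at hcon
      rw [he] at hfin
      simp only [hcon] at hfin
      rw [ENNReal.mul_top] at hfin
      · exact lt_irrefl _ hfin
      · rw [ne_eq, ENNReal.rpow_eq_zero_iff]
        simp [hP0, hPt]
    · rw [hD0 β hβ, indicator_zero']
      exact MemLp.zero
  obtain ⟨χ, hχ⟩ := hcut z (ρ z / 16) (by positivity)
  have hΩ : IsOpen {x | 0 < ρ x} := isOpen_lt continuous_const hρ.1
  have hu : LocallyIntegrableOn u {x | 0 < ρ x} volume := (hD 0 (zero_mem_multiIdx d m)).1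
  obtain ⟨E, hE⟩ := local_pow hp hCt hC hCx (by positivity) hχ hΩ hu hD
    (by rw [show 4 * (ρ z / 16) = ρ z / 4 by ring]; exact hsub) hMem n
  refine ⟨E, fun α hα => ⟨(hE α hα).1, ?_⟩⟩
  have h2 := (hE α hα).2.2
  rw [show 4 * (ρ z / 16) = ρ z / 4 by ring] at h2
  have h3 := alg_bound (multiIdx d m) (fun β => ∑ i, β i) m (fun β hβ => mem_multiIdx.1 hβ) a ((d : ℝ) / p) hP0 hPt
    (by rw [hP, show (16 : ℝ≥0∞) = ENNReal.ofReal 16 by simp, ← ENNReal.ofReal_mul (by norm_num)]; congr 1; ring) e n α hα h1 h2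
  set s : ℝ := ((∑ i, α i : ℕ) : ℝ) - (((n + 1 : ℕ) : ℝ) * a - (d : ℝ) / p * n) with hs
  have hsabs : |s| ≤ (κ + (d : ℝ) / p) * ((n + 1 : ℕ) : ℝ) := by
    have hm1 : ((∑ i, α i : ℕ) : ℝ) ≤ m := by exact_mod_cast (mem_multiIdx.1 hα)
    have hm0 : (0 : ℝ) ≤ ((∑ i, α i : ℕ) : ℝ) := by positivity
    have hn : (0 : ℝ) ≤ n := by positivity
    have ha1 := neg_abs_le a
    have ha2 := le_abs_self a
    have hm2 : (0 : ℝ) ≤ m := by positivity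
    have q1 := mul_nonneg hn hδ
    have q2 := mul_nonneg hn hm2
    rw [hs, hκ, abs_le]
    push_cast at *
    constructor <;> nlinarith
  have h4 := (wt_int hp s hz (measurableSet_ball (x := z) (ε := ρ z / 16))
    (fun x hx => ball_comp hρ hz x (ball_subset_closedBall.trans (closedBall_subset_closedBall (by linarith)) hx)) (E α)).2
  have h5 : ∫⁻ x in ball z (ρ z / 16), ‖E α x‖ₑ ^ p ≤ (eLpNorm (E α) (ENNReal.ofReal p) volume) ^ p := by
    rw [eLpNorm_eq_l hp, ← ENNReal.rpow_mul, one_div_mul_cancel hp0.ne', ENNReal.rpow_one]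
    exact setLIntegral_le_lintegral _ _
  have hL2 : (2 : ℝ≥0∞) ^ |s| ≤ L ^ (n + 1) := by
    rw [hL, ← ENNReal.rpow_natCast, ← ENNReal.rpow_mul]
    exact ENNReal.rpow_le_rpow_of_exponent_le (by norm_num) hsabs
  have hpp : ∀ (X : ℝ≥0∞) (k : ℕ), (X ^ k) ^ p = (X ^ p) ^ k := fun X k => by
    rw [← ENNReal.rpow_natCast, ← ENNReal.rpow_natCast, ← ENNReal.rpow_mul, ← ENNReal.rpow_mul, mul_comm]
  calc _ ≤ (2 ^ |s|) ^ p * ((P ^ s) ^ p * ∫⁻ x in ball z (ρ z / 16), ‖E α x‖ₑ ^ p) := h4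
    _ ≤ (L ^ (n + 1)) ^ p * ((P ^ s) ^ p * (eLpNorm (E α) (ENNReal.ofReal p) volume) ^ p) := by gcongr
    _ = (L ^ (n + 1)) ^ p * (P ^ s * eLpNorm (E α) (ENNReal.ofReal p) volume) ^ p := by rw [ENNReal.mul_rpow_of_nonneg _ _ hp0.le]
    _ ≤ (L ^ (n + 1)) ^ p * (H ^ (n + 1) * (Tz ^ (1 / p)) ^ (n + 1)) ^ p := by gcongr
    _ = ((L * H) ^ p) ^ (n + 1) * Tz ^ (n + 1) := by
      rw [ENNReal.mul_rpow_of_nonneg _ _ hp0.le, ENNReal.mul_rpow_of_nonneg _ _ hp0.le, hpp, hpp, hpp, ← ENNReal.rpow_mul Tz,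
        one_div_mul_cancel hp0.ne', ENNReal.rpow_one, mul_pow, mul_assoc]

theorem meas_rep {d : ℕ} {Ω : Set (Ed d)} (hΩ : IsOpen Ω) {α : Fin d → ℕ} {u v : Ed d → ℝ} (h : HasWeakDerivOn d Ω α u v) :
    ∃ w, Measurable w ∧ v =ᵐ[volume.restrict Ω] w ∧ HasWeakDerivOn d Ω α u w := by
  have hm : AEStronglyMeasurable v (volume.restrict Ω) := h.2.1.aestronglyMeasurable
  exact ⟨hm.mk v, hm.stronglyMeasurable_mk.measurable, hm.ae_eq_mk,
    weak_congr hΩ.measurableSet (ae_eq_refl _) hm.ae_eq_mk h⟩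

theorem GW_congr {d : ℕ} {ρ : Ed d → ℝ} (s p : ℝ) {g h : Ed d → ℝ} {S : Set (Ed d)} (e : g =ᵐ[volume.restrict S] h) :
    ∫⁻ x in S, GW d ρ s p g x = ∫⁻ x in S, GW d ρ s p h x := by
  refine lintegral_congr_ae (e.mono fun x hx => ?_)
  simp only [GW, hx]

theorem global_wt {d m : ℕ} {ρ : Ed d → ℝ} (hρ : IsWt d ρ) (hd : 0 < d) {p : ℝ} (hp : 1 ≤ p) (a : ℝ)
    (halg : (1 < p ∧ (d : ℝ) / p < m) ∨ (p = 1 ∧ d ≤ m)) :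
    ∃ A : ℝ≥0∞, A ≠ ⊤ ∧ ∀ (u : Ed d → ℝ) (D : (Fin d → ℕ) → Ed d → ℝ), (∀ β, Measurable (D β)) → (∀ β ∉ multiIdx d m, D β = 0) →
      IsWeakDerivFamily d {x | 0 < ρ x} m u D →
      (∫⁻ x in {x | 0 < ρ x}, ∑ β ∈ multiIdx d m, GW d ρ (((∑ i, β i : ℕ) : ℝ) - a) p (D β) x) ≠ ⊤ →
      ∀ n : ℕ, 1 ≤ n → ∃ E : (Fin d → ℕ) → Ed d → ℝ, (∀ α, Measurable (E α)) ∧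
        IsWeakDerivFamily d {x | 0 < ρ x} m (fun x => u x ^ (n + 1)) E ∧
        ∑ α ∈ multiIdx d m, ∫⁻ x in {x | 0 < ρ x}, GW d ρ (((∑ i, α i : ℕ) : ℝ) - (((n + 1 : ℕ) : ℝ) * a - (d : ℝ) / p * n)) p (E α) x ≤
          A ^ n * (∫⁻ x in {x | 0 < ρ x}, ∑ β ∈ multiIdx d m, GW d ρ (((∑ i, β i : ℕ) : ℝ) - a) p (D β) x) ^ (n + 1) := by
  obtain ⟨C, hCt, hC⟩ := algC_exists hd hp halg
  obtain ⟨Cx, hCx, hcut⟩ := cut_exists d m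
  obtain ⟨A, hA, hloc⟩ := local_wt hρ hp a hCt hC hCx hcut
  obtain ⟨C1, hC1, hlow⟩ := avg_lower hρ
  obtain ⟨C2, hC2, hup⟩ := avg_upper hρ
  have hΩ : IsOpen {x | 0 < ρ x} := isOpen_lt continuous_const hρ.1
  set B : ℝ≥0∞ := 1 + (multiIdx d m).card * (C1 * C2 * A) with hB
  have hBt : B ≠ ⊤ := ENNReal.add_ne_top.2 ⟨by simp, ENNReal.mul_ne_top (by simp) (ENNReal.mul_ne_top (ENNReal.mul_ne_top hC1 hC2) hA)⟩
  refine ⟨B * A, ENNReal.mul_ne_top hBt hA, ?_⟩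
  intro u D hDm hD0 hD hT n hn
  set G : Ed d → ℝ≥0∞ := fun x => ∑ β ∈ multiIdx d m, GW d ρ (((∑ i, β i : ℕ) : ℝ) - a) p (D β) x with hG
  have hGm : Measurable G := Finset.measurable_sum _ fun β _ => GW_meas hρ.1 _ _ (hDm β)
  set T := ∫⁻ x in {x | 0 < ρ x}, G x with hTdef
  have hL := hloc u D hDm hD0 hD hT n
  have hsub : ∀ z, 0 < ρ z → closedBall z (ρ z / 4) ⊆ {x | 0 < ρ x} := fun z hz x hx => by
    have := (ball_comp hρ hz x hx).2
    show 0 < ρ x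
    linarith
  have hsub' : ∀ z, 0 < ρ z → ball z (ρ z / 16) ⊆ {x | 0 < ρ x} := fun z hz =>
    (ball_subset_closedBall.trans (closedBall_subset_closedBall (by linarith))).trans (hsub z hz)
  have hex : ∀ α : Fin d → ℕ, ∃ w : Ed d → ℝ, Measurable w ∧ (α ∈ multiIdx d m → HasWeakDerivOn d {x | 0 < ρ x} α (fun x => u x ^ (n + 1)) w) := by
    intro α
    by_cases hα : α ∈ multiIdx d m
    · obtain ⟨v, hv⟩ : ∃ v, HasWeakDerivOn d {x | 0 < ρ x} α (fun x => u x ^ (n + 1)) v := by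
        refine weak_glue_exists fun z hz => ?_
        have hz : 0 < ρ z := hz
        obtain ⟨E, hE⟩ := hL z hz
        exact ⟨ρ z / 16, by positivity, hsub' z hz, E α, (hE α hα).1⟩
      obtain ⟨w, h1, -, h2⟩ := meas_rep hΩ hv
      exact ⟨w, h1, fun _ => h2⟩
    · exact ⟨0, measurable_zero, fun h => absurd h hα⟩
  choose E hEm hEw using hex
  refine ⟨E, hEm, fun α hα => hEw α hα, ?_⟩
  have hterm : ∀ α ∈ multiIdx d m,
      ∫⁻ x in {x | 0 < ρ x}, GW d ρ (((∑ i, α i : ℕ) : ℝ) - (((n + 1 : ℕ) : ℝ) * a - (d : ℝ) / p * n)) p (E α) x ≤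
        C1 * (C2 * A ^ (n + 1) * T ^ (n + 1)) := by
    intro α hα
    refine (hlow _ (GW_meas hρ.1 _ _ (hEm α))).trans (mul_le_mul_right ?_ _)
    have hK : A ^ (n + 1) * T ^ n ≠ ⊤ := ENNReal.mul_ne_top (ENNReal.pow_ne_top hA) (ENNReal.pow_ne_top hT)
    calc _ ≤ ∫⁻ z in {x | 0 < ρ x}, (A ^ (n + 1) * T ^ n) * (ENNReal.ofReal (ρ z) ^ (-(d : ℝ)) * ∫⁻ x in closedBall z (ρ z / 4), G x) := by
          refine setLIntegral_mono' hΩ.measurableSet fun z hz => ?_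
          have hz : 0 < ρ z := hz
          obtain ⟨E', hE'⟩ := hL z hz
          have heq := weak_unique isOpen_ball (weak_restrict (hsub' z hz) (hEw α hα)) (hE' α hα).1
          rw [GW_congr _ _ heq]
          have hTz : ∫⁻ x in closedBall z (ρ z / 4), G x ≤ T := lintegral_mono_set (hsub z hz)
          calc _ ≤ ENNReal.ofReal (ρ z) ^ (-(d : ℝ)) * (A ^ (n + 1) * (∫⁻ x in closedBall z (ρ z / 4), G x) ^ (n + 1)) :=
                mul_le_mul_right (hE' α hα).2 _
            _ ≤ ENNReal.ofReal (ρ z) ^ (-(d : ℝ)) * (A ^ (n + 1) * (T ^ n * ∫⁻ x in closedBall z (ρ z / 4), G x)) := by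
                refine mul_le_mul_right (mul_le_mul_right ?_ _) _
                rw [pow_succ]
                exact mul_le_mul_left (pow_le_pow_left₀ zero_le hTz n) _
            _ = _ := by ring
      _ = (A ^ (n + 1) * T ^ n) * ∫⁻ z in {x | 0 < ρ x}, ENNReal.ofReal (ρ z) ^ (-(d : ℝ)) * ∫⁻ x in closedBall z (ρ z / 4), G x :=
          lintegral_const_mul' _ _ hK
      _ ≤ (A ^ (n + 1) * T ^ n) * (C2 * T) := mul_le_mul_right (hup G hGm) _
      _ = _ := by ring
  calc _ ≤ (multiIdx d m).card • (C1 * (C2 * A ^ (n + 1) * T ^ (n + 1))) := Finset.sum_le_card_nsmul _ _ _ hterm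
    _ = ((multiIdx d m).card * (C1 * C2 * A)) * (A ^ n * T ^ (n + 1)) := by rw [nsmul_eq_mul]; ring
    _ ≤ B ^ n * (A ^ n * T ^ (n + 1)) := by
      refine mul_le_mul_left ?_ _
      calc _ ≤ B := le_add_self
        _ ≤ B ^ n := le_self_pow₀ le_self_add (by omega)
    _ = _ := by rw [mul_pow]; ring

/-- Projection onto the first `d - ℓ` coordinates. -/
def maskE (d ℓ : ℕ) (x : Ed d) : Ed d := WithLp.toLp 2 fun i : Fin d => if (i : ℕ) < d - ℓ then x i else 0

theorem maskE_norm (d ℓ : ℕ) (x : Ed d) :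
    Real.sqrt (∑ i ∈ Finset.univ.filter (fun i : Fin d => (i : ℕ) < d - ℓ), (x i) ^ 2) = ‖maskE d ℓ x‖ := by
  rw [EuclideanSpace.norm_eq, Finset.sum_filter]
  congr 1
  refine Finset.sum_congr rfl fun i _ => ?_
  simp only [maskE]
  split_ifs <;> simp

theorem maskE_le (d ℓ : ℕ) (x : Ed d) : ‖maskE d ℓ x‖ ≤ ‖x‖ := by
  rw [← maskE_norm, EuclideanSpace.norm_eq]
  refine Real.sqrt_le_sqrt ?_
  simp only [Real.norm_eq_abs, sq_abs]
  exact Finset.sum_le_univ_sum_of_nonneg fun i => sq_nonneg _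

theorem maskE_sub (d ℓ : ℕ) (x y : Ed d) : maskE d ℓ x - maskE d ℓ y = maskE d ℓ (x - y) := by
  ext i
  simp only [maskE, PiLp.sub_apply]
  split_ifs <;> simp

theorem rho_eq (d ℓ : ℕ) (x : Ed d) : rhoModel d ℓ x = min 1 ‖maskE d ℓ x‖ := by
  rw [rhoModel, maskE_norm]

theorem rho_isWt (d ℓ : ℕ) : IsWt d (rhoModel d ℓ) := by
  have h2 : ∀ x y : Ed d, rhoModel d ℓ x ≤ rhoModel d ℓ y + dist x y := by
    intro x y
    rw [rho_eq, rho_eq]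
    have h1 : ‖maskE d ℓ x‖ ≤ ‖maskE d ℓ y‖ + dist x y := by
      have e1 := norm_sub_norm_le (maskE d ℓ x) (maskE d ℓ y)
      rw [maskE_sub] at e1
      have e2 := maskE_le d ℓ (x - y)
      rw [dist_eq_norm]
      linarith
    have h0 : 0 ≤ dist x y := dist_nonneg
    rcases min_cases 1 ‖maskE d ℓ y‖ with h | h
    · rw [h.1]; exact (min_le_left _ _).trans (by linarith)
    · rw [h.1]; exact (min_le_right _ _).trans h1
  refine ⟨?_, h2⟩
  refine (LipschitzWith.of_le_add (f := rhoModel d ℓ) h2).continuous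

theorem model_eq (d ℓ : ℕ) : ModelDomain d ℓ = {x | 0 < rhoModel d ℓ x} := by
  ext x
  have h1 : x ∈ ModelDomain d ℓ ↔ ¬ ∀ i : Fin d, (i : ℕ) < d - ℓ → x i = 0 := Iff.rfl
  have h2 : x ∈ {x | 0 < rhoModel d ℓ x} ↔ 0 < rhoModel d ℓ x := Iff.rfl
  rw [h1, h2, rho_eq, lt_min_iff, norm_pos_iff]
  have h3 : maskE d ℓ x = 0 ↔ ∀ i : Fin d, (i : ℕ) < d - ℓ → x i = 0 := by
    constructor
    · intro h i hi
      have : maskE d ℓ x i = 0 := by rw [h]; rfl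
      simpa [maskE, hi] using this
    · intro h
      ext i
      simp only [maskE]
      split_ifs with hi
      · simpa using h i hi
      · simp
  rw [← h3]
  simp

theorem kI_ofReal {d : ℕ} {ρ : Ed d → ℝ} {p : ℝ} (hp : 1 ≤ p) (a : ℝ) (α : Fin d → ℕ) (v : Ed d → ℝ) {x : Ed d} (hx : 0 < ρ x) :
    ENNReal.ofReal (kIntegrand d ρ a p α v x) = GW d ρ (((∑ i, α i : ℕ) : ℝ) - a) p v x := by
  unfold kIntegrand GW
  rw [← ENNReal.ofReal_rpow_of_nonneg (by positivity) (by linarith), ENNReal.ofReal_mul (by positivity),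
    ENNReal.ofReal_rpow_of_pos hx, ← Real.norm_eq_abs, ofReal_norm]

theorem kI_nonneg {d : ℕ} {ρ : Ed d → ℝ} (p a : ℝ) (α : Fin d → ℕ) (v : Ed d → ℝ) {x : Ed d} (hx : 0 < ρ x) :
    0 ≤ kIntegrand d ρ a p α v x := by
  unfold kIntegrand
  positivity

theorem kI_meas {d : ℕ} {ρ : Ed d → ℝ} (hρ : Continuous ρ) (p a : ℝ) (α : Fin d → ℕ) {v : Ed d → ℝ} (hv : Measurable v) :
    Measurable (kIntegrand d ρ a p α v) :=
  ((hρ.measurable.pow_const _).mul hv.abs).pow_const p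

theorem kI_lint {d : ℕ} {ρ : Ed d → ℝ} (hρ : Continuous ρ) {p : ℝ} (hp : 1 ≤ p) (a : ℝ) (α : Fin d → ℕ) (v : Ed d → ℝ) :
    ∫⁻ x in {x | 0 < ρ x}, ENNReal.ofReal (kIntegrand d ρ a p α v x) = ∫⁻ x in {x | 0 < ρ x}, GW d ρ (((∑ i, α i : ℕ) : ℝ) - a) p v x :=
  setLIntegral_congr_fun (isOpen_lt continuous_const hρ).measurableSet fun _ hx => kI_ofReal hp a α v hx

theorem kI_int {d : ℕ} {ρ : Ed d → ℝ} (hρ : Continuous ρ) {p : ℝ} (hp : 1 ≤ p) (a : ℝ) (α : Fin d → ℕ) {v : Ed d → ℝ} (hv : Measurable v) :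
    ∫ x in {x | 0 < ρ x}, kIntegrand d ρ a p α v x = (∫⁻ x in {x | 0 < ρ x}, GW d ρ (((∑ i, α i : ℕ) : ℝ) - a) p v x).toReal := by
  rw [integral_eq_lintegral_of_nonneg_ae, kI_lint hρ hp]
  · exact ae_restrict_of_forall_mem (isOpen_lt continuous_const hρ).measurableSet fun x hx => kI_nonneg p a α v hx
  · exact (kI_meas hρ p a α hv).aestronglyMeasurable

theorem kI_integrable {d : ℕ} {ρ : Ed d → ℝ} (hρ : Continuous ρ) {p : ℝ} (hp : 1 ≤ p) (a : ℝ) (α : Fin d → ℕ) {v : Ed d → ℝ} (hv : Measurable v) :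
    IntegrableOn (kIntegrand d ρ a p α v) {x | 0 < ρ x} volume ↔
      ∫⁻ x in {x | 0 < ρ x}, GW d ρ (((∑ i, α i : ℕ) : ℝ) - a) p v x ≠ ⊤ := by
  rw [← kI_lint hρ hp, IntegrableOn, ← lintegral_ofReal_ne_top_iff_integrable]
  · exact (kI_meas hρ p a α hv).aestronglyMeasurable
  · exact ae_restrict_of_forall_mem (isOpen_lt continuous_const hρ).measurableSet fun x hx => kI_nonneg p a α v hx

theorem kI_congr {d : ℕ} {ρ : Ed d → ℝ} (a p : ℝ) (α : Fin d → ℕ) {v w : Ed d → ℝ} {Ω : Set (Ed d)} (h : v =ᵐ[volume.restrict Ω] w) :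
    kIntegrand d ρ a p α v =ᵐ[volume.restrict Ω] kIntegrand d ρ a p α w :=
  h.mono fun x hx => by simp only [kIntegrand, hx]

/-- The norm does not depend on the choice of the weak derivatives. -/
theorem Knorm_eq {d m : ℕ} {Ω : Set (Ed d)} (hΩ : IsOpen Ω) {ρ : Ed d → ℝ} {a p : ℝ} {u : Ed d → ℝ} {D : (Fin d → ℕ) → Ed d → ℝ}
    (h : KMemData d Ω ρ m a p u D) : Knorm d Ω ρ m a p u = KnormP d Ω ρ m a p D := by
  have hM : MemK d Ω ρ m a p u := ⟨D, h⟩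
  rw [Knorm, dif_pos hM]
  unfold KnormP
  congr 1
  refine Finset.sum_congr rfl fun α hα => ?_
  exact integral_congr_ae (kI_congr a p α (weak_unique hΩ (hM.choose_spec.1 α hα) (h.1 α hα)))

/-- Measurable data. -/
theorem meas_data {d m : ℕ} {Ω : Set (Ed d)} (hΩ : IsOpen Ω) {ρ : Ed d → ℝ} {a p : ℝ} {u : Ed d → ℝ} (h : MemK d Ω ρ m a p u) :
    ∃ D : (Fin d → ℕ) → Ed d → ℝ, (∀ β, Measurable (D β)) ∧ (∀ β ∉ multiIdx d m, D β = 0) ∧ KMemData d Ω ρ m a p u D := by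
  obtain ⟨D₀, hD₀, hI⟩ := h
  have hex : ∀ β : Fin d → ℕ, ∃ w : Ed d → ℝ, Measurable w ∧ (β ∉ multiIdx d m → w = 0) ∧
      (β ∈ multiIdx d m → HasWeakDerivOn d Ω β u w ∧ IntegrableOn (kIntegrand d ρ a p β w) Ω volume) := by
    intro β
    by_cases hβ : β ∈ multiIdx d m
    · obtain ⟨w, h1, h2, h3⟩ := meas_rep hΩ (hD₀ β hβ)
      exact ⟨w, h1, fun h => absurd hβ h, fun _ => ⟨h3, (hI β hβ).congr (kI_congr a p β h2)⟩⟩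
    · exact ⟨0, measurable_zero, fun _ => rfl, fun h => absurd h hβ⟩
  choose D h1 h2 h3 using hex
  exact ⟨D, h1, h2, fun β hβ => (h3 β hβ).1, fun β hβ => (h3 β hβ).2⟩

theorem power_est {d m : ℕ} {ρ : Ed d → ℝ} (hρ : IsWt d ρ) (hd : 0 < d) {p : ℝ} (hp : 1 ≤ p) (a : ℝ)
    (halg : (1 < p ∧ (d : ℝ) / p < m) ∨ (p = 1 ∧ d ≤ m)) :
    ∃ c : ℝ, 0 < c ∧ ∀ n : ℕ, 1 ≤ n → ∀ u : Ed d → ℝ, MemK d {x | 0 < ρ x} ρ m a p u →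
      MemK d {x | 0 < ρ x} ρ m (((n + 1 : ℕ) : ℝ) * a - (d : ℝ) / p * n) p (fun x => u x ^ (n + 1)) ∧
      Knorm d {x | 0 < ρ x} ρ m (((n + 1 : ℕ) : ℝ) * a - (d : ℝ) / p * n) p (fun x => u x ^ (n + 1)) ≤
        c ^ n * Knorm d {x | 0 < ρ x} ρ m a p u ^ (n + 1) := by
  have hp0 : 0 < p := by linarith
  obtain ⟨A, hA, hmain⟩ := global_wt hρ hd hp a halg
  have hΩ : IsOpen {x | 0 < ρ x} := isOpen_lt continuous_const hρ.1
  have hc0 : 0 ≤ A.toReal ^ (1 / p) := by positivity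
  refine ⟨A.toReal ^ (1 / p) + 1, by positivity, ?_⟩
  intro n hn u hu
  obtain ⟨D, hDm, hD0, hD⟩ := meas_data hΩ hu
  have hTeq : (∫⁻ x in {x | 0 < ρ x}, ∑ β ∈ multiIdx d m, GW d ρ (((∑ i, β i : ℕ) : ℝ) - a) p (D β) x) =
      ∑ β ∈ multiIdx d m, ∫⁻ x in {x | 0 < ρ x}, GW d ρ (((∑ i, β i : ℕ) : ℝ) - a) p (D β) x :=
    lintegral_finset_sum _ fun β _ => GW_meas hρ.1 _ _ (hDm β)
  have hfin : ∀ β ∈ multiIdx d m, ∫⁻ x in {x | 0 < ρ x}, GW d ρ (((∑ i, β i : ℕ) : ℝ) - a) p (D β) x ≠ ⊤ :=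
    fun β hβ => (kI_integrable hρ.1 hp a β (hDm β)).1 (hD.2 β hβ)
  have hT : (∫⁻ x in {x | 0 < ρ x}, ∑ β ∈ multiIdx d m, GW d ρ (((∑ i, β i : ℕ) : ℝ) - a) p (D β) x) ≠ ⊤ := by
    rw [hTeq]
    exact (ENNReal.sum_lt_top.2 fun β hβ => (hfin β hβ).lt_top).ne
  obtain ⟨E, hEm, hEw, hE⟩ := hmain u D hDm hD0 hD.1 hT n hn
  set T := ∫⁻ x in {x | 0 < ρ x}, ∑ β ∈ multiIdx d m, GW d ρ (((∑ i, β i : ℕ) : ℝ) - a) p (D β) x with hTd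
  set b : ℝ := ((n + 1 : ℕ) : ℝ) * a - (d : ℝ) / p * n with hb
  have hRt : A ^ n * T ^ (n + 1) ≠ ⊤ := ENNReal.mul_ne_top (ENNReal.pow_ne_top hA) (ENNReal.pow_ne_top hT)
  have hSt := (hE.trans_lt hRt.lt_top)
  have hfinE : ∀ α ∈ multiIdx d m, ∫⁻ x in {x | 0 < ρ x}, GW d ρ (((∑ i, α i : ℕ) : ℝ) - b) p (E α) x ≠ ⊤ :=
    fun α hα => (ENNReal.sum_lt_top.1 hSt α hα).ne
  have hdata : KMemData d {x | 0 < ρ x} ρ m b p (fun x => u x ^ (n + 1)) E :=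
    ⟨hEw, fun α hα => (kI_integrable hρ.1 hp b α (hEm α)).2 (hfinE α hα)⟩
  refine ⟨⟨E, hdata⟩, ?_⟩
  rw [Knorm_eq hΩ hdata, Knorm_eq hΩ hD]
  unfold KnormP
  have e1 : ∑ α ∈ multiIdx d m, ∫ x in {x | 0 < ρ x}, kIntegrand d ρ b p α (E α) x =
      (∑ α ∈ multiIdx d m, ∫⁻ x in {x | 0 < ρ x}, GW d ρ (((∑ i, α i : ℕ) : ℝ) - b) p (E α) x).toReal := by
    rw [ENNReal.toReal_sum hfinE]
    exact Finset.sum_congr rfl fun α _ => kI_int hρ.1 hp b α (hEm α)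
  have e2 : ∑ β ∈ multiIdx d m, ∫ x in {x | 0 < ρ x}, kIntegrand d ρ a p β (D β) x = T.toReal := by
    rw [hTeq, ENNReal.toReal_sum hfin]
    exact Finset.sum_congr rfl fun α _ => kI_int hρ.1 hp a α (hDm α)
  rw [e1, e2]
  have hpp : ∀ (X : ℝ) (k : ℕ), 0 ≤ X → (X ^ k) ^ (1 / p) = (X ^ (1 / p)) ^ k := fun X k hX => by
    rw [← Real.rpow_natCast, ← Real.rpow_natCast, ← Real.rpow_mul hX, ← Real.rpow_mul hX, mul_comm]
  calc _ ≤ ((A ^ n * T ^ (n + 1)).toReal) ^ (1 / p) :=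
        Real.rpow_le_rpow ENNReal.toReal_nonneg (ENNReal.toReal_mono hRt hE) (by positivity)
    _ = (A.toReal ^ (1 / p)) ^ n * (T.toReal ^ (1 / p)) ^ (n + 1) := by
        rw [ENNReal.toReal_mul, ENNReal.toReal_pow, ENNReal.toReal_pow, Real.mul_rpow (by positivity) (by positivity),
          hpp _ _ ENNReal.toReal_nonneg, hpp _ _ ENNReal.toReal_nonneg]
    _ ≤ _ := by
        refine mul_le_mul_of_nonneg_right ?_ (by positivity)
        exact pow_le_pow_left₀ hc0 (by linarith) n

/-- Corollary `power1`(i): if either `1 < p < ∞` and `m > d/p`, or `p = 1` and `m ≥ d`,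
then for all `n > 1` and all `u ∈ 𝒦^m_{a,p}(ℝ^d, ℝ^ℓ_*)` one has
`u^n ∈ 𝒦^m_{na - d(n-1)/p, p}(ℝ^d, ℝ^ℓ_*)` with
`‖u^n‖ ≤ c^{n-1} ‖u|𝒦^m_{a,p}‖^n`, `c` independent of `u` and `n`. -/
theorem statement16 (d ℓ m : ℕ) (hd : 2 ≤ d) (hl : ℓ < d) (hm : 1 ≤ m)
    (a p : ℝ) (hp : 1 ≤ p)
    (halg : (1 < p ∧ (d : ℝ) / p < m) ∨ (p = 1 ∧ d ≤ m)) :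
    ∃ c : ℝ, 0 < c ∧ ∀ n : ℕ, 1 < n → ∀ u : Ed d → ℝ, MemKM d ℓ m a p u →
      MemKM d ℓ m ((n : ℝ) * a - d * ((n : ℝ) - 1) / p) p (fun x => u x ^ n) ∧
      KnormM d ℓ m ((n : ℝ) * a - d * ((n : ℝ) - 1) / p) p (fun x => u x ^ n) ≤
        c ^ (n - 1) * KnormM d ℓ m a p u ^ n := by
  obtain ⟨c, hc, H⟩ := power_est (rho_isWt d ℓ) (by omega) hp a halg
  refine ⟨c, hc, ?_⟩
  intro n hn u hu
  obtain ⟨k, rfl⟩ : ∃ k, n = k + 1 := ⟨n - 1, by omega⟩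
  unfold MemKM at hu
  unfold MemKM KnormM
  rw [model_eq] at hu
  have h := H k (by omega) u hu
  have e : ((k + 1 : ℕ) : ℝ) * a - d * (((k + 1 : ℕ) : ℝ) - 1) / p = ((k + 1 : ℕ) : ℝ) * a - (d : ℝ) / p * k := by
    push_cast; ring
  rw [e, model_eq, Nat.add_sub_cancel]
  exact h

end
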